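/- There exists a constant c > 0, depending only on d and κ, such that for all integers n ≥ 1 and all x, y ∈ S^d the reproducing kernel satisfies |P_n(h_κ²;x,y)| ≤ c n^{(d−1)/2} (‖x̄ − ȳ‖ + n^{−1})^{−(d−1)/2} ∏_{j=1}^{d+1}(|x_j y_j| + n^{−1}‖x̄ − ȳ‖ + n^{−2})^{−κ_j}. -/

import Mathlib

open MeasureTheory Finset Real

/-- Generalized binomial coefficient `C(x, k) = x (x-1) ⋯ (x-k+1) / k!`. -/
noncomputable def genBinom (x : ℝ) (k : ℕ) : ℝ :=
  (∏ i ∈ Finset.range k, (x - i)) / (Nat.factorial k)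

/-- Jacobi polynomial `P_n^{(a,b)}(t)`. -/
noncomputable def jacobiP (n : ℕ) (a b t : ℝ) : ℝ :=
  ∑ m ∈ Finset.range (n + 1),
    genBinom (n + a) (n - m) * genBinom (n + b) m * ((t - 1) / 2) ^ m * ((t + 1) / 2) ^ (n - m)

/-- Pochhammer symbol `(a)_n`. -/
noncomputable def poch (a : ℝ) (n : ℕ) : ℝ := ∏ i ∈ Finset.range n, (a + i)

/-- Gegenbauer polynomial `C_n^λ(t)`. -/
noncomputable def gegenC (n : ℕ) (l t : ℝ) : ℝ :=
  (poch (2 * l) n / poch (l + 1 / 2) n) * jacobiP n (l - 1 / 2) (l - 1 / 2) t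

/-- Cesàro coefficient `A_m^δ = C(m+δ, m)`. -/
noncomputable def cesA (δ : ℝ) (m : ℕ) : ℝ := genBinom (m + δ) m

/-- The cube `[-1,1]^m`. -/
def cube (m : ℕ) : Set (Fin m → ℝ) := Set.univ.pi fun _ => Set.Icc (-1) 1

/-- The weight `∏ (1+t_i)(1-t_i²)^{κ_i-1}` on the cube. -/
noncomputable def wprod {m : ℕ} (κ : Fin m → ℝ) (t : Fin m → ℝ) : ℝ :=
  ∏ i, (1 + t i) * (1 - t i ^ 2) ^ (κ i - 1)

/-- `λ_κ = |κ| + (d-1)/2`. -/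
noncomputable def lamK (d : ℕ) (κ : Fin (d + 1) → ℝ) : ℝ := (∑ i, κ i) + ((d : ℝ) - 1) / 2

/-- The reproducing kernel `P_n(h_κ²; x, y)` on the sphere. -/
noncomputable def hP (d : ℕ) (κ : Fin (d + 1) → ℝ) (n : ℕ)
    (x y : EuclideanSpace ℝ (Fin (d + 1))) : ℝ :=
  (∫ t in cube (d + 1), wprod κ t)⁻¹ * ((n + lamK d κ) / lamK d κ) *
    ∫ t in cube (d + 1), gegenC n (lamK d κ) (∑ i, x i * y i * t i) * wprod κ t

/-- The Cesàro `(C,δ)` kernel `K_n^δ(h_κ²; x, y)` on the sphere. -/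
noncomputable def hK (d : ℕ) (κ : Fin (d + 1) → ℝ) (δ : ℝ) (n : ℕ)
    (x y : EuclideanSpace ℝ (Fin (d + 1))) : ℝ :=
  (cesA δ n)⁻¹ * ∑ k ∈ Finset.range (n + 1), cesA δ (n - k) * hP d κ k x y

/-- `z̄ = (|z_1|, …, |z_{d+1}|)`. -/
noncomputable def ebar {m : ℕ} (z : EuclideanSpace ℝ (Fin m)) : EuclideanSpace ℝ (Fin m) :=
  (EuclideanSpace.equiv (Fin m) ℝ).symm fun i => |z i|

/-- `h_κ²(y) = ∏ |y_i|^{2κ_i}`. -/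
noncomputable def hsq {m : ℕ} (κ : Fin m → ℝ) (y : EuclideanSpace ℝ (Fin m)) : ℝ :=
  ∏ i, |y i| ^ (2 * κ i)

/-- `σ_κ = (d-1)/2 + |κ| - min_i κ_i`. -/
noncomputable def sigmaK (d : ℕ) (κ : Fin (d + 1) → ℝ) : ℝ :=
  ((d : ℝ) - 1) / 2 + (∑ i, κ i) - Finset.univ.inf' (Finset.univ_nonempty) κ

/-- The surface measure `dω` on the unit sphere `S^d`. -/
noncomputable def sphereMeas (d : ℕ) :
    Measure (Metric.sphere (0 : EuclideanSpace ℝ (Fin (d + 1))) 1) :=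
  (volume : Measure (EuclideanSpace ℝ (Fin (d + 1)))).toSphere

theorem poch_succ (a : ℝ) (n : ℕ) : poch a (n + 1) = poch a n * (a + n) := by
  simp [poch, Finset.prod_range_succ]

theorem poch_succ' (a : ℝ) (n : ℕ) : poch a (n + 1) = a * poch (a + 1) n := by
  simp only [poch, Finset.prod_range_succ']
  rw [mul_comm]; congr 1
  · simp
  · refine Finset.prod_congr rfl fun i _ => ?_
    push_cast; ring

theorem poch_pos {a : ℝ} (ha : 0 < a) (n : ℕ) : 0 < poch a n :=
  Finset.prod_pos fun i _ => by positivity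

theorem poch_add (a : ℝ) (m n : ℕ) : poch a (m + n) = poch a m * poch (a + m) n := by
  simp only [poch, Finset.prod_range_add]
  congr 1
  refine Finset.prod_congr rfl fun i _ => ?_
  push_cast; ring

/-- The Chu–Vandermonde identity. -/
theorem sum_choose_mul_prod_div_poch (m : ℕ) : ∀ (N a : ℝ), 0 < a →
    ∑ k ∈ range (m + 1), (m.choose k : ℝ) * (∏ i ∈ range k, (N - i)) / poch a k
      = poch (a + N) m / poch a m := by
  induction m with
  | zero => intro N a ha; simp [poch]
  | succ m ih =>
    intro N a ha
    have key : ∑ k ∈ range (m + 2), ((m + 1).choose k : ℝ) * (∏ i ∈ range k, (N - i)) / poch a k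
        = ∑ k ∈ range (m + 1), (m.choose k : ℝ) * (∏ i ∈ range k, (N - i)) / poch a k
          + N / a * ∑ k ∈ range (m + 1),
            (m.choose k : ℝ) * (∏ i ∈ range k, ((N - 1) - i)) / poch (a + 1) k := by
      have h1 : ∑ k ∈ range (m + 1), (m.choose k : ℝ) * (∏ i ∈ range k, (N - i)) / poch a k
        = ∑ k ∈ range (m + 2), (m.choose k : ℝ) * (∏ i ∈ range k, (N - i)) / poch a k := by
        rw [Finset.sum_range_succ _ (m + 1)]; simp
      rw [h1, Finset.sum_range_succ' _ (m + 1), Finset.sum_range_succ' _ (m + 1), Finset.mul_sum,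
        add_right_comm, ← Finset.sum_add_distrib]
      rw [Nat.choose_zero_right, Nat.choose_zero_right]
      congr 1
      refine Finset.sum_congr rfl fun k _ => ?_
      rw [Nat.choose_succ_succ, poch_succ', Finset.prod_range_succ']
      have : ∏ i ∈ range k, (N - ((i + 1 : ℕ) : ℝ)) = ∏ i ∈ range k, ((N - 1) - i) :=
        Finset.prod_congr rfl fun i _ => by push_cast; ring
      rw [this]
      have h2 := (poch_pos (a := a + 1) (by linarith) k).ne'
      have h3 := ha.ne'
      push_cast
      field_simp
      ring
    rw [key, ih N a ha, ih (N - 1) (a + 1) (by linarith),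
      show a + 1 + (N - 1) = a + N by ring, poch_succ (a + N)]
    have e := poch_succ' a m
    have e2 := poch_succ a m
    have h1 := (poch_pos ha m).ne'
    have h2 := (poch_pos (a := a + 1) (by linarith) m).ne'
    have h4 : a + m ≠ 0 := by positivity
    have h3 := ha.ne'
    rw [e2] at e ⊢
    have e3 : N / a * (poch (a + N) m / poch (a + 1) m)
        = N * poch (a + N) m / (poch a m * (a + m)) := by rw [e]; field_simp
    rw [e3]
    field_simp
    ring

theorem genBinom_eq (n k : ℕ) (hk : k ≤ n) {a : ℝ} (ha : 0 < a + 1) :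
    genBinom (n + a) k = poch (a + 1) n / poch (a + 1) (n - k) / k.factorial := by
  unfold genBinom
  congr 1
  rw [eq_div_iff (poch_pos ha _).ne']
  obtain ⟨j, rfl⟩ := Nat.exists_eq_add_of_le hk
  rw [Nat.add_sub_cancel_left, add_comm k j, poch_add, mul_comm]
  congr 1
  unfold poch
  rw [← Finset.prod_range_reflect]
  refine Finset.prod_congr rfl fun i hi => ?_
  have : i + 1 ≤ k := by simpa using hi
  rw [show k - 1 - i = k - (i + 1) by omega, Nat.cast_sub this]
  push_cast; ring

theorem sum_range_even {M : Type*} [AddCommMonoid M] (f : ℕ → M) (hodd : ∀ k, f (2 * k + 1) = 0)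
    (n : ℕ) (hn : ∀ k, n < k → f k = 0) :
    ∑ j ∈ range (n + 1), f j = ∑ k ∈ range (n + 1), f (2 * k) := by
  have h : ∀ N, ∑ j ∈ range (2 * N), f j = ∑ k ∈ range N, f (2 * k) := by
    intro N
    induction N with
    | zero => simp
    | succ N ih => rw [Nat.mul_succ, Finset.sum_range_succ, Finset.sum_range_succ, ih,
        Finset.sum_range_succ, hodd, add_zero]
  rw [← h]
  refine Finset.sum_subset (by intro x; simp; omega) fun x _ hx => hn x (by simpa using hx)

theorem choose_mul_choose_mul {n m k : ℕ} (hk : k ≤ m) (hmk : m + k ≤ n) :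
    (n.choose (2 * k) : ℝ) * ((n - 2 * k).choose (m - k)) * (2 * k).factorial
      = n.choose m * m.choose k * (∏ i ∈ range k, (((n - m : ℕ) : ℝ) - i)) * k.factorial := by
  have e1 : (∏ i ∈ range k, (((n - m : ℕ) : ℝ) - i)) = ((n - m).descFactorial k : ℝ) := by
    rw [Nat.descFactorial_eq_prod_range, Nat.cast_prod]
    refine Finset.prod_congr rfl fun i hi => ?_
    exact (Nat.cast_sub (by have := Finset.mem_range.1 hi; omega)).symm
  rw [e1]
  obtain ⟨i, rfl⟩ := Nat.exists_eq_add_of_le hk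
  obtain ⟨j, rfl⟩ := Nat.exists_eq_add_of_le hmk
  have a1 : k + i + k + j - 2 * k = i + j := by omega
  have a2 : k + i - k = i := by omega
  have a3 : k + i + k + j - (k + i) = k + j := by omega
  rw [a1, a2, a3]
  have b1 := Nat.add_choose_mul_factorial_mul_factorial (2 * k) (i + j)
  have b2 := Nat.add_choose_mul_factorial_mul_factorial i j
  have b3 := Nat.add_choose_mul_factorial_mul_factorial (k + i) (k + j)
  have b4 := Nat.add_choose_mul_factorial_mul_factorial k i
  rw [← Nat.choose_symm_add] at b1 b2 b3 b4
  have b5 := Nat.factorial_mul_descFactorial (n := k + j) (k := k) (by omega)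
  rw [Nat.add_sub_cancel_left] at b5
  have c1 : 2 * k + (i + j) = k + i + k + j := by omega
  have c3 : k + i + (k + j) = k + i + k + j := by omega
  rw [c1] at b1; rw [c3] at b3
  have key : (k + i + k + j).choose (2 * k) * (i + j).choose i * (2 * k).factorial
      = (k + i + k + j).choose (k + i) * (k + i).choose k * (k + j).descFactorial k
        * k.factorial := by
    apply Nat.eq_of_mul_eq_mul_right (Nat.mul_pos (Nat.factorial_pos i) (Nat.factorial_pos j))
    calc _ = (k + i + k + j).choose (2 * k) * (2 * k).factorial *
          ((i + j).choose i * i.factorial * j.factorial) := by ring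
      _ = (k + i + k + j).choose (k + i) * ((k + i).choose k * k.factorial * i.factorial) *
          (j.factorial * (k + j).descFactorial k) := by rw [b2, b1, b4, b5, b3]
      _ = _ := by ring
  exact_mod_cast key

theorem poch_half (k : ℕ) : poch (1 / 2) k * 4 ^ k * k.factorial = (2 * k).factorial := by
  induction k with
  | zero => simp [poch]
  | succ k ih =>
    rw [poch_succ, Nat.mul_succ, Nat.factorial_succ, Nat.factorial_succ, Nat.factorial_succ]
    push_cast
    rw [← ih]; ring

/-- The hypergeometric form of the normalized ultraspherical polynomial. -/
theorem jacobiP_eq_sum (n : ℕ) {a : ℝ} (ha : 0 < a + 1) (u : ℝ) :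
    jacobiP n a a u = poch (a + 1) n / n.factorial * ∑ k ∈ range (n + 1),
      (n.choose (2 * k) : ℝ) * u ^ (n - 2 * k) * (u ^ 2 - 1) ^ k *
        (poch (1 / 2) k / poch (a + 1) k) := by
  set p : ℝ := (u + 1) / 2 with hp
  set q : ℝ := (u - 1) / 2 with hq
  have hpq : u = q + p := by rw [hp, hq]; ring
  have hpq2 : u ^ 2 - 1 = 4 * (p * q) := by rw [hp, hq]; ring
  have inner : ∀ k ∈ range (n + 1), (n.choose (2 * k) : ℝ) * u ^ (n - 2 * k) * (u ^ 2 - 1) ^ k *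
        (poch (1 / 2) k / poch (a + 1) k) = ∑ m ∈ range (n + 1),
        (n.choose m : ℝ) * (m.choose k * (∏ i ∈ range k, (((n - m : ℕ) : ℝ) - i)) /
          poch (a + 1) k) * (q ^ m * p ^ (n - m)) := by
    intro k hk
    have hP := (poch_pos ha k).ne'
    by_cases h2 : 2 * k ≤ n
    · rw [hpq2]
      have hz : ∀ m ∈ range (n + 1), m ∉ Finset.Ico k (n - k + 1) →
          (n.choose m : ℝ) * (m.choose k * (∏ i ∈ range k, (((n - m : ℕ) : ℝ) - i)) /
          poch (a + 1) k) * (q ^ m * p ^ (n - m)) = 0 := by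
        intro m hm hm2
        simp only [Finset.mem_range, Finset.mem_Ico, not_and_or, not_le, not_lt] at hm hm2
        rcases hm2 with h | h
        · rw [Nat.choose_eq_zero_of_lt h]; simp
        · have : ∏ i ∈ range k, (((n - m : ℕ) : ℝ) - i) = 0 :=
            Finset.prod_eq_zero (i := n - m) (by simp; omega) (by simp)
          rw [this]; simp
      rw [← Finset.sum_subset (s₁ := Finset.Ico k (n - k + 1)) (by
        intro m; simp only [Finset.mem_Ico, Finset.mem_range]; omega) hz,
        Finset.sum_Ico_eq_sum_range, hpq, add_pow,
        show n - k + 1 - k = n - 2 * k + 1 by omega, Finset.mul_sum, Finset.sum_mul,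
        Finset.sum_mul]
      refine Finset.sum_congr rfl fun i hi => ?_
      have hi' : i ≤ n - 2 * k := by simpa [Nat.lt_succ_iff] using hi
      have key := choose_mul_choose_mul (n := n) (m := k + i) (k := k) (by omega) (by omega)
      rw [Nat.add_sub_cancel_left, ← poch_half] at key
      have hkf : (k.factorial : ℝ) ≠ 0 := by positivity
      have key2 : (n.choose (2 * k) : ℝ) * ((n - 2 * k).choose i) * (poch (1 / 2) k * 4 ^ k)
          = n.choose (k + i) * (k + i).choose k *
            (∏ j ∈ range k, (((n - (k + i) : ℕ) : ℝ) - j)) := by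
        apply mul_right_cancel₀ hkf
        rw [← key]; ring
      rw [show n - (k + i) = (n - 2 * k - i) + k by omega, pow_add, pow_add, mul_pow, mul_pow]
      rw [show n - (k + i) = (n - 2 * k - i) + k by omega] at key2
      have : ∀ A : ℝ, A / poch (a + 1) k = A * (poch (a + 1) k)⁻¹ := fun A => rfl
      simp only [this]
      linear_combination (q ^ k * q ^ i * (p ^ (n - 2 * k - i) * p ^ k) * (poch (a + 1) k)⁻¹) * key2
    · rw [Nat.choose_eq_zero_of_lt (by omega)]
      simp only [Nat.cast_zero, zero_mul]
      symm
      refine Finset.sum_eq_zero fun m hm => ?_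
      by_cases h : m < k
      · rw [Nat.choose_eq_zero_of_lt h]; simp
      · have : ∏ i ∈ range k, (((n - m : ℕ) : ℝ) - i) = 0 :=
            Finset.prod_eq_zero (i := n - m) (by simp; omega) (by simp)
        rw [this]; simp
  rw [Finset.sum_congr rfl inner, Finset.sum_comm, jacobiP, Finset.mul_sum]
  refine Finset.sum_congr rfl fun m hm => ?_
  have hm' : m ≤ n := by simpa [Nat.lt_succ_iff] using hm
  rw [← Finset.sum_mul, ← Finset.mul_sum]
  have hv : ∑ k ∈ range (n + 1), (m.choose k : ℝ) * (∏ i ∈ range k, (((n - m : ℕ) : ℝ) - i)) /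
          poch (a + 1) k = poch (a + 1 + (n - m : ℕ)) m / poch (a + 1) m := by
    rw [← sum_choose_mul_prod_div_poch m _ _ ha]
    symm
    refine Finset.sum_subset (by intro x; simp; omega) fun x _ hx => ?_
    rw [Nat.choose_eq_zero_of_lt (by simpa using hx)]; simp
  rw [hv, genBinom_eq n (n - m) (by omega) ha, genBinom_eq n m hm' ha,
    show n - (n - m) = m by omega]
  have e : poch (a + 1) n = poch (a + 1) (n - m) * poch (a + 1 + (n - m : ℕ)) m := by
    rw [← poch_add]; congr 1; omega
  have h1 := (poch_pos ha m).ne'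
  have h2 := (poch_pos ha (n - m)).ne'
  rw [Nat.cast_choose ℝ hm', e]
  have h3 : (m.factorial : ℝ) ≠ 0 := by positivity
  have h4 : ((n - m).factorial : ℝ) ≠ 0 := by positivity
  have h5 : (n.factorial : ℝ) ≠ 0 := by positivity
  rw [← hp, ← hq]
  field_simp

theorem intervalIntegrable_one_sub_sq_rpow {l : ℝ} (hl : 0 < l) :
    IntervalIntegrable (fun x : ℝ => (1 - x ^ 2) ^ (l - 1)) volume (-1) 1 := by
  have base : IntervalIntegrable (fun x : ℝ => x ^ (l - 1)) volume 0 1 :=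
    intervalIntegral.intervalIntegrable_rpow' (by linarith)
  have h1 : IntervalIntegrable (fun x : ℝ => (1 - x ^ 2) ^ (l - 1)) volume 0 1 := by
    have h := (base.comp_sub_left 1).symm
    simp only [sub_self, sub_zero] at h
    have hc : ContinuousOn (fun x : ℝ => (1 + x) ^ (l - 1)) (Set.uIcc 0 1) := by
      intro x hx
      rw [Set.uIcc_of_le zero_le_one] at hx
      refine ContinuousAt.continuousWithinAt ?_
      exact ContinuousAt.rpow_const (by fun_prop) (Or.inl (by linarith [hx.1]))
    refine (h.mul_continuousOn hc).congr ?_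
    intro x hx
    rw [Set.uIoc_of_le zero_le_one] at hx
    simp only
    rw [← Real.mul_rpow (by linarith [hx.2]) (by linarith [hx.1])]
    congr 1; ring
  have h2 : IntervalIntegrable (fun x : ℝ => (1 - x ^ 2) ^ (l - 1)) volume (-1) 0 := by
    have h := (h1.comp_sub_left 0).symm
    simpa using h
  exact h2.trans h1

theorem integral_odd_mul_one_sub_sq_rpow (l : ℝ) (k : ℕ) :
    ∫ x in (-1 : ℝ)..1, x ^ (2 * k + 1) * (1 - x ^ 2) ^ (l - 1) = 0 := by
  have h := intervalIntegral.integral_comp_neg (a := -1) (b := 1)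
    (fun x : ℝ => x ^ (2 * k + 1) * (1 - x ^ 2) ^ (l - 1))
  have e : ∀ x : ℝ, (-x) ^ (2 * k + 1) * (1 - (-x) ^ 2) ^ (l - 1)
      = -(x ^ (2 * k + 1) * (1 - x ^ 2) ^ (l - 1)) := by
    intro x
    rw [Odd.neg_pow ⟨k, rfl⟩, neg_sq]; ring
  simp only [e, intervalIntegral.integral_neg, neg_neg] at h
  linarith

theorem intervalIntegrable_pow_mul_one_sub_sq_rpow {l : ℝ} (hl : 0 < l) (j : ℕ) :
    IntervalIntegrable (fun x : ℝ => x ^ j * (1 - x ^ 2) ^ (l - 1)) volume (-1) 1 :=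
  (intervalIntegrable_one_sub_sq_rpow hl).continuousOn_mul (by fun_prop)

theorem integral_even_mul_one_sub_sq_rpow {l : ℝ} (hl : 0 < l) (k : ℕ) :
    ∫ x in (-1 : ℝ)..1, x ^ (2 * k) * (1 - x ^ 2) ^ (l - 1) =
      (∫ x in (-1 : ℝ)..1, (1 - x ^ 2) ^ (l - 1)) * (poch (1 / 2) k / poch (l + 1 / 2) k) := by
  induction k with
  | zero => simp [poch]
  | succ k ih =>
    have i1 := intervalIntegrable_pow_mul_one_sub_sq_rpow hl (2 * k)
    have i2 := intervalIntegrable_pow_mul_one_sub_sq_rpow hl (2 * (k + 1))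
    have hF : ∫ x in (-1 : ℝ)..1, ((2 * k + 1) * (x ^ (2 * k) * (1 - x ^ 2) ^ (l - 1))
        - (2 * k + 1 + 2 * l) * (x ^ (2 * (k + 1)) * (1 - x ^ 2) ^ (l - 1)))
        = (1 : ℝ) ^ (2 * k + 1) * (1 - 1 ^ 2) ^ l
          - (-1 : ℝ) ^ (2 * k + 1) * (1 - (-1) ^ 2) ^ l := by
      refine intervalIntegral.integral_eq_sub_of_hasDerivAt_of_le
        (f := fun x : ℝ => x ^ (2 * k + 1) * (1 - x ^ 2) ^ l) (by norm_num) ?_ ?_ ?_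
      · refine Continuous.continuousOn ?_
        exact (continuous_pow _).mul (Continuous.rpow_const (by fun_prop) fun _ => Or.inr hl.le)
      · intro x hx
        have hx2 : 0 < 1 - x ^ 2 := by nlinarith [hx.1, hx.2]
        have h1 : HasDerivAt (fun x : ℝ => 1 - x ^ 2) (-(2 * x)) x := by
          simpa using ((hasDerivAt_pow 2 x).const_sub 1)
        have h2 := (hasDerivAt_pow (2 * k + 1) x).mul (h1.rpow_const (p := l) (Or.inl hx2.ne'))
        convert! h2 using 1
        have e : (1 - x ^ 2) ^ l = (1 - x ^ 2) ^ (l - 1) * (1 - x ^ 2) := by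
          rw [← Real.rpow_add_one hx2.ne']; congr 1; ring
        rw [e]
        push_cast
        rw [show 2 * (k + 1) = 2 * k + 2 by ring, pow_add, pow_succ x (2 * k)]
        ring
      · exact (i1.const_mul _).sub (i2.const_mul _)
    rw [intervalIntegral.integral_sub (i1.const_mul _) (i2.const_mul _),
      intervalIntegral.integral_const_mul, intervalIntegral.integral_const_mul, ih] at hF
    norm_num [Real.zero_rpow hl.ne'] at hF
    rw [poch_succ, poch_succ]
    have h1 := (poch_pos (a := l + 1 / 2) (by linarith) k).ne'
    have h3 : l + 1 / 2 + k ≠ 0 := by positivity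
    have h4 : 2 * (k : ℝ) + 1 + 2 * l ≠ 0 := by positivity
    set J := ∫ x in (-1 : ℝ)..1, x ^ (2 * (k + 1)) * (1 - x ^ 2) ^ (l - 1)
    have : J = (2 * k + 1) / (2 * k + 1 + 2 * l) *
      ((∫ x in (-1 : ℝ)..1, (1 - x ^ 2) ^ (l - 1)) * (poch (1 / 2) k / poch (l + 1 / 2) k)) := by
      rw [div_mul_eq_mul_div, eq_div_iff h4]; linarith
    rw [this]
    generalize poch (l + 1 / 2) k = P at *
    rw [show l + 1 / 2 + k = (2 * k + 1 + 2 * l) / 2 by ring,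
      show (1 : ℝ) / 2 + k = (2 * k + 1) / 2 by ring]
    generalize 2 * (k : ℝ) + 1 + 2 * l = Q at *
    field_simp

theorem integral_one_sub_sq_rpow_pos {l : ℝ} (hl : 0 < l) :
    0 < ∫ x in (-1 : ℝ)..1, (1 - x ^ 2) ^ (l - 1) :=
  intervalIntegral.intervalIntegral_pos_of_pos_on (intervalIntegrable_one_sub_sq_rpow hl)
    (fun x hx => Real.rpow_pos_of_pos (by nlinarith [hx.1, hx.2]) _) (by norm_num)

/-- Laplace's integral representation of the Gegenbauer polynomials. -/
theorem gegenC_laplace (n : ℕ) {l : ℝ} (hl : 0 < l) (u s : ℂ) (t : ℝ) (hu : u = t)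
    (hs : s ^ 2 = 1 - u ^ 2) :
    ∫ x in (-1 : ℝ)..1, (u + Complex.I * x * s) ^ n * (((1 - x ^ 2) ^ (l - 1) : ℝ) : ℂ)
      = ((∫ x in (-1 : ℝ)..1, (1 - x ^ 2) ^ (l - 1)) * (n.factorial / poch (2 * l) n) *
        gegenC n l t : ℝ) := by
  have e1 : ∀ x : ℝ, (u + Complex.I * x * s) ^ n * (((1 - x ^ 2) ^ (l - 1) : ℝ) : ℂ)
      = ∑ j ∈ range (n + 1), ((n.choose j : ℂ) * u ^ (n - j) * (Complex.I * s) ^ j) *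
        ((x ^ j * (1 - x ^ 2) ^ (l - 1) : ℝ) : ℂ) := by
    intro x
    rw [add_comm u, add_pow, Finset.sum_mul]
    refine Finset.sum_congr rfl fun j _ => ?_
    push_cast
    ring
  simp_rw [e1]
  rw [intervalIntegral.integral_finsetSum]
  swap
  · intro j _
    have h := intervalIntegrable_pow_mul_one_sub_sq_rpow hl j
    exact (show IntervalIntegrable (fun x : ℝ => ((x ^ j * (1 - x ^ 2) ^ (l - 1) : ℝ) : ℂ))
      volume (-1) 1 from ⟨h.1.ofReal, h.2.ofReal⟩).const_mul _
  simp_rw [intervalIntegral.integral_const_mul, intervalIntegral.integral_ofReal]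
  rw [sum_range_even]
  · simp_rw [integral_even_mul_one_sub_sq_rpow hl]
    unfold gegenC
    rw [jacobiP_eq_sum n (by linarith), show l - 1 / 2 + 1 = l + 1 / 2 by ring]
    have h1 := (poch_pos (a := l + 1 / 2) (by linarith) n).ne'
    have h2 := (poch_pos (a := 2 * l) (by linarith) n).ne'
    have h3 : (n.factorial : ℝ) ≠ 0 := by positivity
    rw [show ∀ A S : ℝ, A * (n.factorial / poch (2 * l) n) * (poch (2 * l) n / poch (l + 1 / 2) n *
      (poch (l + 1 / 2) n / n.factorial * S)) = A * S by
        intros; generalize poch (l + 1 / 2) n = P at *; field_simp, Finset.mul_sum,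
      Complex.ofReal_sum]
    refine Finset.sum_congr rfl fun k _ => ?_
    rw [pow_mul, mul_pow, hs, Complex.I_sq, hu]
    push_cast
    rw [show (-1 : ℂ) * (1 - t ^ 2) = t ^ 2 - 1 by ring]
    ring
  · intro k
    rw [integral_odd_mul_one_sub_sq_rpow]; simp
  · intro k hk
    rw [Nat.choose_eq_zero_of_lt hk]; simp

theorem differentiableOn_integral_of_dominated {α : Type*} [MeasurableSpace α] {μ : Measure α}
    {U : Set ℂ} (hU : IsOpen U) {F : ℂ → α → ℂ}
    (hm : ∀ z ∈ U, AEStronglyMeasurable (F z) μ)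
    (hd : ∀ᵐ t ∂μ, DifferentiableOn ℂ (fun z => F z t) U)
    (hb : ∀ z ∈ U, ∃ ε > 0, ∃ b : α → ℝ, Integrable b μ ∧
      ∀ᵐ t ∂μ, ∀ w ∈ Metric.ball z ε, w ∈ U → ‖F w t‖ ≤ b t) :
    DifferentiableOn ℂ (fun z => ∫ t, F z t ∂μ) U := by
  intro z hz
  obtain ⟨ε, hε, b, hbi, hb⟩ := hb z hz
  obtain ⟨r, hr, hrU⟩ := Metric.isOpen_iff.1 hU z hz
  set δ := min ε r / 3 with hδ
  have hδ0 : 0 < δ := by positivity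
  have hδε : 3 * δ ≤ ε := by rw [hδ]; linarith [min_le_left ε r]
  have hδr : 3 * δ ≤ r := by rw [hδ]; linarith [min_le_right ε r]
  have hin : ∀ w, dist w z < 3 * δ → w ∈ U := fun w hw =>
    hrU (Metric.mem_ball.2 (hw.trans_le hδr))
  have hdz : ∀ᵐ t ∂μ, ∀ w ∈ Metric.ball z δ, HasDerivAt (fun w => F w t)
      (deriv (fun w => F w t) w) w := by
    filter_upwards [hd] with t ht w hw
    have hw' : w ∈ U := hin w (by rw [Metric.mem_ball] at hw; linarith)
    exact ((ht w hw').differentiableAt (hU.mem_nhds hw')).hasDerivAt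
  have hbound : ∀ᵐ t ∂μ, ∀ w ∈ Metric.ball z δ, ‖deriv (fun w => F w t) w‖ ≤ b t / δ := by
    filter_upwards [hd, hb] with t ht hbt w hw
    rw [Metric.mem_ball] at hw
    have hsub : ∀ v, dist v w ≤ δ → dist v z < 3 * δ := fun v hv => by
      linarith [dist_triangle v w z]
    refine Complex.norm_deriv_le_of_forall_mem_sphere_norm_le hδ0 ?_ ?_
    · refine DifferentiableOn.diffContOnCl (s := Metric.ball w δ) (ht.mono ?_)
      intro v hv
      exact hin v (hsub v (Metric.closure_ball_subset_closedBall hv))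
    · intro v hv
      have := hsub v (le_of_eq hv)
      exact hbt v (Metric.mem_ball.2 (by linarith)) (hin v this)
  have hmem : Metric.ball z δ ∈ nhds z := Metric.ball_mem_nhds z hδ0
  have hseq : Filter.Tendsto (fun k : ℕ => z + ((δ / 2 * (1 / ((k : ℝ) + 1)) : ℝ) : ℂ))
      Filter.atTop (nhdsWithin z {z}ᶜ) := by
    refine tendsto_nhdsWithin_iff.2 ⟨?_, Filter.Eventually.of_forall fun k => ?_⟩
    · have h1 := (tendsto_one_div_add_atTop_nhds_zero_nat (𝕜 := ℝ)).const_mul (δ / 2)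
      have h2 := (Complex.continuous_ofReal.tendsto _).comp h1
      simpa [Function.comp_def] using h2.const_add z
    · have : (δ / 2 * (1 / ((k : ℝ) + 1)) : ℝ) ≠ 0 := by positivity
      simp only [Set.mem_compl_iff, Set.mem_singleton_iff, add_eq_left]
      exact_mod_cast this
  refine (hasDerivAt_integral_of_dominated_loc_of_deriv_le (F' := fun w t => deriv (fun w => F w t) w)
    (bound := fun t => b t / δ) hmem ?_ ?_ ?_ hbound (hbi.div_const δ) hdz).2.differentiableAt.differentiableWithinAt
  · filter_upwards [hU.mem_nhds hz] with w hw using hm w hw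
  · refine hbi.mono' (hm z hz) ?_
    filter_upwards [hb] with t ht
    exact ht z (Metric.mem_ball_self hε) hz
  · refine aestronglyMeasurable_of_tendsto_ae (u := Filter.atTop)
      (f := fun (k : ℕ) t => slope (fun w => F w t) z (z + ((δ / 2 * (1 / ((k : ℝ) + 1)) : ℝ) : ℂ))) ?_ ?_
    · intro k
      simp only [slope_def_module]
      refine ((hm (z + ((δ / 2 * (1 / ((k : ℝ) + 1)) : ℝ) : ℂ)) ?_).sub (hm z hz)).const_smul
        ((z + ((δ / 2 * (1 / ((k : ℝ) + 1)) : ℝ) : ℂ) - z)⁻¹)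
      refine hin _ ?_
      rw [dist_eq_norm, add_sub_cancel_left, Complex.norm_real, Real.norm_of_nonneg (by positivity)]
      have : 1 / ((k : ℝ) + 1) ≤ 1 := by
        rw [div_le_one (by positivity)]; linarith [k.cast_nonneg (α := ℝ)]
      nlinarith
    · filter_upwards [hdz] with t ht
      exact (hasDerivAt_iff_tendsto_slope.1 (ht z (Metric.mem_ball_self hδ0))).comp hseq

/-- The denominator of the Gegenbauer generating function does not meet the branch cut. -/
theorem one_sub_add_sq_mem_slitPlane {t : ℝ} (ht : t ^ 2 < 1) {w : ℂ} (hw : ‖w‖ ≤ 1)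
    (h0 : 1 - 2 * t * w + w ^ 2 ≠ 0) : 1 - 2 * t * w + w ^ 2 ∈ Complex.slitPlane := by
  rw [Complex.mem_slitPlane_iff]
  by_contra! h
  have hre : (1 - 2 * t * w + w ^ 2).re = 1 - 2 * t * w.re + (w.re ^ 2 - w.im ^ 2) := by
    simp [pow_two]
  have him : (1 - 2 * t * w + w ^ 2).im = 2 * (w.re - t) * w.im := by
    simp [pow_two]; ring
  obtain ⟨h1, h2⟩ := h
  have hn : w.re ^ 2 + w.im ^ 2 ≤ 1 := by
    have := Complex.sq_norm w
    rw [Complex.normSq_apply] at this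
    nlinarith [norm_nonneg w]
  have h3 : (1 - 2 * t * w + w ^ 2).re ≠ 0 := fun h => h0 (Complex.ext h h2)
  have h4 := lt_of_le_of_ne h1 h3
  rw [hre] at h4
  rw [him] at h2
  rcases mul_eq_zero.1 h2 with h | h
  · have : w.re = t := by linarith
    rw [this] at h4 hn
    linarith
  · rw [h] at h4
    nlinarith [sq_nonneg (w.re - t)]

theorem norm_one_sub_le_two_mul {z : ℂ} (hz : ‖z‖ ≤ 1) {r : ℝ} (h0 : 0 ≤ r) (h1 : r ≤ 1) :
    ‖1 - z‖ ≤ 2 * ‖1 - r * z‖ := by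
  have e : 1 - z = (1 - r * z) - ((1 - r : ℝ) : ℂ) * z := by push_cast; ring
  have h2 : ‖1 - z‖ ≤ ‖1 - r * z‖ + (1 - r) * ‖z‖ := by
    rw [e]
    refine (norm_sub_le _ _).trans ?_
    rw [norm_mul, Complex.norm_real, Real.norm_of_nonneg (by linarith)]
  have h3 : 1 - r * ‖z‖ ≤ ‖1 - r * z‖ := by
    have := norm_sub_norm_le (1 : ℂ) (r * z)
    rwa [norm_one, norm_mul, Complex.norm_real, Real.norm_of_nonneg h0] at this
  nlinarith [norm_nonneg z]

theorem rpow_le_add_of_mem_Icc {a b c : ℝ} (ha : 0 < a) (hab : a ≤ b) (hbc : b ≤ c) (s : ℝ) :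
    b ^ s ≤ a ^ s + c ^ s := by
  rcases le_total 0 s with h | h
  · have := Real.rpow_le_rpow (ha.le.trans hab) hbc h
    have := Real.rpow_nonneg ha.le s
    linarith
  · have := Real.rpow_le_rpow_of_nonpos ha hab h
    have := Real.rpow_nonneg (ha.le.trans (hab.trans hbc)) s
    linarith

theorem one_sub_add_sq_factor {t σ : ℝ} (h : t ^ 2 + σ ^ 2 = 1) (w : ℂ) :
    1 - 2 * t * w + w ^ 2 = (1 - w * (t + Complex.I * σ)) * (1 - w * (t - Complex.I * σ)) := by
  have h' : (t : ℂ) ^ 2 + σ ^ 2 = 1 := by exact_mod_cast h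
  linear_combination (-w ^ 2) * h' + w ^ 2 * σ ^ 2 * Complex.I_sq

theorem norm_add_I_mul_eq_one {t σ : ℝ} (h : t ^ 2 + σ ^ 2 = 1) :
    ‖(t : ℂ) + Complex.I * σ‖ = 1 ∧ ‖(t : ℂ) - Complex.I * σ‖ = 1 := by
  constructor <;>
  · rw [← sq_eq_sq₀ (norm_nonneg _) zero_le_one, Complex.sq_norm, Complex.normSq_apply]
    simp; nlinarith

theorem norm_one_sub_add_sq_le {t σ : ℝ} (h : t ^ 2 + σ ^ 2 = 1) {w : ℂ} (hw : ‖w‖ ≤ 1) {r : ℝ}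
    (h0 : 0 ≤ r) (h1 : r ≤ 1) :
    ‖1 - 2 * t * w + w ^ 2‖ / 4 ≤ ‖1 - 2 * t * (r * w) + (r * w) ^ 2‖ ∧
      ‖1 - 2 * t * (r * w) + (r * w) ^ 2‖ ≤ 4 := by
  obtain ⟨n1, n2⟩ := norm_add_I_mul_eq_one h
  set ζ := (t : ℂ) + Complex.I * σ
  set ξ := (t : ℂ) - Complex.I * σ
  rw [one_sub_add_sq_factor h, one_sub_add_sq_factor h, norm_mul, norm_mul, mul_assoc, mul_assoc]
  have b : ∀ z : ℂ, ‖z‖ = 1 → ‖1 - w * z‖ ≤ 2 * ‖1 - r * (w * z)‖ ∧ ‖1 - r * (w * z)‖ ≤ 2 := by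
    intro z hz
    refine ⟨norm_one_sub_le_two_mul (by rw [norm_mul, hz, mul_one]; exact hw) h0 h1, ?_⟩
    refine (norm_sub_le _ _).trans ?_
    rw [norm_mul, norm_mul, hz, norm_one, Complex.norm_real, Real.norm_of_nonneg h0]
    nlinarith [norm_nonneg w]
  obtain ⟨a1, a2⟩ := b ζ n1
  obtain ⟨a3, a4⟩ := b ξ n2
  constructor
  · have := mul_le_mul a1 a3 (norm_nonneg _) (by positivity)
    linarith
  · have := mul_le_mul a2 a4 (norm_nonneg _) (by positivity)
    linarith

theorem tendsto_primitive_segment (n : ℕ) {l t σ : ℝ} (h : t ^ 2 + σ ^ 2 = 1) (hσ : 0 < σ)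
    {Φ : ℂ → ℂ} (hΦ : ∀ w ∈ Metric.ball (0 : ℂ) 1,
      HasDerivAt Φ (w ^ n * (1 - 2 * t * w + w ^ 2) ^ ((l - 1 : ℝ) : ℂ)) w)
    {a b : ℝ} (hab : a ≤ b) (p m : ℂ) (hnorm : ∀ x ∈ Set.Icc a b, ‖p + x * m‖ ≤ 1)
    (hne : ∀ x ∈ Set.Ioo a b, 1 - 2 * t * (p + x * m) + (p + x * m) ^ 2 ≠ 0)
    (hintg : IntervalIntegrable
      (fun x : ℝ => ‖1 - 2 * t * (p + x * m) + (p + x * m) ^ 2‖ ^ (l - 1)) volume a b) :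
    Filter.Tendsto (fun r : ℝ => Φ (r * (p + b * m)) - Φ (r * (p + a * m)))
      (nhdsWithin 1 (Set.Iio 1)) (nhds (∫ x in a..b, m * ((p + x * m) ^ n *
        (1 - 2 * t * (p + x * m) + (p + x * m) ^ 2) ^ ((l - 1 : ℝ) : ℂ)))) := by
  have ht : t ^ 2 < 1 := by nlinarith
  have hev : ∀ᶠ r : ℝ in nhdsWithin 1 (Set.Iio 1), 0 < r ∧ r < 1 := by
    have h1 : ∀ᶠ r : ℝ in nhdsWithin 1 (Set.Iio 1), 0 < r :=
      nhdsWithin_le_nhds (lt_mem_nhds one_pos)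
    filter_upwards [h1, self_mem_nhdsWithin] with r h1 h2 using ⟨h1, h2⟩
  have hball : ∀ r : ℝ, 0 < r ∧ r < 1 → ∀ x ∈ Set.Icc a b, ‖(r : ℂ) * (p + x * m)‖ < 1 := by
    intro r hr x hx
    rw [norm_mul, Complex.norm_real, Real.norm_of_nonneg hr.1.le]
    nlinarith [hnorm x hx, norm_nonneg (p + x * m)]
  have hqne : ∀ w : ℂ, ‖w‖ < 1 → 1 - 2 * t * w + w ^ 2 ≠ 0 := by
    intro w hw
    obtain ⟨n1, n2⟩ := norm_add_I_mul_eq_one h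
    rw [one_sub_add_sq_factor h]
    refine mul_ne_zero ?_ ?_ <;>
    · rw [sub_ne_zero]
      intro hh
      have := congrArg norm hh
      rw [norm_one, norm_mul] at this
      simp only [n1, n2, mul_one] at this
      linarith
  have hAc : ∀ w : ℂ, ‖w‖ ≤ 1 → 1 - 2 * t * w + w ^ 2 ≠ 0 →
      ContinuousAt (fun w : ℂ => w ^ n * (1 - 2 * t * w + w ^ 2) ^ ((l - 1 : ℝ) : ℂ)) w := by
    intro w hw h0
    refine ContinuousAt.mul (by fun_prop) ?_
    exact ContinuousAt.cpow (by fun_prop) (by fun_prop) (one_sub_add_sq_mem_slitPlane ht hw h0)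
  have hcont : ∀ r : ℝ, 0 < r ∧ r < 1 → ContinuousOn (fun x : ℝ => r * m * ((r * (p + x * m)) ^ n *
        (1 - 2 * t * (r * (p + x * m)) + (r * (p + x * m)) ^ 2) ^ ((l - 1 : ℝ) : ℂ)))
        (Set.Icc a b) := by
    intro r hr x hx
    refine ContinuousAt.continuousWithinAt ?_
    refine ContinuousAt.mul continuousAt_const ?_
    have hb := hball r hr x hx
    exact ContinuousAt.comp (f := fun x : ℝ => (r : ℂ) * (p + x * m)) (hAc _ hb.le (hqne _ hb))
      (by fun_prop)
  have key : (fun r : ℝ => ∫ x in a..b, r * m * ((r * (p + x * m)) ^ n *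
        (1 - 2 * t * (r * (p + x * m)) + (r * (p + x * m)) ^ 2) ^ ((l - 1 : ℝ) : ℂ)))
      =ᶠ[nhdsWithin 1 (Set.Iio 1)]
      (fun r : ℝ => Φ (r * (p + b * m)) - Φ (r * (p + a * m))) := by
    filter_upwards [hev] with r hr
    refine intervalIntegral.integral_eq_sub_of_hasDerivAt
      (f := fun x : ℝ => Φ (r * (p + x * m))) ?_ ?_
    · intro x hx
      rw [Set.uIcc_of_le hab] at hx
      have h1 := hΦ (r * (p + x * m)) (by rw [mem_ball_zero_iff]; exact hball r hr x hx)
      have h2 : HasDerivAt (fun x : ℂ => (r : ℂ) * (p + x * m)) (r * m) x := by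
        simpa using (((hasDerivAt_id (x : ℂ)).mul_const m).const_add p).const_mul (r : ℂ)
      have h3 := (HasDerivAt.comp (x : ℂ) h1 h2).comp_ofReal
      convert! h3 using 1
      ring
    · exact ((hcont r hr).mono (by rw [Set.uIcc_of_le hab])).intervalIntegrable
  refine Filter.Tendsto.congr' key ?_
  refine intervalIntegral.tendsto_integral_filter_of_dominated_convergence
    (fun x => ‖m‖ * ((‖1 - 2 * t * (p + x * m) + (p + x * m) ^ 2‖ / 4) ^ (l - 1) + 4 ^ (l - 1)))
    ?_ ?_ ?_ ?_
  · filter_upwards [hev] with r hr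
    rw [Set.uIoc_of_le hab]
    exact ((hcont r hr).mono Set.Ioc_subset_Icc_self).aestronglyMeasurable measurableSet_Ioc
  · filter_upwards [hev] with r hr
    have hnb : ∀ᵐ x : ℝ ∂volume, x ≠ b := by simp [ae_iff, measure_singleton]
    filter_upwards [hnb] with x hxb hx
    rw [Set.uIoc_of_le hab] at hx
    have hx1 : x ∈ Set.Ioo a b := ⟨hx.1, lt_of_le_of_ne hx.2 hxb⟩
    have hx2 : x ∈ Set.Icc a b := ⟨hx.1.le, hx.2⟩
    obtain ⟨q1, q2⟩ := norm_one_sub_add_sq_le h (hnorm x hx2) hr.1.le hr.2.le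
    have q3 := rpow_le_add_of_mem_Icc (by have := norm_pos_iff.2 (hne x hx1); positivity) q1 q2 (l - 1)
    rw [norm_mul, norm_mul, norm_mul, norm_pow, Complex.norm_cpow_real, Complex.norm_real,
      Real.norm_of_nonneg hr.1.le]
    have q4 : ‖(r : ℂ) * (p + x * m)‖ ^ n ≤ 1 := pow_le_one₀ (norm_nonneg _) (hball r hr x hx2).le
    have q5 : ‖(r : ℂ) * (p + x * m)‖ ^ n *
        ‖1 - 2 * t * (r * (p + x * m)) + (r * (p + x * m)) ^ 2‖ ^ (l - 1) ≤ 1 * _ :=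
      mul_le_mul q4 q3 (by positivity) zero_le_one
    rw [one_mul] at q5
    refine mul_le_mul ?_ q5 (by positivity) (norm_nonneg _)
    nlinarith [norm_nonneg m, hr.2]
  · refine (IntervalIntegrable.add ?_ (by simp)).const_mul _
    have : (fun x : ℝ => (‖1 - 2 * t * (p + x * m) + (p + x * m) ^ 2‖ / 4) ^ (l - 1)) =
        fun x : ℝ => ‖1 - 2 * t * (p + x * m) + (p + x * m) ^ 2‖ ^ (l - 1) * (4 ^ (l - 1))⁻¹ := by
      funext x
      rw [Real.div_rpow (norm_nonneg _) (by norm_num), div_eq_mul_inv]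
    rw [this]
    exact hintg.mul_const _
  · have hnb : ∀ᵐ x : ℝ ∂volume, x ≠ b := by simp [ae_iff, measure_singleton]
    filter_upwards [hnb] with x hxb hx
    rw [Set.uIoc_of_le hab] at hx
    have hx1 : x ∈ Set.Ioo a b := ⟨hx.1, lt_of_le_of_ne hx.2 hxb⟩
    have hx2 : x ∈ Set.Icc a b := ⟨hx.1.le, hx.2⟩
    have h1 := hAc _ (hnorm x hx2) (hne x hx1)
    have h2 : Filter.Tendsto (fun r : ℝ => (r : ℂ) * (p + x * m)) (nhdsWithin 1 (Set.Iio 1))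
        (nhds (p + x * m)) := by
      have : ContinuousAt (fun r : ℝ => (r : ℂ) * (p + x * m)) 1 := by fun_prop
      have h3 := this.tendsto.mono_left (nhdsWithin_le_nhds (s := Set.Iio 1))
      simpa using h3
    have h4 : Filter.Tendsto (fun r : ℝ => (r : ℂ) * m) (nhdsWithin 1 (Set.Iio 1)) (nhds m) := by
      have : ContinuousAt (fun r : ℝ => (r : ℂ) * m) 1 := by fun_prop
      have h3 := this.tendsto.mono_left (nhdsWithin_le_nhds (s := Set.Iio 1))
      simpa using h3
    exact h4.mul (h1.tendsto.comp h2)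

/-- The radial integral `∫₀¹ rⁿ ((1-r)(1-rv²))^{λ-1} dr`. -/
noncomputable def radialJ (n : ℕ) (l : ℝ) (v : ℂ) : ℂ :=
  ∫ r in (0 : ℝ)..1, (r : ℂ) ^ n * ((1 - r) * (1 - r * v ^ 2)) ^ ((l - 1 : ℝ) : ℂ)

theorem tendsto_primitive_radius (n : ℕ) {l t τ : ℝ} (hl : 0 < l) (h : t ^ 2 + τ ^ 2 = 1)
    (hτ : τ ≠ 0) {Φ : ℂ → ℂ} (hΦ : ∀ w ∈ Metric.ball (0 : ℂ) 1,
      HasDerivAt Φ (w ^ n * (1 - 2 * t * w + w ^ 2) ^ ((l - 1 : ℝ) : ℂ)) w) :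
    Filter.Tendsto (fun r : ℝ => Φ (r * (t + Complex.I * τ)) - Φ 0)
      (nhdsWithin 1 (Set.Iio 1)) (nhds ((t + Complex.I * τ) ^ (n + 1) *
        radialJ n l (t + Complex.I * τ))) := by
  have hτ2 : 0 < τ ^ 2 := by positivity
  obtain ⟨hn, -⟩ := norm_add_I_mul_eq_one h
  have hσ : 0 < |τ| := abs_pos.2 hτ
  have h' : t ^ 2 + |τ| ^ 2 = 1 := by rwa [sq_abs]
  have hq : ∀ x : ℂ, 1 - 2 * t * (0 + x * (t + Complex.I * τ)) + (0 + x * (t + Complex.I * τ)) ^ 2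
      = (1 - x) * (1 - x * (t + Complex.I * τ) ^ 2) := by
    intro x
    have hh : (t : ℂ) ^ 2 + τ ^ 2 = 1 := by exact_mod_cast h
    linear_combination x * τ ^ 2 * Complex.I_sq - x * hh
  have hre : ∀ x ∈ Set.Icc (0 : ℝ) 1, 0 < (1 - x * ((t : ℂ) + Complex.I * τ) ^ 2).re := by
    intro x hx
    have : (1 - x * ((t : ℂ) + Complex.I * τ) ^ 2).re = 1 - x * (t ^ 2 - τ ^ 2) := by
      simp [pow_two]
    rw [this]
    nlinarith [hx.1, hx.2]
  have hne : ∀ x ∈ Set.Icc (0 : ℝ) 1, (1 - x * ((t : ℂ) + Complex.I * τ) ^ 2) ≠ 0 := by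
    intro x hx h0
    have := hre x hx
    rw [h0] at this
    simp at this
  have hT := tendsto_primitive_segment n h' hσ hΦ zero_le_one 0 (t + Complex.I * τ) ?_ ?_ ?_
  · simp only [zero_add, Complex.ofReal_one, one_mul, Complex.ofReal_zero, zero_mul, mul_zero] at hT
    convert! hT using 2
    rw [radialJ, ← intervalIntegral.integral_const_mul]
    refine intervalIntegral.integral_congr fun x _ => ?_
    have := hq x
    simp only [zero_add] at this
    simp only [this]
    rw [mul_pow, pow_succ _ n]
    ring
  · intro x hx
    rw [zero_add, norm_mul, hn, Complex.norm_real, Real.norm_of_nonneg hx.1, mul_one]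
    exact hx.2
  · intro x hx
    rw [hq]
    refine mul_ne_zero ?_ (hne x ⟨hx.1.le, hx.2.le⟩)
    have : (1 - x : ℝ) ≠ 0 := by linarith [hx.2]
    exact_mod_cast this
  · simp_rw [hq]
    have base : IntervalIntegrable (fun x : ℝ => (1 - x) ^ (l - 1)) volume 0 1 := by
      have := (intervalIntegral.intervalIntegrable_rpow' (a := 0) (b := 1)
        (r := l - 1) (by linarith)).comp_sub_left 1
      simpa using this.symm
    have hc : ContinuousOn (fun x : ℝ => ‖1 - x * ((t : ℂ) + Complex.I * τ) ^ 2‖ ^ (l - 1))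
        (Set.uIcc 0 1) := by
      intro x hx
      rw [Set.uIcc_of_le zero_le_one] at hx
      refine ContinuousAt.continuousWithinAt ?_
      exact ContinuousAt.rpow_const (by fun_prop) (Or.inl (norm_ne_zero_iff.2 (hne x hx)))
    refine (base.mul_continuousOn hc).congr ?_
    intro x hx
    rw [Set.uIoc_of_le zero_le_one] at hx
    simp only
    rw [norm_mul, Real.mul_rpow (norm_nonneg _) (norm_nonneg _)]
    congr 2
    rw [← Complex.ofReal_one, ← Complex.ofReal_sub, Complex.norm_real,
      Real.norm_of_nonneg (by linarith [hx.2])]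

theorem integral_laplace_eq_radialJ (n : ℕ) {l t σ : ℝ} (hl : 0 < l) (h : t ^ 2 + σ ^ 2 = 1)
    (hσ : 0 < σ) :
    Complex.I * σ * (((σ ^ 2) ^ (l - 1) : ℝ) : ℂ) *
      ∫ x in (-1 : ℝ)..1, (t + Complex.I * x * σ) ^ n * (((1 - x ^ 2) ^ (l - 1) : ℝ) : ℂ)
    = (t + Complex.I * σ) ^ (n + 1) * radialJ n l (t + Complex.I * σ) -
      (t - Complex.I * σ) ^ (n + 1) * radialJ n l (t - Complex.I * σ) := by
  have ht : t ^ 2 < 1 := by nlinarith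
  obtain ⟨n1, n2⟩ := norm_add_I_mul_eq_one h
  obtain ⟨Φ, hΦ⟩ : ∃ Φ : ℂ → ℂ, ∀ w ∈ Metric.ball (0 : ℂ) 1,
      HasDerivAt Φ (w ^ n * (1 - 2 * t * w + w ^ 2) ^ ((l - 1 : ℝ) : ℂ)) w := by
    refine DifferentiableOn.isExactOn_ball (f := fun w : ℂ =>
      w ^ n * (1 - 2 * t * w + w ^ 2) ^ ((l - 1 : ℝ) : ℂ)) ?_
    intro w hw
    rw [mem_ball_zero_iff] at hw
    have h0 : 1 - 2 * t * w + w ^ 2 ≠ 0 := by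
      rw [one_sub_add_sq_factor h]
      refine mul_ne_zero ?_ ?_ <;>
      · rw [sub_ne_zero]
        intro hh
        have := congrArg norm hh
        rw [norm_one, norm_mul] at this
        simp only [n1, n2, mul_one] at this
        linarith
    refine DifferentiableAt.differentiableWithinAt ?_
    refine DifferentiableAt.mul (by fun_prop) ?_
    exact DifferentiableAt.cpow (by fun_prop) (by fun_prop)
      (one_sub_add_sq_mem_slitPlane ht hw.le h0)
  have T1 := tendsto_primitive_radius n hl h hσ.ne' hΦ
  have T2 := tendsto_primitive_radius n (τ := -σ) hl (by rwa [neg_sq]) (by simpa using hσ.ne') hΦ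
  have hq : ∀ x : ℝ, (1 : ℂ) - 2 * t * (t + x * (Complex.I * σ)) + (t + x * (Complex.I * σ)) ^ 2
      = ((σ ^ 2 * (1 - x ^ 2) : ℝ) : ℂ) := by
    intro x
    have hh : (t : ℂ) ^ 2 + σ ^ 2 = 1 := by exact_mod_cast h
    push_cast
    linear_combination (-1 : ℂ) * hh + x ^ 2 * σ ^ 2 * Complex.I_sq
  have hx2 : ∀ x ∈ Set.Icc (-1 : ℝ) 1, 0 ≤ 1 - x ^ 2 := by
    intro x hx; nlinarith [hx.1, hx.2]
  have T3 := tendsto_primitive_segment n h hσ hΦ (a := -1) (b := 1) (by norm_num) t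
    (Complex.I * σ) ?_ ?_ ?_
  · have T4 := T1.sub T2
    have e : ∀ z : ℝ, Φ (z * (t + Complex.I * σ)) - Φ 0 -
        (Φ (z * (t + Complex.I * ((-σ : ℝ) : ℂ))) - Φ 0) =
        Φ (z * (t + (1 : ℝ) * (Complex.I * σ))) - Φ (z * (t + (-1 : ℝ) * (Complex.I * σ))) := by
      intro z
      push_cast
      rw [show (t : ℂ) + Complex.I * -σ = t + -1 * (Complex.I * σ) by ring, one_mul]
      ring
    simp_rw [e] at T4
    have := tendsto_nhds_unique T3 T4
    push_cast at this
    rw [show (t : ℂ) + Complex.I * -σ = t - Complex.I * σ by ring] at this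
    rw [← this, ← intervalIntegral.integral_const_mul]
    refine intervalIntegral.integral_congr fun x hx => ?_
    rw [Set.uIcc_of_le (by norm_num)] at hx
    have hh := hx2 x hx
    simp only [hq]
    rw [← Complex.ofReal_one, ← Complex.ofReal_sub, ← Complex.ofReal_cpow (by positivity),
      Real.mul_rpow (by positivity) hh, Complex.ofReal_mul]
    rw [show (t : ℂ) + x * (Complex.I * σ) = t + Complex.I * x * σ by ring]
    ring
  · intro x hx
    rw [← sq_le_sq₀ (norm_nonneg _) zero_le_one, Complex.sq_norm, Complex.normSq_apply]
    simp
    nlinarith [hx2 x hx, mul_nonneg (hx2 x hx) (sq_nonneg σ)]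
  · intro x hx
    rw [hq]
    have : 0 < σ ^ 2 * (1 - x ^ 2) := mul_pos (by positivity) (by nlinarith [hx.1, hx.2])
    exact_mod_cast this.ne'
  · simp_rw [hq]
    refine ((intervalIntegrable_one_sub_sq_rpow hl).const_mul ((σ ^ 2) ^ (l - 1))).congr ?_
    intro x hx
    rw [Set.uIoc_of_le (by norm_num)] at hx
    have hh := hx2 x ⟨hx.1.le, hx.2⟩
    simp only
    rw [Complex.norm_real, Real.norm_of_nonneg (by positivity), Real.mul_rpow (by positivity) hh]

theorem radialJ_conj (n : ℕ) (l : ℝ) {v : ℂ} (hv : ∀ r ∈ Set.Ico (0 : ℝ) 1,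
    1 - r * v ^ 2 ∈ Complex.slitPlane) :
    radialJ n l (starRingEnd ℂ v) = starRingEnd ℂ (radialJ n l v) := by
  have hnb : ∀ᵐ x : ℝ ∂volume, x ≠ 1 := by simp [ae_iff, measure_singleton]
  rw [radialJ, radialJ, intervalIntegral.integral_of_le zero_le_one,
    intervalIntegral.integral_of_le zero_le_one, ← integral_conj]
  refine integral_congr_ae ?_
  filter_upwards [ae_restrict_mem measurableSet_Ioc, ae_restrict_of_ae hnb] with r hr hr1
  have hr2 : r < 1 := lt_of_le_of_ne hr.2 hr1
  have hs : ((1 : ℂ) - r) * (1 - r * v ^ 2) ∈ Complex.slitPlane := by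
    have h1 := hv r ⟨hr.1.le, hr2⟩
    rw [Complex.mem_slitPlane_iff] at h1 ⊢
    have e : ((1 : ℂ) - r) = ((1 - r : ℝ) : ℂ) := by push_cast; ring
    rw [e, Complex.re_ofReal_mul, Complex.im_ofReal_mul]
    rcases h1 with h1 | h1
    · exact Or.inl (mul_pos (by linarith) h1)
    · exact Or.inr (mul_ne_zero (by linarith) h1)
  have := Complex.cpow_conj (starRingEnd ℂ (((1 : ℂ) - r) * (1 - r * v ^ 2))) ((l - 1 : ℝ) : ℂ) (by
    rw [Complex.arg_conj, if_neg (Complex.slitPlane_arg_ne_pi hs)]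
    intro h
    have := Complex.neg_pi_lt_arg (((1 : ℂ) - r) * (1 - r * v ^ 2))
    linarith)
  rw [Complex.conj_ofReal, Complex.conj_conj] at this
  rw [map_mul, map_pow, Complex.conj_ofReal, ← this]
  simp

/-- The principal branch of `√(1-u²)`. -/
noncomputable def sqrtOneSub (u : ℂ) : ℂ := (1 - u ^ 2) ^ ((1 / 2 : ℝ) : ℂ)

/-- A holomorphic function on the strip `|Re u| < 1` whose real part on `(-1,1)` is the
Gegenbauer polynomial, and which decays in the upper half-plane. -/
noncomputable def gegenG (n : ℕ) (l : ℝ) (u : ℂ) : ℂ :=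
  ((poch (2 * l) n / n.factorial / (∫ x in (-1 : ℝ)..1, (1 - x ^ 2) ^ (l - 1)) * 2 : ℝ) : ℂ) *
    Complex.I * sqrtOneSub u ^ ((1 - 2 * l : ℝ) : ℂ) *
    ((u - Complex.I * sqrtOneSub u) ^ (n + 1) * radialJ n l (u - Complex.I * sqrtOneSub u))

theorem sqrtOneSub_ofReal {t : ℝ} (ht : t ^ 2 < 1) : sqrtOneSub t = (√(1 - t ^ 2) : ℝ) := by
  rw [sqrtOneSub, ← Complex.ofReal_one, ← Complex.ofReal_pow, ← Complex.ofReal_sub,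
    ← Complex.ofReal_cpow (by linarith), Real.sqrt_eq_rpow]

theorem re_gegenG (n : ℕ) {l t : ℝ} (hl : 0 < l) (ht : t ^ 2 < 1) :
    (gegenG n l t).re = gegenC n l t := by
  set σ := √(1 - t ^ 2) with hσd
  have hσ : 0 < σ := Real.sqrt_pos.2 (by linarith)
  have hσ2 : σ ^ 2 = 1 - t ^ 2 := Real.sq_sqrt (by linarith)
  have h : t ^ 2 + σ ^ 2 = 1 := by linarith
  have hL := integral_laplace_eq_radialJ n hl h hσ
  rw [gegenC_laplace n hl t σ t rfl (by exact_mod_cast hσ2)] at hL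
  set c := ∫ x in (-1 : ℝ)..1, (1 - x ^ 2) ^ (l - 1) with hc
  have hc0 : 0 < c := integral_one_sub_sq_rpow_pos hl
  have hconj : (starRingEnd ℂ) ((t : ℂ) - Complex.I * σ) = t + Complex.I * σ := by simp
  rw [← hconj, radialJ_conj, ← map_pow, ← map_mul] at hL
  · rw [gegenG, sqrtOneSub_ofReal ht, ← hσd, ← hc]
    set z := ((t : ℂ) - Complex.I * σ) ^ (n + 1) * radialJ n l (t - Complex.I * σ)
    have him := congrArg Complex.im hL
    rw [Complex.sub_im, Complex.conj_im, mul_assoc, mul_assoc, Complex.I_mul_im] at him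
    rw [← Complex.ofReal_mul, ← Complex.ofReal_mul, Complex.ofReal_re] at him
    have hrr : ∀ (a b : ℝ) (z : ℂ), ((a : ℂ) * Complex.I * b * z).re = a * b * -z.im := by
      intro a b z; simp
    rw [← Complex.ofReal_cpow hσ.le, hrr]
    have e : z.im = -(σ * ((σ ^ 2) ^ (l - 1) * (c * (n.factorial / poch (2 * l) n) *
      gegenC n l t))) / 2 := by linarith
    rw [e]
    have h1 : σ ^ (1 - 2 * l) * (σ * (σ ^ 2) ^ (l - 1)) = 1 := by
      rw [← Real.rpow_natCast σ 2, ← Real.rpow_mul hσ.le]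
      nth_rewrite 2 [← Real.rpow_one σ]
      rw [← Real.rpow_add hσ, ← Real.rpow_add hσ]
      push_cast
      rw [show 1 - 2 * l + (1 + 2 * (l - 1)) = 0 by ring, Real.rpow_zero]
    have h2 := (poch_pos (a := 2 * l) (by linarith) n).ne'
    have h3 : (n.factorial : ℝ) ≠ 0 := by positivity
    calc _ = (σ ^ (1 - 2 * l) * (σ * (σ ^ 2) ^ (l - 1))) * gegenC n l t *
          ((poch (2 * l) n / poch (2 * l) n) * (n.factorial / n.factorial) * (c / c)) := by ring
      _ = gegenC n l t := by
        rw [h1, div_self h2, div_self h3, div_self hc0.ne']; ring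
  · intro r hr
    refine Complex.mem_slitPlane_iff.2 (Or.inl ?_)
    have : (1 - r * ((t : ℂ) - Complex.I * σ) ^ 2).re = 1 - r * (t ^ 2 - σ ^ 2) := by
      simp [pow_two]
    rw [this]
    nlinarith [hr.1, hr.2]

theorem one_sub_mul_sq_mem_slitPlane {v : ℂ} (hv : v.im < 0) {r : ℝ} (hr : 0 ≤ r) :
    1 - r * v ^ 2 ∈ Complex.slitPlane := by
  rw [Complex.mem_slitPlane_iff]
  by_contra! h
  have h1 : (1 - r * v ^ 2).re = 1 - r * (v.re ^ 2 - v.im ^ 2) := by simp [pow_two]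
  have h2 : (1 - r * v ^ 2).im = -(2 * (r * v.re) * v.im) := by simp [pow_two]; ring
  rw [h1, h2] at h
  obtain ⟨h3, h4⟩ := h
  have h5 : r * v.re = 0 := by
    have : (r * v.re) * v.im = 0 := by linarith
    exact (mul_eq_zero.1 this).resolve_right hv.ne
  have h6 : r * v.re ^ 2 = 0 := by rw [pow_two, ← mul_assoc, h5, zero_mul]
  nlinarith [mul_nonneg hr (sq_nonneg v.im)]

theorem one_sub_mul_mem_slitPlane {v : ℂ} (hv : v.im < 0) {r : ℝ} (hr : 0 ≤ r) (hr1 : r < 1) :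
    ((1 : ℂ) - r) * (1 - r * v ^ 2) ∈ Complex.slitPlane := by
  have h1 := one_sub_mul_sq_mem_slitPlane hv hr
  rw [Complex.mem_slitPlane_iff] at h1 ⊢
  have e : ((1 : ℂ) - r) = ((1 - r : ℝ) : ℂ) := by push_cast; ring
  rw [e, Complex.re_ofReal_mul, Complex.im_ofReal_mul]
  rcases h1 with h1 | h1
  · exact Or.inl (mul_pos (by linarith) h1)
  · exact Or.inr (mul_ne_zero (by linarith) h1)

theorem radialJ_eq (n : ℕ) (l : ℝ) (v : ℂ) : radialJ n l v =
    ∫ r in Set.Ioo (0 : ℝ) 1, (r : ℂ) ^ n * ((1 - r) * (1 - r * v ^ 2)) ^ ((l - 1 : ℝ) : ℂ) := by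
  rw [radialJ, intervalIntegral.integral_of_le zero_le_one, integral_Ioc_eq_integral_Ioo]

theorem norm_radialJ_integrand (n : ℕ) (l : ℝ) (v : ℂ) {r : ℝ} (hr : r ∈ Set.Ioo (0 : ℝ) 1) :
    ‖(r : ℂ) ^ n * ((1 - r) * (1 - r * v ^ 2)) ^ ((l - 1 : ℝ) : ℂ)‖
      = r ^ n * (1 - r) ^ (l - 1) * ‖1 - r * v ^ 2‖ ^ (l - 1) := by
  have e : ((1 : ℂ) - r) = ((1 - r : ℝ) : ℂ) := by push_cast; ring
  rw [norm_mul, norm_pow, Complex.norm_cpow_real, norm_mul, e, Complex.norm_real,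
    Complex.norm_real, Real.norm_of_nonneg hr.1.le, Real.norm_of_nonneg (by linarith [hr.2]),
    Real.mul_rpow (by linarith [hr.2]) (norm_nonneg _), mul_assoc]

theorem continuousOn_radialJ_integrand (n : ℕ) (l : ℝ) {v : ℂ} (hv : v.im < 0) :
    ContinuousOn (fun r : ℝ => (r : ℂ) ^ n *
      ((1 - r) * (1 - r * v ^ 2)) ^ ((l - 1 : ℝ) : ℂ)) (Set.Ioo 0 1) := by
  intro r hr
  refine ContinuousAt.continuousWithinAt (ContinuousAt.mul (by fun_prop) ?_)
  exact ContinuousAt.cpow (by fun_prop) (by fun_prop)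
    (one_sub_mul_mem_slitPlane hv hr.1.le hr.2)

theorem integrableOn_one_sub_rpow {l : ℝ} (hl : 0 < l) :
    IntegrableOn (fun x : ℝ => (1 - x) ^ (l - 1)) (Set.Ioo 0 1) := by
  have := (intervalIntegral.intervalIntegrable_rpow' (a := 0) (b := 1)
    (r := l - 1) (by linarith)).comp_sub_left 1
  have := this.symm
  simp only [sub_self, sub_zero] at this
  rw [intervalIntegrable_iff_integrableOn_Ioo_of_le zero_le_one] at this
  exact this

theorem differentiableOn_radialJ (n : ℕ) {l : ℝ} (hl : 0 < l) :
    DifferentiableOn ℂ (radialJ n l) {v | v.im < 0} := by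
  have hU : IsOpen {v : ℂ | v.im < 0} := isOpen_lt Complex.continuous_im continuous_const
  rw [show radialJ n l = fun v => ∫ r in Set.Ioo (0 : ℝ) 1,
    (r : ℂ) ^ n * ((1 - r) * (1 - r * v ^ 2)) ^ ((l - 1 : ℝ) : ℂ) from funext (radialJ_eq n l)]
  refine differentiableOn_integral_of_dominated hU ?_ ?_ ?_
  · intro v hv
    exact (continuousOn_radialJ_integrand n l hv).aestronglyMeasurable measurableSet_Ioo
  · filter_upwards [ae_restrict_mem measurableSet_Ioo] with r hr v hv
    refine DifferentiableAt.differentiableWithinAt (DifferentiableAt.const_mul ?_ _)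
    exact DifferentiableAt.cpow (by fun_prop) (by fun_prop)
      (one_sub_mul_mem_slitPlane hv hr.1.le hr.2)
  · intro z hz
    obtain ⟨ε, hε, hεU⟩ := Metric.nhds_basis_closedBall.mem_iff.1 (hU.mem_nhds hz)
    have hK : IsCompact (Metric.closedBall z ε ×ˢ Set.Icc (0 : ℝ) 1) :=
      (isCompact_closedBall z ε).prod isCompact_Icc
    have hc : ContinuousOn (fun x : ℂ × ℝ => ‖1 - x.2 * x.1 ^ 2‖)
      (Metric.closedBall z ε ×ˢ Set.Icc (0 : ℝ) 1) := by fun_prop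
    have hne : (Metric.closedBall z ε ×ˢ Set.Icc (0 : ℝ) 1).Nonempty :=
      ⟨(z, 0), Metric.mem_closedBall_self hε.le, by simp⟩
    obtain ⟨x₀, hx₀, hmin⟩ := hK.exists_isMinOn hne hc
    obtain ⟨x₁, hx₁, hmax⟩ := hK.exists_isMaxOn hne hc
    have hpos : 0 < ‖1 - x₀.2 * x₀.1 ^ 2‖ := by
      rw [norm_pos_iff]
      exact Complex.slitPlane_ne_zero (one_sub_mul_sq_mem_slitPlane (hεU hx₀.1) hx₀.2.1)
    refine ⟨ε, hε, fun r => (1 - r) ^ (l - 1) * (‖1 - x₀.2 * x₀.1 ^ 2‖ ^ (l - 1) +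
      ‖1 - x₁.2 * x₁.1 ^ 2‖ ^ (l - 1)), (integrableOn_one_sub_rpow hl).mul_const _, ?_⟩
    filter_upwards [ae_restrict_mem measurableSet_Ioo] with r hr v hv _
    rw [norm_radialJ_integrand n l v hr]
    have hm : (v, r) ∈ Metric.closedBall z ε ×ˢ Set.Icc (0 : ℝ) 1 :=
      ⟨Metric.ball_subset_closedBall hv, hr.1.le, hr.2.le⟩
    have h1 := rpow_le_add_of_mem_Icc hpos (hmin hm) (hmax hm) (l - 1)
    have h2 : 0 ≤ (1 - r) ^ (l - 1) := Real.rpow_nonneg (by linarith [hr.2]) _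
    have h3 : r ^ n ≤ 1 := pow_le_one₀ hr.1.le hr.2.le
    refine mul_le_mul ?_ h1 (by positivity) h2
    exact mul_le_of_le_one_left h2 h3

theorem sqrtOneSub_sq (u : ℂ) : sqrtOneSub u ^ 2 = 1 - u ^ 2 := by
  rw [sqrtOneSub]
  have := Complex.cpow_nat_inv_pow (1 - u ^ 2) (n := 2) (by norm_num)
  convert! this using 3
  push_cast; norm_num

theorem one_sub_sq_re_pos {u : ℂ} (hu : |u.re| < 1) : 0 < (1 - u ^ 2).re := by
  have h : (1 - u ^ 2).re = 1 - (u.re ^ 2 - u.im ^ 2) := by simp [pow_two]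
  rw [h]
  have := (sq_lt_one_iff_abs_lt_one u.re).2 hu
  nlinarith [sq_nonneg u.im]

theorem sqrtOneSub_re_pos {u : ℂ} (hu : |u.re| < 1) : 0 < (sqrtOneSub u).re := by
  have h := one_sub_sq_re_pos hu
  have h0 : 1 - u ^ 2 ≠ 0 := fun h0 => by rw [h0] at h; simp at h
  rw [sqrtOneSub, Complex.cpow_ofReal_re]
  refine mul_pos (Real.rpow_pos_of_pos (norm_pos_iff.2 h0) _) (Real.cos_pos_of_mem_Ioo ?_)
  have := Complex.neg_pi_lt_arg (1 - u ^ 2)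
  have := Complex.arg_le_pi (1 - u ^ 2)
  have h1 := (Complex.abs_arg_lt_pi_div_two_iff.2 (Or.inl h))
  rw [abs_lt] at h1
  constructor <;> linarith [Real.pi_pos]

theorem abs_im_lt_sqrtOneSub_re {u : ℂ} (hu : |u.re| < 1) : |u.im| < (sqrtOneSub u).re := by
  have h := sqrtOneSub_sq u
  have ha := sqrtOneSub_re_pos hu
  set a := (sqrtOneSub u).re
  set b := (sqrtOneSub u).im
  have h1 : a ^ 2 - b ^ 2 = 1 - u.re ^ 2 + u.im ^ 2 := by
    have := congrArg Complex.re h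
    simp [pow_two] at this
    simp only [a, b]
    linarith
  have h2 : a * b = -(u.re * u.im) := by
    have := congrArg Complex.im h
    simp [pow_two] at this
    simp only [a, b]
    linarith
  have hp := (sq_lt_one_iff_abs_lt_one u.re).2 hu
  refine abs_lt_of_sq_lt_sq ?_ ha.le
  by_contra! hc
  have h3 : a ^ 2 * b ^ 2 = u.re ^ 2 * u.im ^ 2 := by
    rw [← mul_pow, h2]; ring
  have hb : b ^ 2 < u.re ^ 2 := by linarith
  have h4 : 0 < u.im ^ 2 := by nlinarith
  nlinarith [sq_nonneg b]

theorem differentiableOn_sqrtOneSub : DifferentiableOn ℂ sqrtOneSub {u | |u.re| < 1} := by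
  intro u hu
  refine DifferentiableAt.differentiableWithinAt ?_
  exact DifferentiableAt.cpow (by fun_prop) (by fun_prop)
    (Complex.mem_slitPlane_iff.2 (Or.inl (one_sub_sq_re_pos hu)))

theorem im_sub_I_mul_sqrtOneSub {u : ℂ} (hu : |u.re| < 1) :
    (u - Complex.I * sqrtOneSub u).im < 0 := by
  have := abs_im_lt_sqrtOneSub_re hu
  have := le_abs_self u.im
  simp
  linarith

theorem differentiableOn_gegenG (n : ℕ) {l : ℝ} (hl : 0 < l) :
    DifferentiableOn ℂ (gegenG n l) {u | |u.re| < 1} := by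
  have h1 := differentiableOn_sqrtOneSub
  have h2 : DifferentiableOn ℂ (fun u => u - Complex.I * sqrtOneSub u) {u | |u.re| < 1} :=
    differentiableOn_id.sub (h1.const_mul _)
  have h3 : DifferentiableOn ℂ (fun u => radialJ n l (u - Complex.I * sqrtOneSub u))
      {u | |u.re| < 1} :=
    DifferentiableOn.comp (differentiableOn_radialJ n hl) h2 fun u hu => im_sub_I_mul_sqrtOneSub hu
  refine DifferentiableOn.mul (DifferentiableOn.const_mul ?_ _) ((h2.pow _).mul h3)
  refine h1.cpow (differentiableOn_const _) fun u hu => ?_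
  exact Complex.mem_slitPlane_iff.2 (Or.inl (sqrtOneSub_re_pos hu))

theorem exists_one_add_rpow_le_exp (a : ℝ) {b : ℝ} (hb : 0 < b) :
    ∃ C : ℝ, 0 < C ∧ ∀ z : ℝ, 0 ≤ z → (1 + z) ^ a ≤ C * Real.exp (b * z) := by
  rcases le_total a 0 with ha | ha
  · refine ⟨1, one_pos, fun z hz => ?_⟩
    have h1 := Real.rpow_le_one_of_one_le_of_nonpos (by linarith : 1 ≤ 1 + z) ha
    have h2 := Real.one_le_exp (by positivity : 0 ≤ b * z)
    linarith
  · set M := max 1 (a / b) with hM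
    have hM1 : 1 ≤ M := le_max_left _ _
    have hM0 : 0 < M := by linarith
    have hM2 : a ≤ b * M := by
      have := le_max_right 1 (a / b)
      rw [div_le_iff₀ hb] at this
      linarith
    refine ⟨M ^ a, by positivity, fun z hz => ?_⟩
    have h1 : 1 + z ≤ M * Real.exp (z / M) := by
      have := Real.add_one_le_exp (z / M)
      calc 1 + z ≤ M + z := by linarith
        _ = M * (z / M + 1) := by field_simp; ring
        _ ≤ _ := by gcongr
    calc (1 + z) ^ a ≤ (M * Real.exp (z / M)) ^ a := Real.rpow_le_rpow (by linarith) h1 ha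
      _ = M ^ a * Real.exp (z / M * a) := by
        rw [Real.mul_rpow hM0.le (Real.exp_pos _).le, ← Real.exp_mul]
      _ ≤ M ^ a * Real.exp (b * z) := by
        have : z / M * a ≤ b * z := by
          rw [div_mul_eq_mul_div, div_le_iff₀ hM0]
          nlinarith
        gcongr

theorem exists_poch_div_factorial_le {a : ℝ} (ha : 0 < a) :
    ∃ C : ℝ, 0 < C ∧ ∀ n : ℕ, 1 ≤ n → poch a n / n.factorial ≤ C * (n : ℝ) ^ (a - 1) := by
  have h1 := (Real.GammaSeq_tendsto_Gamma a).inv₀ (Real.Gamma_pos_of_pos ha).ne'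
  obtain ⟨C, hC⟩ := h1.bddAbove_range
  refine ⟨max C 1, by positivity, fun n hn => ?_⟩
  have hn0 : (0 : ℝ) < n := by exact_mod_cast hn
  have h2 : (Real.GammaSeq a n)⁻¹ ≤ C := hC ⟨n, rfl⟩
  have h3 : (Real.GammaSeq a n)⁻¹ = poch a n * (a + n) / ((n : ℝ) ^ a * n.factorial) := by
    rw [Real.GammaSeq, inv_div, ← poch_succ]; rfl
  have h4 := poch_pos ha n
  have h5 : (0 : ℝ) < (n : ℝ) ^ (a - 1) := by positivity
  have h6 : (n : ℝ) ^ a = (n : ℝ) ^ (a - 1) * n := by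
    rw [← Real.rpow_add_one hn0.ne']; congr 1; ring
  rw [div_le_iff₀ (by positivity)]
  rw [h3, div_le_iff₀ (by positivity), h6] at h2
  have h7 : poch a n * n ≤ poch a n * (a + n) := by gcongr; linarith
  have h8 : poch a n * n ≤ (C * (n : ℝ) ^ (a - 1) * n.factorial) * n := by linarith
  have h9 := le_of_mul_le_mul_right h8 hn0
  refine h9.trans ?_
  gcongr
  exact le_max_left _ _

theorem exists_norm_radialJ_le {l c : ℝ} (hl : 0 < l) (hc : 0 < c) :
    ∃ C : ℝ, 0 < C ∧ ∀ n : ℕ, 1 ≤ n → ∀ v : ℂ, v.im < 0 → ‖v‖ ≤ 1 → c / n ≤ ‖1 - v ^ 2‖ →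
      ‖radialJ n l v‖ ≤ C * (n : ℝ) ^ (-l) * ‖1 - v ^ 2‖ ^ (l - 1) := by
  obtain ⟨M, hM, hM'⟩ := exists_one_add_rpow_le_exp (l - 1) (b := c / 2) (by positivity)
  set B : ℝ := 2⁻¹ ^ (l - 1) + M
  have hB : 0 < B := by positivity
  refine ⟨B * (2 ^ l * Real.Gamma l), by have := Real.Gamma_pos_of_pos hl; positivity,
    fun n hn v hv hv1 hE => ?_⟩
  have hn0 : (0 : ℝ) < n := by exact_mod_cast hn
  set E := ‖1 - v ^ 2‖ with hEd
  have hE0 : 0 < E := lt_of_lt_of_le (by positivity) hE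
  have hpt : ∀ r ∈ Set.Ioo (0 : ℝ) 1, ‖1 - r * v ^ 2‖ ^ (l - 1) ≤
      B * E ^ (l - 1) * Real.exp (n / 2 * (1 - r)) := by
    intro r hr
    have hv2 : ‖v ^ 2‖ ≤ 1 := by rw [norm_pow]; exact pow_le_one₀ (norm_nonneg _) hv1
    have h1 := norm_one_sub_le_two_mul hv2 hr.1.le hr.2.le
    have h2 : ‖1 - r * v ^ 2‖ ≤ E * (1 + (1 - r) / E) := by
      have e : 1 - r * v ^ 2 = (1 - v ^ 2) + ((1 - r : ℝ) : ℂ) * v ^ 2 := by push_cast; ring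
      rw [mul_add, mul_one, mul_div_cancel₀ _ hE0.ne', e]
      refine (norm_add_le _ _).trans ?_
      rw [norm_mul, Complex.norm_real, Real.norm_of_nonneg (by linarith [hr.2])]
      have : (1 - r) * ‖v ^ 2‖ ≤ 1 - r := mul_le_of_le_one_right (by linarith [hr.2]) hv2
      linarith
    have h3 := rpow_le_add_of_mem_Icc (a := E * 2⁻¹) (by positivity) (by linarith) h2 (l - 1)
    have hy : 0 ≤ (1 - r) / E := div_nonneg (by linarith [hr.2]) hE0.le
    have h4 := hM' _ hy
    rw [Real.mul_rpow hE0.le (by norm_num), Real.mul_rpow hE0.le (by linarith)] at h3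
    have h5 : c / 2 * ((1 - r) / E) ≤ n / 2 * (1 - r) := by
      rw [← mul_div_assoc, div_le_iff₀ hE0]
      rw [div_le_iff₀ hn0] at hE
      nlinarith [mul_le_mul_of_nonneg_right hE (by linarith [hr.2] : (0 : ℝ) ≤ 1 - r)]
    have h6 : (1 + (1 - r) / E) ^ (l - 1) ≤ M * Real.exp (n / 2 * (1 - r)) := by
      refine h4.trans ?_
      gcongr
    have h7 : 1 ≤ Real.exp (n / 2 * (1 - r)) :=
      Real.one_le_exp (mul_nonneg (by positivity) (by linarith [hr.2]))
    have h8 : (2⁻¹ : ℝ) ^ (l - 1) ≤ 2⁻¹ ^ (l - 1) * Real.exp (n / 2 * (1 - r)) :=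
      le_mul_of_one_le_right (by positivity) h7
    calc _ ≤ E ^ (l - 1) * (2⁻¹ ^ (l - 1) + (1 + (1 - r) / E) ^ (l - 1)) := by linarith
      _ ≤ E ^ (l - 1) * (2⁻¹ ^ (l - 1) * Real.exp (n / 2 * (1 - r)) +
          M * Real.exp (n / 2 * (1 - r))) := by gcongr
      _ = _ := by ring
  have hGi : IntegrableOn (fun y : ℝ => y ^ (l - 1) * Real.exp (-(n / 2 * y))) (Set.Ioi 0) := by
    have := Real.integral_rpow_mul_exp_neg_mul_Ioi hl (r := n / 2) (by positivity)
    by_contra hni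
    rw [integral_undef hni] at this
    have := mul_pos (Real.rpow_pos_of_pos (by positivity : (0 : ℝ) < 1 / (n / 2)) l)
      (Real.Gamma_pos_of_pos hl)
    linarith
  have hGi' : IntegrableOn (fun y : ℝ => (1 - y) ^ (l - 1) * Real.exp (-(n / 2 * (1 - y))))
      (Set.Ioo 0 1) := by
    have h1 : IntervalIntegrable (fun y : ℝ => y ^ (l - 1) * Real.exp (-(n / 2 * y)))
        volume 0 1 := by
      rw [intervalIntegrable_iff_integrableOn_Ioc_of_le zero_le_one]
      exact hGi.mono_set Set.Ioc_subset_Ioi_self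
    have h2 := (h1.comp_sub_left 1).symm
    simp only [sub_self, sub_zero] at h2
    rwa [intervalIntegrable_iff_integrableOn_Ioo_of_le zero_le_one] at h2
  have hGv : ∫ y in Set.Ioo (0 : ℝ) 1, (1 - y) ^ (l - 1) * Real.exp (-(n / 2 * (1 - y))) ≤
      (n : ℝ) ^ (-l) * (2 ^ l * Real.Gamma l) := by
    have e1 : ∫ y in Set.Ioo (0 : ℝ) 1, (1 - y) ^ (l - 1) * Real.exp (-(n / 2 * (1 - y))) =
        ∫ y in (0 : ℝ)..1, (1 - y) ^ (l - 1) * Real.exp (-(n / 2 * (1 - y))) := by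
      rw [intervalIntegral.integral_of_le zero_le_one, integral_Ioc_eq_integral_Ioo]
    have e2 := intervalIntegral.integral_comp_sub_left (a := 0) (b := 1)
      (fun y : ℝ => y ^ (l - 1) * Real.exp (-(n / 2 * y))) 1
    rw [e1, e2, sub_self, sub_zero, intervalIntegral.integral_of_le zero_le_one]
    have e3 := Real.integral_rpow_mul_exp_neg_mul_Ioi hl (r := n / 2) (by positivity)
    have e4 : (1 / ((n : ℝ) / 2)) ^ l = (n : ℝ) ^ (-l) * 2 ^ l := by
      rw [one_div_div, Real.div_rpow (by norm_num) hn0.le, Real.rpow_neg hn0.le]; ring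
    rw [e4, mul_assoc] at e3
    rw [← e3]
    refine setIntegral_mono_set hGi ?_ Set.Ioc_subset_Ioi_self.eventuallyLE
    filter_upwards [ae_restrict_mem measurableSet_Ioi] with y hy
    have : (0 : ℝ) < y := hy
    positivity
  rw [radialJ_eq]
  calc _ ≤ ∫ r in Set.Ioo (0 : ℝ) 1, (B * E ^ (l - 1)) *
        ((1 - r) ^ (l - 1) * Real.exp (-(n / 2 * (1 - r)))) := by
        refine norm_integral_le_of_norm_le (hGi'.const_mul _) ?_
        filter_upwards [ae_restrict_mem measurableSet_Ioo] with r hr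
        rw [norm_radialJ_integrand n l v hr]
        have h1 : r ^ n ≤ Real.exp (-(n * (1 - r))) := by
          have := Real.add_one_le_exp (r - 1)
          have h2 : r ≤ Real.exp (r - 1) := by linarith
          calc r ^ n ≤ Real.exp (r - 1) ^ n := pow_le_pow_left₀ hr.1.le h2 n
            _ = _ := by rw [← Real.exp_nat_mul]; congr 1; ring
        have h2 : 0 ≤ (1 - r) ^ (l - 1) := Real.rpow_nonneg (by linarith [hr.2]) _
        calc _ ≤ Real.exp (-(n * (1 - r))) * (1 - r) ^ (l - 1) *
              (B * E ^ (l - 1) * Real.exp (n / 2 * (1 - r))) := by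
              gcongr
              exact hpt r hr
          _ = (B * E ^ (l - 1)) * ((1 - r) ^ (l - 1) * (Real.exp (-(n * (1 - r))) *
                Real.exp (n / 2 * (1 - r)))) := by ring
          _ = _ := by rw [← Real.exp_add]; congr 3; ring
    _ ≤ (B * E ^ (l - 1)) * ((n : ℝ) ^ (-l) * (2 ^ l * Real.Gamma l)) := by
        rw [integral_const_mul]
        gcongr
    _ = _ := by ring

theorem norm_sqrtOneSub_bounds {u : ℂ} (hu : |u.re| < 1) (h0 : 0 ≤ u.im) (h1 : u.im ≤ 1) :
    1 - |u.re| ≤ ‖sqrtOneSub u‖ ^ 2 ∧ u.im ≤ ‖sqrtOneSub u‖ ^ 2 ∧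
      ‖sqrtOneSub u‖ ^ 2 ≤ 3 * (1 - |u.re| + u.im) := by
  have e : ‖sqrtOneSub u‖ ^ 2 = ‖1 - u‖ * ‖1 + u‖ := by
    rw [← norm_pow, sqrtOneSub_sq, ← norm_mul]; congr 1; ring
  have up : ∀ w : ℂ, ‖w‖ ≤ |w.re| + |w.im| := Complex.norm_le_abs_re_add_abs_im
  have lo1 := Complex.abs_re_le_norm
  have lo2 := Complex.abs_im_le_norm
  have main : ∀ w z : ℂ, |w.re| = 1 - |u.re| → |z.re| = 1 + |u.re| → |w.im| = u.im →
      |z.im| = u.im → 1 - |u.re| ≤ ‖w‖ * ‖z‖ ∧ u.im ≤ ‖w‖ * ‖z‖ ∧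
        ‖w‖ * ‖z‖ ≤ 3 * (1 - |u.re| + u.im) := by
    intro w z hw hz hw' hz'
    have a1 := up w
    have a2 := up z
    have a3 := lo1 w
    have a4 := lo1 z
    have a5 := lo2 w
    rw [hw, hw'] at a1
    rw [hz, hz'] at a2
    rw [hw] at a3
    rw [hz] at a4
    rw [hw'] at a5
    have a6 := abs_nonneg u.re
    refine ⟨by nlinarith [norm_nonneg w], by nlinarith [norm_nonneg w], ?_⟩
    rw [mul_comm 3]
    exact mul_le_mul a1 (by linarith) (norm_nonneg _) (by linarith)
  rw [e]
  have hb := abs_lt.1 hu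
  rcases le_total 0 u.re with hp | hp
  · refine main _ _ ?_ ?_ ?_ ?_
    · simp only [Complex.sub_re, Complex.one_re]
      rw [abs_of_nonneg hp, abs_of_nonneg (by linarith)]
    · simp only [Complex.add_re, Complex.one_re]
      rw [abs_of_nonneg hp, abs_of_nonneg (by linarith)]
    · simp [abs_of_nonneg h0]
    · simp [abs_of_nonneg h0]
  · rw [mul_comm]
    refine main _ _ ?_ ?_ ?_ ?_
    · simp only [Complex.add_re, Complex.one_re]
      rw [abs_of_nonpos hp, abs_of_nonneg (by linarith)]; ring
    · simp only [Complex.sub_re, Complex.one_re]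
      rw [abs_of_nonpos hp, abs_of_nonneg (by linarith)]; ring
    · simp [abs_of_nonneg h0]
    · simp [abs_of_nonneg h0]

theorem norm_sub_I_mul_sqrtOneSub_bounds {u : ℂ} (hu : |u.re| < 1) (h0 : 0 ≤ u.im)
    (h1 : u.im ≤ 1) :
    1 / 5 ≤ ‖u - Complex.I * sqrtOneSub u‖ ∧ ‖u - Complex.I * sqrtOneSub u‖ ≤ 1 ∧
      ‖u - Complex.I * sqrtOneSub u‖ ^ 2 ≤ 1 - u.im / ‖sqrtOneSub u‖ ∧
      ‖1 - (u - Complex.I * sqrtOneSub u) ^ 2‖ =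
        2 * ‖u - Complex.I * sqrtOneSub u‖ * ‖sqrtOneSub u‖ := by
  obtain ⟨b1, b2, b3⟩ := norm_sqrtOneSub_bounds hu h0 h1
  have ha := abs_im_lt_sqrtOneSub_re hu
  have hs2 := sqrtOneSub_sq u
  have hre := Complex.re_le_norm (sqrtOneSub u)
  set s := sqrtOneSub u
  set v := u - Complex.I * s with hv
  rw [abs_of_nonneg h0] at ha
  have hvw : v * (u + Complex.I * s) = 1 := by
    rw [hv]; linear_combination hs2 - s ^ 2 * Complex.I_sq
  have hw : u + Complex.I * s = v⁻¹ := by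
    rw [eq_inv_of_mul_eq_one_right hvw]
  have hvim : v.im = u.im - s.re := by simp [hv]
  have hwim : (u + Complex.I * s).im = u.im + s.re := by simp
  have hv0 : v ≠ 0 := left_ne_zero_of_mul_eq_one hvw
  have hn0 : 0 < ‖v‖ := norm_pos_iff.2 hv0
  have hsp : 0 < ‖s‖ := by linarith
  have hD : ‖s‖ ≤ 3 := by
    have : ‖s‖ ^ 2 ≤ 3 ^ 2 := by nlinarith [abs_nonneg u.re]
    exact le_of_sq_le_sq this (by norm_num)
  have hu2 : ‖u‖ ≤ 2 := by
    have := Complex.norm_le_abs_re_add_abs_im u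
    rw [abs_of_nonneg h0] at this
    linarith
  have hratio : ‖v‖ ^ 2 * (u.im + s.re) = s.re - u.im := by
    rw [hw, Complex.inv_im, hvim, Complex.normSq_eq_norm_sq] at hwim
    rw [← hwim]
    field_simp
    ring
  have hle : ‖v‖ ^ 2 ≤ 1 - u.im / ‖s‖ := by
    have : ‖v‖ ^ 2 = 1 - 2 * u.im / (u.im + s.re) := by
      have h2 : u.im + s.re ≠ 0 := by linarith
      rw [eq_sub_iff_add_eq]
      field_simp
      linarith
    rw [this]
    have h3 : u.im / ‖s‖ ≤ 2 * u.im / (u.im + s.re) := by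
      rw [div_le_div_iff₀ hsp (by linarith)]
      nlinarith
    linarith
  refine ⟨?_, ?_, hle, ?_⟩
  · have h2 : ‖v‖ * ‖u + Complex.I * s‖ = 1 := by rw [← norm_mul, hvw, norm_one]
    have h3 : ‖u + Complex.I * s‖ ≤ 5 := by
      refine (norm_add_le _ _).trans ?_
      rw [norm_mul, Complex.norm_I, one_mul]
      linarith
    nlinarith
  · have : 0 ≤ u.im / ‖s‖ := by positivity
    have h2 : ‖v‖ ^ 2 ≤ 1 ^ 2 := by linarith
    exact le_of_sq_le_sq h2 zero_le_one
  · have : 1 - v ^ 2 = 2 * v * s * Complex.I := by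
      rw [← hvw, hv]; ring
    rw [this]
    simp

theorem one_add_div_le_mul_sq {n r D τ : ℝ} (hn : 0 < n) (hr : 0 < r) (hD : 0 < D) (hτ : 0 ≤ τ)
    (hrn : 1 ≤ 2 * n * r) (hDr : D ^ 2 ≤ 3 * (r ^ 2 + τ)) :
    1 + n * τ / r ≤ 12 * (1 + n * τ / D) ^ 2 := by
  obtain ⟨X, hX⟩ : ∃ X, X = n * τ / r := ⟨_, rfl⟩
  obtain ⟨Y, hY⟩ : ∃ Y, Y = n * τ / D := ⟨_, rfl⟩
  rw [← hX, ← hY]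
  have hX0 : 0 ≤ X := by rw [hX]; positivity
  have hY0 : 0 ≤ Y := by rw [hY]; positivity
  have hYD : Y * D = n * τ := by rw [hY]; field_simp
  have hXr : X * r = n * τ := by rw [hX]; field_simp
  rcases le_total τ (r ^ 2) with hc | hc
  · have h2 : D ≤ 3 * r := le_of_sq_le_sq (by nlinarith) (by linarith)
    have h3 : X * r ≤ (3 * Y) * r := by
      rw [hXr, ← hYD]; nlinarith
    have := le_of_mul_le_mul_right h3 hr
    nlinarith [sq_nonneg Y]
  · have h2 : D ^ 2 ≤ 6 * τ := by linarith
    have hip : 0 < τ := lt_of_lt_of_le (by positivity) hc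
    have h4 : X ≤ 2 * n ^ 2 * τ := by
      rw [hX, div_le_iff₀ hr]
      have h6 : 0 ≤ n * τ := by positivity
      have := mul_le_mul_of_nonneg_left hrn h6
      linarith
    have h5 : n ^ 2 * τ * τ ≤ (6 * Y ^ 2) * τ := by
      calc n ^ 2 * τ * τ = Y ^ 2 * D ^ 2 := by rw [← mul_pow, hYD]; ring
        _ ≤ Y ^ 2 * (6 * τ) := by gcongr
        _ = _ := by ring
    have := le_of_mul_le_mul_right h5 hip
    nlinarith [sq_nonneg Y]

theorem pow_succ_le_exp_neg {v y : ℝ} (hv : 0 ≤ v) (hv1 : v ≤ 1) (h : v ^ 2 ≤ 1 - y) (n : ℕ) :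
    v ^ (n + 1) ≤ Real.exp (-(1 / 2 * (n * y))) := by
  have h2 : v ^ (n + 1) ≤ v ^ n := pow_le_pow_of_le_one hv hv1 n.le_succ
  refine h2.trans (le_of_sq_le_sq ?_ (Real.exp_pos _).le)
  have h3 := Real.add_one_le_exp (-y)
  have h4 : v ^ 2 ≤ Real.exp (-y) := by linarith
  calc (v ^ n) ^ 2 = (v ^ 2) ^ n := by ring
    _ ≤ Real.exp (-y) ^ n := pow_le_pow_left₀ (by positivity) h4 n
    _ = Real.exp (-(1 / 2 * (n * y))) ^ 2 := by
      rw [← Real.exp_nat_mul, ← Real.exp_nat_mul]; congr 1; push_cast; ring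

theorem exp_neg_half_le_rpow {K C X Y : ℝ} (hK : 0 ≤ K) (hX : 0 ≤ X) (hY : 0 ≤ Y)
    (hXY : 1 + X ≤ 12 * (1 + Y) ^ 2) (H : (1 + Y) ^ (2 * K) ≤ C * Real.exp (1 / 2 * Y)) :
    Real.exp (-(1 / 2 * Y)) ≤ 12 ^ K * C * (1 + X) ^ (-K) := by
  have h2 : (1 + X) ^ K ≤ 12 ^ K * C * Real.exp (1 / 2 * Y) := by
    calc (1 + X) ^ K ≤ (12 * (1 + Y) ^ 2) ^ K := Real.rpow_le_rpow (by positivity) hXY hK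
      _ = 12 ^ K * (1 + Y) ^ (2 * K) := by
        rw [Real.mul_rpow (by norm_num) (by positivity), Real.rpow_mul (by positivity)]
        norm_num
      _ ≤ 12 ^ K * (C * Real.exp (1 / 2 * Y)) := by gcongr
      _ = _ := by ring
  rw [Real.exp_neg, Real.rpow_neg (by positivity), ← div_eq_mul_inv, le_div_iff₀ (by positivity),
    inv_mul_le_iff₀ (Real.exp_pos _)]
  linarith

set_option maxHeartbeats 1000000 in
theorem exists_norm_gegenG_le {l K : ℝ} (hl : 0 < l) (hK : 0 ≤ K) :
    ∃ C : ℝ, 0 < C ∧ ∀ n : ℕ, 1 ≤ n → ∀ u : ℂ, |u.re| < 1 → 0 ≤ u.im → u.im ≤ 1 →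
      ∀ r : ℝ, 0 < r → r ^ 2 = 1 - |u.re| → 1 / (2 * n) ≤ r →
      n * ‖gegenG n l u‖ ≤ C * (n : ℝ) ^ l * (r ^ (-l) * (1 + n * u.im / r) ^ (-K)) := by
  obtain ⟨C₁, hC₁, H₁⟩ := exists_poch_div_factorial_le (a := 2 * l) (by linarith)
  obtain ⟨C₂, hC₂, H₂⟩ := exists_norm_radialJ_le (c := 1 / 5) hl (by norm_num)
  obtain ⟨C₃, hC₃, H₃⟩ := exists_one_add_rpow_le_exp (2 * K) (b := 1 / 2) (by norm_num)
  set c := ∫ x in (-1 : ℝ)..1, (1 - x ^ 2) ^ (l - 1) with hc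
  have hc0 : 0 < c := integral_one_sub_sq_rpow_pos hl
  set C₄ : ℝ := (2 / 5) ^ (l - 1) + 2 ^ (l - 1)
  refine ⟨C₁ / c * 2 * (C₂ * C₄) * (12 ^ K * C₃), by positivity, ?_⟩
  intro n hn u hu h0 h1 r hr hr2 hnr
  have hn0 : (0 : ℝ) < n := by exact_mod_cast hn
  obtain ⟨b1, b2, b3⟩ := norm_sqrtOneSub_bounds hu h0 h1
  obtain ⟨v1, v2, v3, v4⟩ := norm_sub_I_mul_sqrtOneSub_bounds hu h0 h1
  have hvim := im_sub_I_mul_sqrtOneSub hu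
  set D := ‖sqrtOneSub u‖ with hD
  set v := u - Complex.I * sqrtOneSub u with hv
  rw [← hr2] at b1 b3
  have hD0 : 0 ≤ D := norm_nonneg _
  have hrD : r ≤ D := le_of_sq_le_sq b1 hD0
  have hDp : 0 < D := by linarith
  have hrn : 1 ≤ 2 * n * r := by
    rw [div_le_iff₀ (by positivity)] at hnr; linarith
  have hE : 1 / 5 / (n : ℝ) ≤ ‖1 - v ^ 2‖ := by
    rw [v4, div_le_iff₀ hn0]
    have : 1 / 5 * r ≤ ‖v‖ * D := mul_le_mul v1 hrD hr.le (norm_nonneg _)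
    nlinarith
  have hJ := H₂ n hn v hvim v2 hE
  have hE2 : ‖1 - v ^ 2‖ ^ (l - 1) ≤ C₄ * D ^ (l - 1) := by
    have := rpow_le_add_of_mem_Icc (a := 2 / 5 * D) (b := ‖1 - v ^ 2‖) (c := 2 * D)
      (by positivity) (by rw [v4]; nlinarith) (by rw [v4]; nlinarith) (l - 1)
    rw [Real.mul_rpow (by norm_num) hD0, Real.mul_rpow (by norm_num) hD0] at this
    linarith
  have hX0 : 0 ≤ n * u.im / r := by positivity
  have hY0 : 0 ≤ n * u.im / D := by positivity
  have hdec := pow_succ_le_exp_neg (norm_nonneg v) v2 v3 n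
  rw [← mul_div_assoc] at hdec
  have hexp := exp_neg_half_le_rpow hK hX0 hY0 (one_add_div_le_mul_sq hn0 hr hDp h0 hrn b3)
    (H₃ _ hY0)
  have hpow : (n : ℝ) * ((n : ℝ) ^ (2 * l - 1) * (n : ℝ) ^ (-l)) = (n : ℝ) ^ l := by
    nth_rewrite 1 [← Real.rpow_one (n : ℝ)]
    rw [← Real.rpow_add hn0, ← Real.rpow_add hn0]; congr 1; ring
  have hpowD : D ^ (1 - 2 * l) * D ^ (l - 1) ≤ r ^ (-l) := by
    rw [← Real.rpow_add hDp, show 1 - 2 * l + (l - 1) = -l by ring]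
    exact Real.rpow_le_rpow_of_nonpos hr hrD (by linarith)
  have hP := H₁ n hn
  have hP0 := poch_pos (a := 2 * l) (by linarith) n
  rw [gegenG, ← hc, ← hv, norm_mul, norm_mul, norm_mul, norm_mul, norm_pow, Complex.norm_cpow_real,
    ← hD, Complex.norm_I, mul_one, Complex.norm_real, Real.norm_of_nonneg (by positivity)]
  calc (n : ℝ) * (poch (2 * l) n / n.factorial / c * 2 * D ^ (1 - 2 * l) *
        (‖v‖ ^ (n + 1) * ‖radialJ n l v‖))
      ≤ n * ((C₁ * (n : ℝ) ^ (2 * l - 1)) / c * 2 * D ^ (1 - 2 * l) *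
        ((12 ^ K * C₃ * (1 + n * u.im / r) ^ (-K)) * (C₂ * (n : ℝ) ^ (-l) * (C₄ * D ^ (l - 1))))) := by
        gcongr
        · exact hdec.trans hexp
        · refine hJ.trans ?_
          gcongr
    _ = C₁ / c * 2 * (C₂ * C₄) * (12 ^ K * C₃) * (n * ((n : ℝ) ^ (2 * l - 1) * (n : ℝ) ^ (-l))) *
        ((D ^ (1 - 2 * l) * D ^ (l - 1)) * (1 + n * u.im / r) ^ (-K)) := by ring
    _ ≤ _ := by
        rw [hpow]
        gcongr

theorem tendsto_integral_mul_add_cpow {s a b : ℝ} (hab : a ≤ b) {γ φ : ℝ → ℂ} {g : ℝ → ℝ}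
    (hγ : Continuous γ) (hφ : ContinuousOn φ (Set.Icc a b))
    (hre : ∀ t ∈ Set.Ioo a b, 0 < (γ t).re) (hn : ∀ t ∈ Set.Ioo a b, ‖γ t‖ ≤ 6)
    (hg : IntervalIntegrable g volume a b) (hgb : ∀ t ∈ Set.Ioo a b, ‖γ t‖ ^ s ≤ g t) :
    Filter.Tendsto (fun δ : ℝ => ∫ t in a..b, φ t * (γ t + δ) ^ (s : ℂ))
      (nhdsWithin 0 (Set.Ioi 0)) (nhds (∫ t in a..b, φ t * γ t ^ (s : ℂ))) := by
  obtain ⟨M, hM⟩ := isCompact_Icc.exists_bound_of_continuousOn hφ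
  have hae : ∀ᵐ t : ℝ, t ≠ b := by simp [ae_iff]
  have hio : ∀ t : ℝ, t ≠ b → t ∈ Set.uIoc a b → t ∈ Set.Ioo a b := by
    intro t h1 h2
    rw [Set.uIoc_of_le hab] at h2
    exact ⟨h2.1, lt_of_le_of_ne h2.2 h1⟩
  refine intervalIntegral.tendsto_integral_filter_of_dominated_convergence
    (fun t => M * (g t + 7 ^ s)) ?_ ?_ ?_ ?_
  · refine Filter.Eventually.of_forall fun δ => ?_
    rw [Set.uIoc_of_le hab]
    refine AEStronglyMeasurable.mul ?_ ?_
    · exact (hφ.mono Set.Ioc_subset_Icc_self).aestronglyMeasurable measurableSet_Ioc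
    · exact Measurable.aestronglyMeasurable (by have := hγ.measurable; fun_prop)
  · have h01 : ∀ᶠ δ : ℝ in nhdsWithin 0 (Set.Ioi 0), δ ∈ Set.Ioo (0 : ℝ) 1 :=
      Ioo_mem_nhdsGT one_pos
    filter_upwards [h01] with δ hδ
    filter_upwards [hae] with t h1 h2
    have ht := hio t h1 h2
    rw [norm_mul, Complex.norm_cpow_real]
    have hMn := hM t (Set.Ioo_subset_Icc_self ht)
    have hM0 : 0 ≤ M := (norm_nonneg _).trans hMn
    have hlo : ‖γ t‖ ≤ ‖γ t + δ‖ := by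
      rw [← sq_le_sq₀ (norm_nonneg _) (norm_nonneg _), Complex.sq_norm, Complex.sq_norm,
        Complex.normSq_apply, Complex.normSq_apply]
      simp only [Complex.add_re, Complex.ofReal_re, Complex.add_im, Complex.ofReal_im, add_zero]
      nlinarith [hre t ht, hδ.1]
    have hup : ‖γ t + δ‖ ≤ 7 := by
      refine (norm_add_le _ _).trans ?_
      rw [Complex.norm_real, Real.norm_of_nonneg hδ.1.le]
      linarith [hn t ht, hδ.2]
    have hpos : 0 < ‖γ t‖ := (hre t ht).trans_le (Complex.re_le_norm _)
    have := rpow_le_add_of_mem_Icc hpos hlo hup s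
    have := hgb t ht
    gcongr
    linarith
  · exact (hg.add intervalIntegrable_const).const_mul M
  · filter_upwards [hae] with t h1 h2
    have ht := hio t h1 h2
    refine Filter.Tendsto.const_mul _ ?_
    have h3 : Filter.Tendsto (fun δ : ℝ => γ t + (δ : ℂ)) (nhdsWithin 0 (Set.Ioi 0)) (nhds (γ t)) := by
      have : Continuous (fun δ : ℝ => γ t + (δ : ℂ)) := by fun_prop
      have h4 := (this.tendsto 0).mono_left (nhdsWithin_le_nhds (s := Set.Ioi (0 : ℝ)))
      simpa using h4
    have h5 : ContinuousAt (fun z : ℂ => z ^ (s : ℂ)) (γ t) :=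
      continuousAt_cpow_const (Or.inl (hre t ht))
    exact h5.tendsto.comp h3

theorem norm_one_sub_sq_side {σ τ : ℝ} (hσ : σ ^ 2 = 1) (h0 : 0 ≤ τ) (h1 : τ ≤ 1) :
    2 * τ ≤ ‖1 - ((σ : ℂ) + τ * Complex.I) ^ 2‖ ∧
      ‖1 - ((σ : ℂ) + τ * Complex.I) ^ 2‖ ≤ 3 * τ := by
  have h : ‖1 - ((σ : ℂ) + τ * Complex.I) ^ 2‖ ^ 2 = τ ^ 2 * (τ ^ 2 + 4) := by
    rw [Complex.sq_norm, Complex.normSq_apply]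
    simp [pow_two]
    linear_combination (σ^2 + 2 * τ ^ 2 - 1) * hσ
  have hn := norm_nonneg (1 - ((σ : ℂ) + τ * Complex.I) ^ 2)
  constructor
  · refine le_of_sq_le_sq ?_ hn
    rw [h]; nlinarith [sq_nonneg (τ ^ 2)]
  · refine le_of_sq_le_sq ?_ (by positivity)
    rw [h]
    have : τ ^ 2 ≤ 1 := by nlinarith
    nlinarith [sq_nonneg τ]

theorem integral_mul_one_sub_sq_cpow_eq {κ : ℝ} (hκ : 0 < κ) {f : ℂ → ℂ}
    (hf : ∀ z : ℂ, |z.re| ≤ 1 → 0 ≤ z.im → z.im ≤ 1 → DifferentiableAt ℂ f z) :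
    ∫ x in (-1 : ℝ)..1, f x * (1 - (x : ℂ) ^ 2) ^ ((κ - 1 : ℝ) : ℂ) =
      (∫ x in (-1 : ℝ)..1, f (x + Complex.I) * (1 - (x + Complex.I) ^ 2) ^ ((κ - 1 : ℝ) : ℂ))
      - Complex.I * (∫ y in (0 : ℝ)..1, f ((1 : ℝ) + y * Complex.I) *
          (1 - ((1 : ℝ) + y * Complex.I) ^ 2) ^ ((κ - 1 : ℝ) : ℂ))
      + Complex.I * (∫ y in (0 : ℝ)..1, f ((-1 : ℝ) + y * Complex.I) *
          (1 - ((-1 : ℝ) + y * Complex.I) ^ 2) ^ ((κ - 1 : ℝ) : ℂ)) := by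
  have hc : ∀ z : ℂ, |z.re| ≤ 1 → 0 ≤ z.im → z.im ≤ 1 → ContinuousAt f z :=
    fun z h1 h2 h3 => (hf z h1 h2 h3).continuousAt
  have hid : ∀ δ : ℝ, 0 < δ →
      ∫ x in (-1 : ℝ)..1, f x * (1 - (x : ℂ) ^ 2 + δ) ^ ((κ - 1 : ℝ) : ℂ) =
      (∫ x in (-1 : ℝ)..1, f (x + Complex.I) * (1 - (x + Complex.I) ^ 2 + δ) ^ ((κ - 1 : ℝ) : ℂ))
      - Complex.I * (∫ y in (0 : ℝ)..1, f ((1 : ℝ) + y * Complex.I) *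
          (1 - ((1 : ℝ) + y * Complex.I) ^ 2 + δ) ^ ((κ - 1 : ℝ) : ℂ))
      + Complex.I * (∫ y in (0 : ℝ)..1, f ((-1 : ℝ) + y * Complex.I) *
          (1 - ((-1 : ℝ) + y * Complex.I) ^ 2 + δ) ^ ((κ - 1 : ℝ) : ℂ)) := by
    intro δ hδ
    have := Complex.integral_boundary_rect_eq_zero_of_differentiableOn
      (fun z => f z * (1 - z ^ 2 + δ) ^ ((κ - 1 : ℝ) : ℂ)) (-1 : ℂ) (1 + Complex.I) ?_
    · simp only [Complex.neg_re, Complex.one_re, Complex.add_re, Complex.I_re, add_zero,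
        Complex.neg_im, Complex.one_im, neg_zero, Complex.add_im, Complex.I_im, zero_add,
        Complex.ofReal_zero, zero_mul, Complex.ofReal_one, one_mul, smul_eq_mul] at this ⊢
      linear_combination this
    · intro z hz
      rw [Complex.mem_reProdIm] at hz
      simp only [Complex.neg_re, Complex.one_re, Complex.add_re, Complex.I_re, add_zero,
        Complex.neg_im, Complex.one_im, neg_zero, Complex.add_im, Complex.I_im, zero_add] at hz
      rw [Set.uIcc_of_le (by norm_num), Set.uIcc_of_le (by norm_num)] at hz
      obtain ⟨⟨h1, h2⟩, h3, h4⟩ := hz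
      refine (DifferentiableAt.mul (hf z (abs_le.2 ⟨h1, h2⟩) h3 h4) ?_).differentiableWithinAt
      refine DifferentiableAt.cpow_const (by fun_prop) (Or.inl ?_)
      simp [pow_two]
      nlinarith
  have t1 := tendsto_integral_mul_add_cpow (s := κ - 1) (a := -1) (b := 1) (by norm_num)
    (γ := fun x => 1 - (x : ℂ) ^ 2) (φ := fun x => f x) (by fun_prop)
    (fun x hx => ContinuousAt.continuousWithinAt
      ((hc x (by simpa [abs_le] using hx) (by simp) (by simp)).comp (by fun_prop)))
    (fun x hx => by simp [pow_two]; nlinarith [hx.1, hx.2])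
    (fun x hx => by
      have : ‖(1 : ℂ) - (x : ℂ) ^ 2‖ = |1 - x ^ 2| := by
        rw [← Real.norm_eq_abs, ← Complex.norm_real]; push_cast; rfl
      rw [this, abs_le]; constructor <;> nlinarith [hx.1, hx.2])
    (intervalIntegrable_one_sub_sq_rpow hκ)
    (fun x hx => by
      have : ‖(1 : ℂ) - (x : ℂ) ^ 2‖ = |1 - x ^ 2| := by
        rw [← Real.norm_eq_abs, ← Complex.norm_real]; push_cast; rfl
      rw [this, abs_of_nonneg (by nlinarith [hx.1, hx.2])])
  have top : ∀ x : ℝ, x ∈ Set.Ioo (-1 : ℝ) 1 →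
      1 ≤ ‖1 - ((x : ℂ) + Complex.I) ^ 2‖ ∧ ‖1 - ((x : ℂ) + Complex.I) ^ 2‖ ≤ 6 ∧
        0 < (1 - ((x : ℂ) + Complex.I) ^ 2).re := by
    intro x hx
    have hre : (1 - ((x : ℂ) + Complex.I) ^ 2).re = 2 - x ^ 2 := by simp [pow_two]; ring
    have h2 : ‖1 - ((x : ℂ) + Complex.I) ^ 2‖ ≤ 1 + ‖(x : ℂ) + Complex.I‖ ^ 2 := by
      refine (norm_sub_le _ _).trans ?_
      rw [norm_pow, norm_one]
    have h3 : ‖(x : ℂ) + Complex.I‖ ≤ 2 := by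
      refine (norm_add_le _ _).trans ?_
      rw [Complex.norm_real, Complex.norm_I, Real.norm_eq_abs]
      linarith [abs_lt.2 hx]
    have h4 := Complex.re_le_norm (1 - ((x : ℂ) + Complex.I) ^ 2)
    rw [hre] at h4 ⊢
    refine ⟨?_, ?_, ?_⟩
    · nlinarith [hx.1, hx.2]
    · nlinarith [norm_nonneg ((x : ℂ) + Complex.I)]
    · nlinarith [hx.1, hx.2]
  have t2 := tendsto_integral_mul_add_cpow (s := κ - 1) (a := -1) (b := 1) (by norm_num)
    (γ := fun x => 1 - ((x : ℂ) + Complex.I) ^ 2) (φ := fun x => f (x + Complex.I)) (by fun_prop)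
    (fun x hx => ContinuousAt.continuousWithinAt
      (ContinuousAt.comp (f := fun x : ℝ => (x : ℂ) + Complex.I)
        (hc (x + Complex.I) (by simpa [abs_le] using hx) (by simp) (by simp)) (by fun_prop)))
    (fun x hx => (top x hx).2.2) (fun x hx => (top x hx).2.1)
    (g := fun _ => 1 ^ (κ - 1) + 6 ^ (κ - 1)) intervalIntegrable_const
    (fun x hx => rpow_le_add_of_mem_Icc one_pos (top x hx).1 (top x hx).2.1 _)
  have t3 : ∀ σ : ℝ, σ ^ 2 = 1 → _ := fun σ hσ =>
    tendsto_integral_mul_add_cpow (s := κ - 1) (a := 0) (b := 1) (by norm_num)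
    (γ := fun y => 1 - ((σ : ℂ) + y * Complex.I) ^ 2) (φ := fun y => f (σ + y * Complex.I))
    (by fun_prop)
    (fun y hy => ContinuousAt.continuousWithinAt
      (ContinuousAt.comp (f := fun y : ℝ => (σ : ℂ) + y * Complex.I)
        (hc (σ + y * Complex.I) (by
          simp only [Complex.add_re, Complex.ofReal_re, Complex.mul_re, Complex.I_re, mul_zero,
            Complex.ofReal_im, Complex.I_im, mul_one, sub_self, add_zero]
          exact (sq_le_one_iff_abs_le_one σ).1 hσ.le) (by simpa using hy.1) (by simpa using hy.2))
        (by fun_prop)))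
    (fun y hy => by simp [pow_two]; nlinarith [hy.1, hy.2])
    (fun y hy => (norm_one_sub_sq_side hσ hy.1.le hy.2.le).2.trans (by linarith [hy.2]))
    (g := fun y => (2 ^ (κ - 1) + 3 ^ (κ - 1)) * y ^ (κ - 1))
    ((intervalIntegral.intervalIntegrable_rpow' (by linarith)).const_mul _)
    (fun y hy => by
      have h := norm_one_sub_sq_side hσ hy.1.le hy.2.le
      have := rpow_le_add_of_mem_Icc (by linarith [hy.1]) h.1 h.2 (κ - 1)
      rw [Real.mul_rpow (by norm_num) hy.1.le, Real.mul_rpow (by norm_num) hy.1.le] at this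
      linarith)
  have t4 := t3 1 (by norm_num)
  have t5 := t3 (-1) (by norm_num)
  refine tendsto_nhds_unique_of_eventuallyEq t1
    ((t2.sub (t4.const_mul Complex.I)).add (t5.const_mul Complex.I)) ?_
  filter_upwards [self_mem_nhdsWithin] with δ hδ using hid δ hδ

theorem enorm_integral_mul_one_sub_sq_rpow_le {κ : ℝ} (hκ : 0 < κ) :
    ∃ C : NNReal, ∀ f : ℂ → ℂ,
    (∀ z : ℂ, |z.re| ≤ 1 → 0 ≤ z.im → z.im ≤ 1 → DifferentiableAt ℂ f z) →
    ‖∫ x in (-1 : ℝ)..1, f x * ((1 - x ^ 2) ^ (κ - 1) : ℝ)‖ₑ ≤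
      C * ((∫⁻ x in Set.Ioo (-1 : ℝ) 1, ‖f (x + Complex.I)‖ₑ) +
        (∫⁻ y in Set.Ioo (0 : ℝ) 1, ‖f ((1 : ℝ) + y * Complex.I)‖ₑ * ENNReal.ofReal (y ^ (κ - 1))) +
        ∫⁻ y in Set.Ioo (0 : ℝ) 1, ‖f ((-1 : ℝ) + y * Complex.I)‖ₑ *
          ENNReal.ofReal (y ^ (κ - 1))) := by
  set A : ℝ := 1 ^ (κ - 1) + 6 ^ (κ - 1) + (2 ^ (κ - 1) + 3 ^ (κ - 1)) with hA
  have hA0 : 0 < A := by positivity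
  refine ⟨A.toNNReal, fun f hf => ?_⟩
  have hbot : ∫ x in (-1 : ℝ)..1, f x * ((1 - x ^ 2) ^ (κ - 1) : ℝ) =
      ∫ x in (-1 : ℝ)..1, f x * (1 - (x : ℂ) ^ 2) ^ ((κ - 1 : ℝ) : ℂ) := by
    refine intervalIntegral.integral_congr fun x hx => ?_
    rw [Set.uIcc_of_le (by norm_num)] at hx
    rw [Complex.ofReal_cpow (by nlinarith [hx.1, hx.2])]
    push_cast; rfl
  rw [hbot, integral_mul_one_sub_sq_cpow_eq hκ hf]
  have key : ∀ (a b : ℝ) (hab : a ≤ b) (φ w : ℝ → ℂ) (p : ℝ → ℝ), 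
      (∀ t ∈ Set.Ioo a b, 0 ≤ p t ∧ ‖w t‖ ^ (κ - 1) ≤ A * p t) →
      ‖∫ t in a..b, φ t * w t ^ ((κ - 1 : ℝ) : ℂ)‖ₑ ≤
        A.toNNReal * ∫⁻ t in Set.Ioo a b, ‖φ t‖ₑ * ENNReal.ofReal (p t) := by
    intro a b hab φ w p hw
    rw [intervalIntegral.integral_of_le hab, integral_Ioc_eq_integral_Ioo]
    refine (enorm_integral_le_lintegral_enorm _).trans ?_
    rw [← lintegral_const_mul' _ _ ENNReal.coe_ne_top]
    refine setLIntegral_mono' measurableSet_Ioo fun t ht => ?_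
    have h1 : ‖w t ^ ((κ - 1 : ℝ) : ℂ)‖ₑ ≤ A.toNNReal * ENNReal.ofReal (p t) := by
      rw [← ofReal_norm, Complex.norm_cpow_real]
      change _ ≤ ENNReal.ofReal A * _
      rw [← ENNReal.ofReal_mul hA0.le]
      exact ENNReal.ofReal_le_ofReal (hw t ht).2
    rw [enorm_mul]
    calc _ ≤ ‖φ t‖ₑ * (A.toNNReal * ENNReal.ofReal (p t)) := by gcongr
      _ = _ := by ring
  have q : ∀ x y z : ℂ, ‖x - Complex.I * y + Complex.I * z‖ₑ ≤ ‖x‖ₑ + ‖y‖ₑ + ‖z‖ₑ := by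
    intro x y z
    refine (enorm_add_le _ _).trans ?_
    refine (add_le_add (enorm_sub_le) le_rfl).trans ?_
    rw [enorm_mul, enorm_mul]
    simp [enorm_eq_nnnorm]
  have side : ∀ σ : ℝ, σ ^ 2 = 1 → ∀ y ∈ Set.Ioo (0 : ℝ) 1, 0 ≤ y ^ (κ - 1) ∧
      ‖1 - ((σ : ℂ) + y * Complex.I) ^ 2‖ ^ (κ - 1) ≤ A * y ^ (κ - 1) := by
    intro σ hσ y hy
    refine ⟨Real.rpow_nonneg hy.1.le _, ?_⟩
    have h := norm_one_sub_sq_side hσ hy.1.le hy.2.le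
    have := rpow_le_add_of_mem_Icc (by linarith [hy.1]) h.1 h.2 (κ - 1)
    rw [Real.mul_rpow (by norm_num) hy.1.le, Real.mul_rpow (by norm_num) hy.1.le] at this
    have p1 : (0 : ℝ) ≤ 1 ^ (κ - 1) + 6 ^ (κ - 1) := by positivity
    have p2 := Real.rpow_nonneg hy.1.le (κ - 1)
    have p3 := mul_nonneg p1 p2
    rw [hA]
    linarith
  refine (q _ _ _).trans ?_
  rw [mul_add, mul_add]
  refine add_le_add (add_le_add ?_ ?_) ?_
  · have := key (-1) 1 (by norm_num) (fun x => f (x + Complex.I))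
      (fun x => 1 - (x + Complex.I) ^ 2) (fun _ => 1) ?_
    · simpa using this
    · intro x hx
      refine ⟨zero_le_one, ?_⟩
      have hre : (1 - ((x : ℂ) + Complex.I) ^ 2).re = 2 - x ^ 2 := by simp [pow_two]; ring
      have h2 : ‖1 - ((x : ℂ) + Complex.I) ^ 2‖ ≤ 1 + ‖(x : ℂ) + Complex.I‖ ^ 2 := by
        refine (norm_sub_le _ _).trans ?_
        rw [norm_pow, norm_one]
      have h3 : ‖(x : ℂ) + Complex.I‖ ≤ 2 := by
        refine (norm_add_le _ _).trans ?_
        rw [Complex.norm_real, Complex.norm_I, Real.norm_eq_abs]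
        linarith [abs_lt.2 hx]
      have h4 := Complex.re_le_norm (1 - ((x : ℂ) + Complex.I) ^ 2)
      rw [hre] at h4
      have := rpow_le_add_of_mem_Icc one_pos (b := ‖1 - ((x : ℂ) + Complex.I) ^ 2‖) (c := 6)
        (by nlinarith [hx.1, hx.2]) (by nlinarith [norm_nonneg ((x : ℂ) + Complex.I)]) (κ - 1)
      have p1 : (0 : ℝ) < 2 ^ (κ - 1) + 3 ^ (κ - 1) := by positivity
      linarith
  · exact key 0 1 zero_le_one _ _ _ fun y hy => side 1 (by norm_num) y hy
  · exact key 0 1 zero_le_one _ _ _ fun y hy => side (-1) (by norm_num) y hy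

theorem enorm_integral_affine_mul_weight_le {κ : ℝ} (hκ : 0 < κ) :
    ∃ C : NNReal, ∀ (G : ℂ → ℂ) (a b σ : ℝ),
    (∀ z : ℂ, |z.re - b| ≤ |a| → σ ≤ z.im → z.im ≤ σ + |a| → DifferentiableAt ℂ G z) →
    ‖∫ t in (-1 : ℝ)..1, G ((b + a * t : ℝ) + σ * Complex.I) *
      ((1 + t) * (1 - t ^ 2) ^ (κ - 1) : ℝ)‖ₑ ≤
      C * ((∫⁻ x in Set.Ioo (-1 : ℝ) 1, ‖G ((b + |a| * x : ℝ) + (σ + |a| : ℝ) * Complex.I)‖ₑ) +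
        (∫⁻ y in Set.Ioo (0 : ℝ) 1, ‖G ((b + |a| : ℝ) + (σ + |a| * y : ℝ) * Complex.I)‖ₑ *
          ENNReal.ofReal (y ^ (κ - 1))) +
        ∫⁻ y in Set.Ioo (0 : ℝ) 1, ‖G ((b - |a| : ℝ) + (σ + |a| * y : ℝ) * Complex.I)‖ₑ *
          ENNReal.ofReal (y ^ (κ - 1))) := by
  obtain ⟨C, hC⟩ := enorm_integral_mul_one_sub_sq_rpow_le hκ
  refine ⟨C * 3, fun G a b σ hG => ?_⟩
  obtain ⟨s, hs, hsa⟩ : ∃ s : ℝ, |s| = 1 ∧ a = s * |a| := by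
    rcases le_total 0 a with h | h
    · exact ⟨1, by simp, by rw [abs_of_nonneg h]; ring⟩
    · exact ⟨-1, by simp, by rw [abs_of_nonpos h]; ring⟩
  have hs2 : s = 1 ∨ s = -1 := by
    rcases abs_eq (zero_le_one' ℝ) |>.1 hs with h | h <;> simp [h]
  have hintg : ∫ t in (-1 : ℝ)..1, G ((b + a * t : ℝ) + σ * Complex.I) *
      ((1 + t) * (1 - t ^ 2) ^ (κ - 1) : ℝ) =
      ∫ t in (-1 : ℝ)..1, ((1 + s * t) * G (b + σ * Complex.I + |a| * t)) *
        ((1 - t ^ 2) ^ (κ - 1) : ℝ) := by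
    rcases hs2 with h | h
    · rw [h, one_mul] at hsa
      refine intervalIntegral.integral_congr fun t _ => ?_
      simp only [h]
      rw [← hsa]
      push_cast
      rw [show (b : ℂ) + a * t + σ * Complex.I = b + σ * Complex.I + a * t by ring]
      ring
    · have hneg := intervalIntegral.integral_comp_neg (a := -1) (b := 1) (fun t : ℝ =>
        G ((b + a * t : ℝ) + σ * Complex.I) * ((1 + t) * (1 - t ^ 2) ^ (κ - 1) : ℝ))
      rw [neg_neg] at hneg
      rw [← hneg]
      refine intervalIntegral.integral_congr fun t _ => ?_
      have ha : a = -|a| := by rw [h] at hsa; linarith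
      simp only [h]
      have e : ((b + a * -t : ℝ) : ℂ) + σ * Complex.I = b + σ * Complex.I + |a| * t := by
        have : (a : ℂ) = -(|a| : ℝ) := by rw [← Complex.ofReal_neg, ← ha]
        push_cast
        rw [this]; ring
      rw [e, neg_sq]
      push_cast
      ring
  rw [hintg]
  refine (hC (fun z => (1 + s * z) * G (b + σ * Complex.I + |a| * z)) ?_).trans ?_
  · intro z h1 h2 h3
    have hd : DifferentiableAt ℂ G (b + σ * Complex.I + |a| * z) := by
      refine hG _ ?_ ?_ ?_
      · simp [abs_mul]; nlinarith [abs_nonneg a]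
      · simp; positivity
      · simp; nlinarith [abs_nonneg a]
    have := DifferentiableAt.comp (f := fun z : ℂ => b + σ * Complex.I + |a| * z) z hd (by fun_prop)
    exact DifferentiableAt.mul (by fun_prop) this
  · have hfac : ∀ z : ℂ, ‖z‖ ≤ 2 → ‖1 + (s : ℂ) * z‖ₑ ≤ 3 := by
      intro z hz
      rw [← ofReal_norm]
      refine ENNReal.ofReal_le_of_le_toReal ?_
      refine (norm_add_le _ _).trans ?_
      rw [norm_mul, Complex.norm_real, Real.norm_eq_abs, hs]
      simp; linarith
    have hmain : ∀ (x y : ℝ), |x| ≤ 1 → |y| ≤ 1 → ∀ z : ℂ, z = x + y * Complex.I → ∀ w : ℂ,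
        w = ((b + |a| * x : ℝ) + (σ + |a| * y : ℝ) * Complex.I) →
        ‖(1 + s * z) * G (b + σ * Complex.I + |a| * z)‖ₑ ≤ 3 * ‖G w‖ₑ := by
      intro x y hx hy z hz w hw
      rw [enorm_mul]
      have h2 : (b : ℂ) + σ * Complex.I + |a| * z = w := by
        rw [hz, hw]; push_cast; ring
      rw [h2]
      gcongr
      refine hfac z ?_
      rw [hz]
      refine (norm_add_le _ _).trans ?_
      rw [norm_mul, Complex.norm_real, Complex.norm_real, Complex.norm_I, Real.norm_eq_abs,
        Real.norm_eq_abs]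
      linarith
    rw [ENNReal.coe_mul, mul_assoc]
    gcongr
    rw [mul_add, mul_add]
    push_cast
    refine add_le_add (add_le_add ?_ ?_) ?_
    · rw [← lintegral_const_mul' _ _ (by norm_num)]
      refine setLIntegral_mono' measurableSet_Ioo fun x hx => ?_
      refine hmain x 1 (abs_le.2 ⟨hx.1.le, hx.2.le⟩) (by simp) _ (by simp) _ (by simp)
    · rw [← lintegral_const_mul' _ _ (by norm_num)]
      refine setLIntegral_mono' measurableSet_Ioo fun y hy => ?_
      rw [← mul_assoc]
      gcongr
      refine hmain 1 y (by simp) (abs_le.2 ⟨by linarith [hy.1], hy.2.le⟩) _ (by simp) _ (by simp)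
    · rw [← lintegral_const_mul' _ _ (by norm_num)]
      refine setLIntegral_mono' measurableSet_Ioo fun y hy => ?_
      rw [← mul_assoc]
      gcongr
      refine hmain (-1) y (by simp) (abs_le.2 ⟨by linarith [hy.1], hy.2.le⟩) _ (by simp) _
        (by push_cast; ring)

theorem lintegral_one_add_mul_rpow {κ A : ℝ} (hκ : 0 < κ) (hA : 0 ≤ A) :
    ∫⁻ y in Set.Ioo (0 : ℝ) 1, ENNReal.ofReal ((1 + A * y) ^ (-(κ + 1)) * y ^ (κ - 1)) =
      ENNReal.ofReal (1 / κ * (1 + A) ^ (-κ)) := by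
  have hpos : ∀ y : ℝ, 0 ≤ y → 0 < 1 + A * y := fun y hy => by positivity
  have hcont : ContinuousOn (fun y : ℝ => 1 / κ * (y ^ κ * (1 + A * y) ^ (-κ))) (Set.Icc 0 1) := by
    refine ContinuousOn.mul continuousOn_const (ContinuousOn.mul ?_ ?_)
    · exact (Real.continuous_rpow_const hκ.le).continuousOn
    · exact ContinuousOn.rpow_const (by fun_prop) fun y hy => Or.inl (hpos y hy.1).ne'
  have hder : ∀ y ∈ Set.Ioo (0 : ℝ) 1,
      HasDerivAt (fun y : ℝ => 1 / κ * (y ^ κ * (1 + A * y) ^ (-κ)))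
        ((1 + A * y) ^ (-(κ + 1)) * y ^ (κ - 1)) y := by
    intro y hy
    have h1 := Real.hasDerivAt_rpow_const (x := y) (p := κ) (Or.inl hy.1.ne')
    have h2 : HasDerivAt (fun y : ℝ => 1 + A * y) A y := by
      simpa using ((hasDerivAt_id y).const_mul A).const_add 1
    have h3 := h2.rpow_const (p := -κ) (Or.inl (hpos y hy.1.le).ne')
    convert! (h1.mul h3).const_mul (1 / κ) using 1
    have e1 : (1 + A * y) ^ (-κ) = (1 + A * y) ^ (-(κ + 1)) * (1 + A * y) := by
      rw [← Real.rpow_add_one (hpos y hy.1.le).ne']; congr 1; ring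
    have e2 : y ^ κ = y ^ (κ - 1) * y := by
      rw [← Real.rpow_add_one hy.1.ne']; congr 1; ring
    rw [e1, e2, show -κ - 1 = -(κ + 1) by ring]
    field_simp
    ring
  have hnn : ∀ y ∈ Set.Ioo (0 : ℝ) 1, 0 ≤ (1 + A * y) ^ (-(κ + 1)) * y ^ (κ - 1) := fun y hy =>
    mul_nonneg (Real.rpow_nonneg (hpos y hy.1.le).le _) (Real.rpow_nonneg hy.1.le _)
  have hintg := intervalIntegral.integrableOn_deriv_of_nonneg hcont hder hnn
  have hval := intervalIntegral.integral_eq_sub_of_hasDerivAt_of_le zero_le_one hcont hder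
    ((intervalIntegrable_iff_integrableOn_Ioc_of_le zero_le_one).2 hintg)
  rw [← ofReal_integral_eq_lintegral_ofReal (hintg.mono_set Set.Ioo_subset_Ioc_self)
    (ae_restrict_of_forall_mem measurableSet_Ioo hnn), ← integral_Ioc_eq_integral_Ioo,
    ← intervalIntegral.integral_of_le zero_le_one, hval]
  congr 1
  simp [Real.zero_rpow hκ.ne']

/-- The weighted average `∫_{-1}^1 H(z + a t) (1 + t) (1 - t²)^{κ-1} dt`. -/
noncomputable def weightAvg (κ a : ℝ) (H : ℂ → ℂ) (z : ℂ) : ℂ :=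
  ∫ t in (-1 : ℝ)..1, H (z + a * t) * ((1 + t) * (1 - t ^ 2) ^ (κ - 1) : ℝ)

/-- The iterated weighted average of `g` in the directions `a`. -/
noncomputable def iterAvg (g : ℂ → ℂ) : (k : ℕ) → (κ a : Fin k → ℝ) → ℂ → ℂ
  | 0, _, _ => g
  | k + 1, κ, a => weightAvg (κ 0) (a 0) (iterAvg g k (fun i => κ i.succ) fun i => a i.succ)

theorem intervalIntegrable_weight {κ : ℝ} (hκ : 0 < κ) :
    IntervalIntegrable (fun t : ℝ => (1 + t) * (1 - t ^ 2) ^ (κ - 1)) volume (-1) 1 :=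
  (intervalIntegrable_one_sub_sq_rpow hκ).continuousOn_mul (by fun_prop)

theorem isOpen_strip (ρ : ℝ) : IsOpen {z : ℂ | |z.re| < ρ} :=
  isOpen_lt (by fun_prop) continuous_const

theorem differentiableOn_weightAvg {κ a ρ : ℝ} (hκ : 0 < κ) {H : ℂ → ℂ}
    (hH : DifferentiableOn ℂ H {z | |z.re| < ρ}) :
    DifferentiableOn ℂ (weightAvg κ a H) {z | |z.re| < ρ - |a|} := by
  have hstrip : ∀ z : ℂ, |z.re| < ρ - |a| → ∀ t ∈ Set.Icc (-1 : ℝ) 1,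
      z + a * t ∈ {z : ℂ | |z.re| < ρ} := by
    intro z hz t ht
    simp only [Set.mem_ofPred_eq, Complex.add_re, Complex.mul_re, Complex.ofReal_re,
      Complex.ofReal_im, mul_zero, sub_zero]
    have h1 : |a * t| ≤ |a| := by
      rw [abs_mul]; exact mul_le_of_le_one_right (abs_nonneg _) (abs_le.2 ht)
    linarith [abs_add_le z.re (a * t)]
  have hI : (fun z => weightAvg κ a H z) = fun z => ∫ t in Set.Ioc (-1 : ℝ) 1,
      H (z + a * t) * ((1 + t) * (1 - t ^ 2) ^ (κ - 1) : ℝ) := by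
    funext z
    rw [weightAvg, intervalIntegral.integral_of_le (by norm_num)]
  have hw := (intervalIntegrable_iff_integrableOn_Ioc_of_le (by norm_num)).1
    (intervalIntegrable_weight hκ)
  change DifferentiableOn ℂ (fun z => weightAvg κ a H z) _
  rw [hI]
  refine differentiableOn_integral_of_dominated (isOpen_strip _) ?_ ?_ ?_
  · intro z hz
    refine AEStronglyMeasurable.mul ?_ ?_
    · refine ContinuousOn.aestronglyMeasurable ?_ measurableSet_Ioc
      exact hH.continuousOn.comp (by fun_prop) fun t ht => hstrip z hz t (Set.Ioc_subset_Icc_self ht)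
    · exact (Complex.continuous_ofReal.comp_aestronglyMeasurable hw.1)
  · refine ae_restrict_of_forall_mem measurableSet_Ioc fun t ht => ?_
    refine DifferentiableOn.mul_const ?_ _
    exact hH.comp (by fun_prop) fun z hz => hstrip z hz t (Set.Ioc_subset_Icc_self ht)
  · intro z hz
    obtain ⟨ε, hε, hεU⟩ := Metric.nhds_basis_closedBall.mem_iff.1 ((isOpen_strip _).mem_nhds hz)
    have hc : ContinuousOn (fun p : ℂ × ℝ => H (p.1 + a * p.2))
        (Metric.closedBall z ε ×ˢ Set.Icc (-1) 1) :=
      hH.continuousOn.comp (by fun_prop) fun p hp => hstrip p.1 (hεU hp.1) p.2 hp.2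
    obtain ⟨M, hM⟩ := ((isCompact_closedBall z ε).prod isCompact_Icc).exists_bound_of_continuousOn hc
    refine ⟨ε, hε, fun t => M * ‖(1 + t) * (1 - t ^ 2) ^ (κ - 1)‖, hw.norm.const_mul M, ?_⟩
    refine ae_restrict_of_forall_mem measurableSet_Ioc fun t ht w hw _ => ?_
    rw [norm_mul, Complex.norm_real]
    exact mul_le_mul_of_nonneg_right
      (hM (w, t) ⟨Metric.ball_subset_closedBall hw, Set.Ioc_subset_Icc_self ht⟩) (norm_nonneg _)

theorem differentiableOn_iterAvg {g : ℂ → ℂ} (hg : DifferentiableOn ℂ g {z | |z.re| < 1}) :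
    ∀ (k : ℕ) (κ a : Fin k → ℝ), (∀ j, 0 < κ j) →
      DifferentiableOn ℂ (iterAvg g k κ a) {z | |z.re| < 1 - ∑ j, |a j|} := by
  intro k
  induction k with
  | zero => intro κ a _; simpa [iterAvg] using hg
  | succ k ih =>
    intro κ a hκ
    have := differentiableOn_weightAvg (a := a 0) (hκ 0) (ih (fun i => κ i.succ)
      (fun i => a i.succ) fun j => hκ _)
    have hs : 1 - ∑ j, |a j| = 1 - ∑ j : Fin k, |a j.succ| - |a 0| := by
      rw [Fin.sum_univ_succ]; ring
    rw [hs]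
    exact this

theorem one_add_mul_add_div_rpow_le {N r σ τ p q : ℝ} (hN : 0 ≤ N) (hr : 0 < r) (hσ : 0 ≤ σ)
    (hτ : 0 ≤ τ) (hp : 0 ≤ p) (hq : 0 ≤ q) :
    (1 + N * (σ + τ) / r) ^ (-(p + q)) ≤ (1 + N * σ / r) ^ (-p) * (1 + N * τ / r) ^ (-q) := by
  have h1 : 0 < 1 + N * σ / r := by positivity
  have h2 : 0 < 1 + N * τ / r := by positivity
  have e : 1 + N * (σ + τ) / r = 1 + N * σ / r + N * τ / r := by ring
  have h3 : 1 + N * σ / r ≤ 1 + N * (σ + τ) / r := by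
    rw [e]; linarith [show 0 ≤ N * τ / r by positivity]
  have h4 : 1 + N * τ / r ≤ 1 + N * (σ + τ) / r := by
    rw [e]; linarith [show 0 ≤ N * σ / r by positivity]
  rw [neg_add, Real.rpow_add (h1.trans_le h3)]
  exact mul_le_mul (Real.rpow_le_rpow_of_nonpos h1 h3 (by linarith))
    (Real.rpow_le_rpow_of_nonpos h2 h4 (by linarith)) (Real.rpow_nonneg (h1.trans_le h3).le _)
    (Real.rpow_nonneg h1.le _)

/-- The distribution of `σ + A y`, where `σ` has law `ω` and `y` has density `y^{κ-1}` on
`(0, 1)`. -/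
noncomputable def spread (κ A : ℝ) (ω : Measure ℝ) : Measure ℝ :=
  (ω.prod ((volume.restrict (Set.Ioo 0 1)).withDensity
    fun y => ENNReal.ofReal (y ^ (κ - 1)))).map fun q => q.1 + A * q.2

instance (κ A : ℝ) (ω : Measure ℝ) [SFinite ω] : SFinite (spread κ A ω) := by
  unfold spread; infer_instance

theorem lintegral_spread (κ A : ℝ) (ω : Measure ℝ) [SFinite ω] {f : ℝ → ENNReal}
    (hf : Measurable f) :
    ∫⁻ s, f s ∂(spread κ A ω) =
      ∫⁻ σ, (∫⁻ y in Set.Ioo (0 : ℝ) 1, f (σ + A * y) * ENNReal.ofReal (y ^ (κ - 1))) ∂ω := by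
  rw [spread, lintegral_map hf (by fun_prop), lintegral_prod _ (by fun_prop)]
  refine lintegral_congr fun σ => ?_
  rw [lintegral_withDensity_eq_lintegral_mul _ (by fun_prop) (by fun_prop)]
  refine lintegral_congr fun y => ?_
  simp [mul_comm]

theorem ae_spread {κ A : ℝ} {ω : Measure ℝ} [SFinite ω] {P : ℝ → Prop}
    (hP : MeasurableSet {s | P s}) (h : ∀ᵐ σ ∂ω, ∀ y ∈ Set.Ioo (0 : ℝ) 1, P (σ + A * y)) :
    ∀ᵐ s ∂(spread κ A ω), P s := by
  have hm : MeasurableSet {s | ¬ P s} := hP.compl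
  rw [ae_iff, ← lintegral_indicator_one hm, lintegral_spread _ _ _ (measurable_one.indicator hm)]
  rw [← lintegral_zero (μ := ω)]
  refine lintegral_congr_ae ?_
  filter_upwards [h] with σ hσ
  rw [← lintegral_zero (μ := volume.restrict (Set.Ioo (0 : ℝ) 1))]
  refine setLIntegral_congr_fun measurableSet_Ioo fun y hy => ?_
  simp [hσ y hy]

theorem lintegral_spread_rpow_le {κ A N r p : ℝ} {ω : Measure ℝ} [SFinite ω] (hκ : 0 < κ)
    (hA : 0 ≤ A) (hN : 0 ≤ N) (hr : 0 < r) (hp : 0 ≤ p) (hω : ∀ᵐ σ ∂ω, 0 ≤ σ) :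
    ∫⁻ s, ENNReal.ofReal ((1 + N * s / r) ^ (-(p + (κ + 1)))) ∂(spread κ A ω) ≤
      ENNReal.ofReal (1 / κ * (1 + N * A / r) ^ (-κ)) *
        ∫⁻ σ, ENNReal.ofReal ((1 + N * σ / r) ^ (-p)) ∂ω := by
  rw [lintegral_spread _ _ _ (by fun_prop), ← lintegral_const_mul _ (by fun_prop)]
  refine lintegral_mono_ae ?_
  filter_upwards [hω] with σ hσ
  rw [← lintegral_one_add_mul_rpow hκ (show 0 ≤ N * A / r by positivity),
    ← lintegral_mul_const _ (by fun_prop)]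
  refine setLIntegral_mono' measurableSet_Ioo fun y hy => ?_
  have h1 := one_add_mul_add_div_rpow_le hN hr hσ (mul_nonneg hA hy.1.le) hp
    (show 0 ≤ κ + 1 by linarith)
  have h2 : 0 ≤ y ^ (κ - 1) := Real.rpow_nonneg hy.1.le _
  have h3 : 0 ≤ 1 + N * σ / r := by positivity
  have h4 : 0 ≤ 1 + N * A / r * y := by have := hy.1.le; positivity
  rw [← ENNReal.ofReal_mul' h2, ← ENNReal.ofReal_mul (by positivity)]
  refine ENNReal.ofReal_le_ofReal ?_
  calc _ ≤ ((1 + N * σ / r) ^ (-p) * (1 + N * (A * y) / r) ^ (-(κ + 1))) * y ^ (κ - 1) := by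
        gcongr
    _ = _ := by
        rw [show N * (A * y) / r = N * A / r * y by ring]; ring

/-- The estimate for weighted averages of `H` over vertical lines, tested against measures: `M`
bounds `H`, `N`, `l`, `R` are the scale, the order and the least distance to the boundary, `p` is
the remaining decay order. -/
def TestBound (H : ℂ → ℂ) (M : ENNReal) (N l R p : ℝ) {k : ℕ} (κ a : Fin k → ℝ) : Prop :=
  ∀ (b : ℝ) (ω : Measure ℝ) [SFinite ω] (B : ENNReal), |b| + ∑ j, |a j| ≤ 1 - R ^ 2 →
    (∀ᵐ σ ∂ω, 0 ≤ σ ∧ σ + ∑ j, |a j| ≤ 1) →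
    (∀ r, R ≤ r → ENNReal.ofReal (r ^ (-l) * ∏ j, (1 + N * |a j| / r) ^ (-κ j)) *
      ∫⁻ σ, ENNReal.ofReal ((1 + N * σ / r) ^ (-p)) ∂ω ≤ B) →
    ∫⁻ σ : ℝ, ‖H (b + σ * Complex.I)‖ₑ ∂ω ≤ M * B

theorem testBound_weightAvg {κ₀ : ℝ} (hκ₀ : 0 < κ₀) : ∃ C : NNReal, ∀ (H : ℂ → ℂ) (M : ENNReal)
    (N l R p : ℝ) (k : ℕ) (κ a : Fin (k + 1) → ℝ), κ 0 = κ₀ → 0 ≤ N → 0 < R → 0 ≤ p →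
    DifferentiableOn ℂ H {z | |z.re| < 1 - ∑ j : Fin k, |a j.succ|} →
    TestBound H M N l R (p + (κ 0 + 1)) (fun j => κ j.succ) (fun j => a j.succ) →
    TestBound (weightAvg (κ 0) (a 0) H) (C * M) N l R p κ a := by
  obtain ⟨C, hC⟩ := enorm_integral_affine_mul_weight_le hκ₀
  set D : NNReal := (1 / κ₀).toNNReal with hD
  have hDof : (D : ENNReal) = ENNReal.ofReal (1 / κ₀) := rfl
  refine ⟨C * (2 + D + D), ?_⟩
  intro H M N l R p k κ a hκ hN hR hp hH hT b ω _ B hb hω hB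
  rw [hκ] at hT ⊢
  rw [Fin.sum_univ_succ] at hb hω
  set A := |a 0| with hA
  set s := ∑ j : Fin k, |a j.succ| with hs
  have hA0 : 0 ≤ A := abs_nonneg _
  have hs0 : 0 ≤ s := Finset.sum_nonneg fun _ _ => abs_nonneg _
  have hR2 : 0 < R ^ 2 := by positivity
  have hκ' : ∀ r, R ≤ r → ENNReal.ofReal (r ^ (-l) * ∏ j : Fin k, (1 + N * |a j.succ| / r) ^ (-κ j.succ)) *
      (ENNReal.ofReal ((1 + N * A / r) ^ (-κ₀)) *
      ∫⁻ σ, ENNReal.ofReal ((1 + N * σ / r) ^ (-p)) ∂ω) ≤ B := by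
    intro r hr
    have hr0 : 0 < r := hR.trans_le hr
    refine le_trans (le_of_eq ?_) (hB r hr)
    rw [← mul_assoc, ← ENNReal.ofReal_mul]
    · rw [Fin.prod_univ_succ, hκ]
      congr 2
      ring
    · refine mul_nonneg (Real.rpow_nonneg hr0.le _) (Finset.prod_nonneg fun j _ => ?_)
      exact Real.rpow_nonneg (by positivity) _
  have hU := isOpen_strip (1 - s)
  obtain ⟨F, hF⟩ : ∃ F : ℂ → ENNReal, F = {z : ℂ | |z.re| < 1 - s}.indicator fun z => ‖H z‖ₑ :=
    ⟨_, rfl⟩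
  have hFm : Measurable F := by
    rw [hF]
    classical
    rw [← Set.piecewise_eq_indicator]
    exact ContinuousOn.measurable_piecewise hH.continuousOn.enorm continuousOn_const
      hU.measurableSet
  have hms : MeasurableSet {σ : ℝ | 0 ≤ σ ∧ σ + s ≤ 1} :=
    measurableSet_Icc.congr (s := Set.Icc 0 (1 - s)) (by ext σ; simp [le_sub_iff_add_le])
  have hFe : ∀ c t : ℝ, |c| < 1 - s → F (c + t * Complex.I) = ‖H (c + t * Complex.I)‖ₑ := by
    intro c t hc
    rw [hF, Set.indicator_of_mem]
    simpa using hc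
  have hT' : ∀ (c : ℝ) (ω : Measure ℝ) [SFinite ω] (B : ENNReal), |c| + s ≤ 1 - R ^ 2 →
    (∀ᵐ σ ∂ω, 0 ≤ σ ∧ σ + s ≤ 1) →
    (∀ r, R ≤ r → ENNReal.ofReal (r ^ (-l) * ∏ j : Fin k, (1 + N * |a j.succ| / r) ^ (-κ j.succ)) *
      ∫⁻ σ, ENNReal.ofReal ((1 + N * σ / r) ^ (-(p + (κ₀ + 1)))) ∂ω ≤ B) →
    ∫⁻ σ : ℝ, F (c + σ * Complex.I) ∂ω ≤ M * B := by
    intro c ω _ B hc h1 h2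
    rw [lintegral_congr fun t => hFe c t (by linarith)]
    exact hT c ω B hc h1 h2
  have hside : ∀ c : ℝ, |c| + s ≤ 1 - R ^ 2 →
      ∫⁻ σ : ℝ, (∫⁻ y in Set.Ioo (0 : ℝ) 1, F (c + (σ + A * y : ℝ) * Complex.I) *
        ENNReal.ofReal (y ^ (κ₀ - 1))) ∂ω ≤ M * (D * B) := by
    intro c hc
    rw [← lintegral_spread κ₀ A ω (f := fun s => F (c + s * Complex.I)) (by fun_prop)]
    refine hT' c _ _ hc ?_ ?_
    · refine ae_spread hms ?_
      filter_upwards [hω] with σ hσ y hy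
      have := mul_nonneg hA0 hy.1.le
      have := mul_le_of_le_one_right hA0 hy.2.le
      constructor <;> linarith [hσ.1, hσ.2]
    · intro r hr
      have hr0 : 0 < r := hR.trans_le hr
      have h1 := lintegral_spread_rpow_le hκ₀ hA0 hN hr0 hp (hω.mono fun σ h => h.1)
      rw [ENNReal.ofReal_mul (by positivity), ← hDof] at h1
      calc _ ≤ ENNReal.ofReal (r ^ (-l) * ∏ j : Fin k, (1 + N * |a j.succ| / r) ^ (-κ j.succ)) *
            (D * ENNReal.ofReal ((1 + N * A / r) ^ (-κ₀)) *
            ∫⁻ σ, ENNReal.ofReal ((1 + N * σ / r) ^ (-p)) ∂ω) := by gcongr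
        _ = D * (ENNReal.ofReal (r ^ (-l) * ∏ j : Fin k, (1 + N * |a j.succ| / r) ^ (-κ j.succ)) *
            (ENNReal.ofReal ((1 + N * A / r) ^ (-κ₀)) *
            ∫⁻ σ, ENNReal.ofReal ((1 + N * σ / r) ^ (-p)) ∂ω)) := by ring
        _ ≤ D * B := by gcongr; exact hκ' r hr
  have htop : ∫⁻ σ : ℝ, (∫⁻ x in Set.Ioo (-1 : ℝ) 1,
      F ((b + A * x : ℝ) + (σ + A : ℝ) * Complex.I)) ∂ω ≤ M * B * 2 := by
    rw [lintegral_lintegral_swap (by fun_prop)]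
    have h1 : ∀ x ∈ Set.Ioo (-1 : ℝ) 1,
        ∫⁻ σ : ℝ, F ((b + A * x : ℝ) + (σ + A : ℝ) * Complex.I) ∂ω ≤ M * B := by
      intro x hx
      rw [← lintegral_map (μ := ω) (f := fun s : ℝ => F ((b + A * x : ℝ) + s * Complex.I))
        (g := fun σ => σ + A) (by fun_prop) (by fun_prop)]
      refine hT' _ _ _ ?_ ?_ ?_
      · have h1 : |A * x| ≤ A := by
          rw [abs_mul, abs_of_nonneg hA0]
          exact mul_le_of_le_one_right hA0 (abs_le.2 ⟨hx.1.le, hx.2.le⟩)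
        linarith [abs_add_le b (A * x)]
      · rw [ae_map_iff (by fun_prop) hms]
        filter_upwards [hω] with σ hσ
        constructor <;> linarith [hσ.1, hσ.2]
      · intro r hr
        have hr0 : 0 < r := hR.trans_le hr
        refine le_trans ?_ (hκ' r hr)
        gcongr
        rw [lintegral_map (by fun_prop) (by fun_prop), ← lintegral_const_mul _ (by fun_prop)]
        refine lintegral_mono_ae ?_
        filter_upwards [hω] with σ hσ
        have h1 := hσ.1
        rw [← ENNReal.ofReal_mul (by positivity)]
        refine ENNReal.ofReal_le_ofReal ?_
        refine (one_add_mul_add_div_rpow_le hN hr0 h1 hA0 hp (by linarith)).trans ?_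
        rw [mul_comm]
        gcongr
        · rw [le_add_iff_nonneg_right]; positivity
        · linarith
    refine (setLIntegral_mono' measurableSet_Ioo h1).trans ?_
    rw [setLIntegral_const, Real.volume_Ioo]
    norm_num
  have hpt : ∀ σ : ℝ, ‖weightAvg κ₀ (a 0) H (b + σ * Complex.I)‖ₑ ≤ 
      C * ((∫⁻ x in Set.Ioo (-1 : ℝ) 1, F ((b + A * x : ℝ) + (σ + A : ℝ) * Complex.I)) +
        (∫⁻ y in Set.Ioo (0 : ℝ) 1, F ((b + A : ℝ) + (σ + A * y : ℝ) * Complex.I) *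
          ENNReal.ofReal (y ^ (κ₀ - 1))) +
        ∫⁻ y in Set.Ioo (0 : ℝ) 1, F ((b - A : ℝ) + (σ + A * y : ℝ) * Complex.I) *
          ENNReal.ofReal (y ^ (κ₀ - 1))) := by
    intro σ
    have hw : weightAvg κ₀ (a 0) H (b + σ * Complex.I) =
        ∫ t in (-1 : ℝ)..1, H ((b + a 0 * t : ℝ) + σ * Complex.I) *
          ((1 + t) * (1 - t ^ 2) ^ (κ₀ - 1) : ℝ) := by
      refine intervalIntegral.integral_congr fun t _ => ?_
      have : (b : ℂ) + σ * Complex.I + a 0 * t = (b + a 0 * t : ℝ) + σ * Complex.I := by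
        push_cast; ring
      simp only [this]
    have hlt : ∀ c : ℝ, |c - b| ≤ A → |c| < 1 - s := by
      intro c hc
      have := abs_add_le (c - b) b
      rw [sub_add_cancel] at this
      linarith
    rw [hw]
    refine (hC H (a 0) b σ fun z h1 _ _ => ?_).trans ?_
    · exact (hH z (hlt _ h1)).differentiableAt (hU.mem_nhds (hlt _ h1))
    · gcongr C * (?_ + ?_ + ?_)
      · refine setLIntegral_mono' measurableSet_Ioo fun x hx => ?_
        rw [hFe _ _ (hlt _ _)]
        rw [add_sub_cancel_left, abs_mul, abs_of_nonneg hA0]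
        exact mul_le_of_le_one_right hA0 (abs_le.2 ⟨hx.1.le, hx.2.le⟩)
      · refine lintegral_mono fun y => ?_
        rw [hFe _ _ (hlt _ _)]
        simp [abs_of_nonneg hA0]
      · refine lintegral_mono fun y => ?_
        rw [hFe _ _ (hlt _ _)]
        simp [abs_of_nonneg hA0]
  have hsum : |b + A| + s ≤ 1 - R ^ 2 ∧ |b - A| + s ≤ 1 - R ^ 2 := by
    have h1 := abs_add_le b A
    have h2 := abs_sub b A
    rw [abs_of_nonneg hA0] at h1 h2
    constructor <;> linarith
  have hm : ∀ c : ℝ, Measurable fun σ : ℝ => ∫⁻ y in Set.Ioo (0 : ℝ) 1,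
      F (c + (σ + A * y : ℝ) * Complex.I) * ENNReal.ofReal (y ^ (κ₀ - 1)) := fun c =>
    Measurable.lintegral_prod_right' (f := fun q : ℝ × ℝ =>
      F (c + (q.1 + A * q.2 : ℝ) * Complex.I) * ENNReal.ofReal (q.2 ^ (κ₀ - 1))) (by fun_prop)
  refine (lintegral_mono hpt).trans ?_
  rw [lintegral_const_mul' _ _ ENNReal.coe_ne_top, lintegral_add_right _ (hm _),
    lintegral_add_right _ (hm _)]
  calc _ ≤ (C : ENNReal) * (M * B * 2 + M * (D * B) + M * (D * B)) := by
        gcongr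
        · exact hside _ hsum.1
        · exact hside _ hsum.2
    _ = _ := by push_cast; ring

theorem exists_testBound_iterAvg : ∀ (k : ℕ) (κ : Fin k → ℝ), (∀ j, 0 < κ j) →
    ∃ C : NNReal, ∀ (g : ℂ → ℂ) (M : ENNReal) (N l R p : ℝ) (a : Fin k → ℝ),
    DifferentiableOn ℂ g {z | |z.re| < 1} → 0 ≤ N → 0 < R → 0 ≤ p →
    (∀ u : ℂ, |u.re| ≤ 1 - R ^ 2 → 0 ≤ u.im → u.im ≤ 1 → ∀ r, 0 < r → r ^ 2 = 1 - |u.re| →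
      ‖g u‖ₑ ≤ M * ENNReal.ofReal (r ^ (-l) * (1 + N * u.im / r) ^ (-(p + ∑ j, (κ j + 1))))) →
    TestBound (iterAvg g k κ a) (C * M) N l R p κ a := by
  intro k
  induction k with
  | zero =>
    intro κ _
    refine ⟨1, fun g M N l R p a hg hN hR hp hgb b ω _ B hb hω hB => ?_⟩
    simp only [Finset.univ_eq_empty, Finset.sum_empty, add_zero, Finset.prod_empty, mul_one] at *
    have hR2 : 0 < R ^ 2 := by positivity
    have hr : 0 < √(1 - |b|) := Real.sqrt_pos.2 (by linarith)
    have hr2 : √(1 - |b|) ^ 2 = 1 - |b| := Real.sq_sqrt (by linarith)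
    have hRr : R ≤ √(1 - |b|) := Real.le_sqrt_of_sq_le (by linarith)
    set r := √(1 - |b|)
    refine le_trans ?_ (mul_le_mul_right (hB r hRr) _)
    rw [← lintegral_const_mul _ (by fun_prop), ← lintegral_const_mul _ (by fun_prop)]
    refine lintegral_mono_ae ?_
    filter_upwards [hω] with σ hσ
    have := hgb (b + σ * Complex.I) (by simpa using hb) (by simpa using hσ.1)
      (by simpa using hσ.2) r hr (by simpa using hr2)
    rw [← ENNReal.ofReal_mul (Real.rpow_nonneg hr.le _)]
    simpa [iterAvg] using this
  | succ k ih =>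
    intro κ hκ
    obtain ⟨C₁, h₁⟩ := ih (fun j => κ j.succ) fun j => hκ _
    obtain ⟨C₂, h₂⟩ := testBound_weightAvg (hκ 0)
    refine ⟨C₂ * C₁, fun g M N l R p a hg hN hR hp hgb => ?_⟩
    rw [ENNReal.coe_mul, mul_assoc]
    refine h₂ _ (C₁ * M) N l R p k κ a rfl hN hR hp
      (differentiableOn_iterAvg hg k _ _ fun j => hκ _) ?_
    refine h₁ g M N l R _ _ hg hN hR (by linarith [hκ 0]) ?_
    intro u h1 h2 h3 r h4 h5
    have := hgb u h1 h2 h3 r h4 h5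
    rw [Fin.sum_univ_succ, ← add_assoc] at this
    exact this

/-- Lebesgue measure on the cube as a product measure. -/
theorem volume_restrict_cube (k : ℕ) : (volume : Measure (Fin k → ℝ)).restrict (cube k) =
    Measure.pi fun _ => (volume : Measure ℝ).restrict (Set.Icc (-1) 1) := by
  rw [volume_pi, cube, Measure.restrict_pi_pi]

theorem integrableOn_wprod {k : ℕ} {κ : Fin k → ℝ} (hκ : ∀ j, 0 < κ j) :
    IntegrableOn (wprod κ) (cube k) := by
  rw [IntegrableOn, volume_restrict_cube]
  refine Integrable.fintype_prod (f := fun i (t : ℝ) => (1 + t) * (1 - t ^ 2) ^ (κ i - 1)) ?_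
  intro i
  have := (intervalIntegrable_iff_integrableOn_Icc_of_le (by norm_num)).1
    (intervalIntegrable_weight (hκ i))
  exact this

theorem isCompact_cube (k : ℕ) : IsCompact (cube k) := isCompact_univ_pi fun _ => isCompact_Icc

theorem integrableOn_mul_wprod {k : ℕ} {κ : Fin k → ℝ} (hκ : ∀ j, 0 < κ j)
    {f : (Fin k → ℝ) → ℂ} (hf : ContinuousOn f (cube k)) :
    IntegrableOn (fun t => f t * (wprod κ t : ℝ)) (cube k) :=
  IntegrableOn.continuousOn_mul hf (Integrable.ofReal (integrableOn_wprod hκ)) (isCompact_cube k)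

theorem abs_sum_mul_le {k : ℕ} (a : Fin k → ℝ) {t : Fin k → ℝ} (ht : t ∈ cube k) :
    |∑ j, a j * t j| ≤ ∑ j, |a j| := by
  refine (Finset.abs_sum_le_sum_abs _ _).trans (Finset.sum_le_sum fun j _ => ?_)
  rw [abs_mul]
  exact mul_le_of_le_one_right (abs_nonneg _) (abs_le.2 (ht j trivial))

theorem continuousOn_comp_sum {g : ℂ → ℂ} (hg : ContinuousOn g {z | |z.re| < 1}) {k : ℕ}
    (a : Fin k → ℝ) {b : ℂ} (hb : |b.re| + ∑ j, |a j| < 1) :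
    ContinuousOn (fun t : Fin k → ℝ => g (b + (∑ j, a j * t j : ℝ))) (cube k) := by
  refine hg.comp (by fun_prop) fun t ht => ?_
  have h1 := abs_sum_mul_le a ht
  have h2 := abs_add_le b.re (∑ j, a j * t j)
  simp only [Set.mem_ofPred_eq, Complex.add_re, Complex.ofReal_re]
  linarith

theorem iterAvg_eq_integral {g : ℂ → ℂ} (hg : ContinuousOn g {z | |z.re| < 1}) :
    ∀ (k : ℕ) (κ a : Fin k → ℝ), (∀ j, 0 < κ j) → ∀ b : ℂ, |b.re| + ∑ j, |a j| < 1 →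
      iterAvg g k κ a b = ∫ t in cube k, g (b + (∑ j, a j * t j : ℝ)) * (wprod κ t : ℝ) := by
  intro k
  induction k with
  | zero =>
    intro κ a _ b _
    rw [volume_restrict_cube, Measure.pi_of_empty]
    simp [iterAvg, wprod]
  | succ k ih =>
    intro κ a hκ b hb
    have hintg := integrableOn_mul_wprod hκ (continuousOn_comp_sum hg a hb)
    rw [IntegrableOn, volume_restrict_cube] at hintg
    have hmp := (measurePreserving_piFinSuccAbove
      (fun _ : Fin (k + 1) => (volume : Measure ℝ).restrict (Set.Icc (-1) 1)) 0).symm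
    have hintg' := hmp.integrable_comp_emb (MeasurableEquiv.measurableEmbedding _) |>.2 hintg
    simp only [Function.comp_def] at hintg'
    rw [volume_restrict_cube, ← hmp.integral_comp', integral_prod _ hintg', iterAvg, weightAvg,
      intervalIntegral.integral_of_le (by norm_num), ← integral_Icc_eq_integral_Ioc]
    refine setIntegral_congr_fun measurableSet_Icc fun x hx => ?_
    have hx1 : |a 0 * x| ≤ |a 0| := by
      rw [abs_mul]; exact mul_le_of_le_one_right (abs_nonneg _) (abs_le.2 hx)
    rw [Fin.sum_univ_succ] at hb
    rw [ih _ _ (fun j => hκ _), ← volume_restrict_cube, ← integral_mul_const]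
    · refine setIntegral_congr_fun (isCompact_cube k).measurableSet fun y hy => ?_
      simp only [MeasurableEquiv.piFinSuccAbove_symm_apply]
      rw [Fin.sum_univ_succ, wprod, wprod, Fin.prod_univ_succ]
      simp
      ring_nf
    · have := abs_add_le b.re (a 0 * x)
      simp
      linarith

theorem rpow_mul_prod_le {k : ℕ} {κ : Fin k → ℝ} (hκ : ∀ j, 0 < κ j) {m N R r : ℝ} (hm : 0 ≤ m)
    (hN : 0 ≤ N) (hR : 0 < R) (hr : R ≤ r) (a : Fin k → ℝ) :
    r ^ (-((∑ j, κ j) + m)) * ∏ j, (1 + N * |a j| / r) ^ (-κ j) ≤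
      R ^ (-m) * ∏ j, (R + N * |a j|) ^ (-κ j) := by
  have hr0 : 0 < r := hR.trans_le hr
  have e : r ^ (-((∑ j, κ j) + m)) * ∏ j, (1 + N * |a j| / r) ^ (-κ j) =
      r ^ (-m) * ∏ j, (r + N * |a j|) ^ (-κ j) := by
    rw [neg_add, add_comm, Real.rpow_add hr0, mul_assoc, ← Finset.sum_neg_distrib,
      Real.rpow_sum_of_pos hr0, ← Finset.prod_mul_distrib]
    congr 1
    refine Finset.prod_congr rfl fun j _ => ?_
    rw [← Real.mul_rpow hr0.le (by positivity)]
    congr 1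
    field_simp
  rw [e]
  refine mul_le_mul (Real.rpow_le_rpow_of_nonpos hR hr (by linarith)) ?_
    (Finset.prod_nonneg fun j _ => Real.rpow_nonneg (by positivity) _) (Real.rpow_nonneg hR.le _)
  refine Finset.prod_le_prod (fun j _ => Real.rpow_nonneg (by positivity) _) fun j _ => ?_
  exact Real.rpow_le_rpow_of_nonpos (by positivity) (by linarith) (by linarith [hκ j])

theorem abs_integral_gegenC_le_norm_iterAvg (n : ℕ) {l : ℝ} (hl : 0 < l) {k : ℕ} {κ : Fin k → ℝ}
    (hκ : ∀ j, 0 < κ j) {a : Fin k → ℝ} (ha : ∑ j, |a j| < 1) :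
    |∫ t in cube k, gegenC n l (∑ j, a j * t j) * wprod κ t| ≤
      ‖iterAvg (gegenG n l) k κ a 0‖ := by
  have hg := (differentiableOn_gegenG n hl).continuousOn
  have hb : |(0 : ℂ).re| + ∑ j, |a j| < 1 := by simpa using ha
  rw [iterAvg_eq_integral hg k κ a hκ 0 hb]
  have hintg := integrableOn_mul_wprod hκ (continuousOn_comp_sum hg a hb)
  have hre := integral_re hintg
  have : ∫ t in cube k, gegenC n l (∑ j, a j * t j) * wprod κ t =
      ∫ t in cube k, RCLike.re (gegenG n l (0 + (∑ j, a j * t j : ℝ)) * (wprod κ t : ℝ)) := by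
    refine setIntegral_congr_fun (isCompact_cube k).measurableSet fun t ht => ?_
    have h1 := abs_sum_mul_le a ht
    have h2 : (∑ j, a j * t j) ^ 2 < 1 := by
      rw [sq_lt_one_iff_abs_lt_one]; linarith
    simp only [RCLike.re_eq_complex_re, Complex.re_mul_ofReal, zero_add]
    rw [re_gegenG n hl h2]
  rw [this, hre]
  exact Complex.abs_re_le_norm _

theorem exists_abs_integral_gegenC_le {k : ℕ} {κ : Fin k → ℝ} (hκ : ∀ j, 0 < κ j) {m : ℝ}
    (hm : 0 ≤ m) (hl : 0 < (∑ j, κ j) + m) :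
    ∃ C : ℝ, 0 < C ∧ ∀ n : ℕ, 1 ≤ n → ∀ (a : Fin k → ℝ) (R : ℝ), 1 / (2 * n) ≤ R →
      ∑ j, |a j| ≤ 1 - R ^ 2 →
      n * |∫ t in cube k, gegenC n ((∑ j, κ j) + m) (∑ j, a j * t j) * wprod κ t| ≤
        C * (n : ℝ) ^ m * (R ^ (-m) * ∏ j, (|a j| + R / n) ^ (-κ j)) := by
  set l := (∑ j, κ j) + m with hldef
  have hK : 0 ≤ ∑ j, (κ j + 1) := Finset.sum_nonneg fun j _ => by linarith [hκ j]
  obtain ⟨C₁, hC₁, h₁⟩ := exists_norm_gegenG_le hl hK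
  obtain ⟨C₂, h₂⟩ := exists_testBound_iterAvg k κ hκ
  refine ⟨(C₂ + 1) * C₁, by positivity, fun n hn a R hnR ha => ?_⟩
  have hn0 : (0 : ℝ) < n := by exact_mod_cast hn
  have hR : 0 < R := lt_of_lt_of_le (by positivity) hnR
  have hR2 : 0 < R ^ 2 := by positivity
  have hT := h₂ (gegenG n l) (ENNReal.ofReal (C₁ * (n : ℝ) ^ l / n)) n l R 0 a
    (differentiableOn_gegenG n hl) hn0.le hR le_rfl ?_
  · have hP0 : 0 ≤ R ^ (-m) * ∏ j, (R + n * |a j|) ^ (-κ j) :=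
      mul_nonneg (Real.rpow_nonneg hR.le _)
        (Finset.prod_nonneg fun j _ => Real.rpow_nonneg (by positivity) _)
    have h0 := hT 0 (Measure.dirac 0) (ENNReal.ofReal (R ^ (-m) * ∏ j, (R + n * |a j|) ^ (-κ j)))
      (by simpa using ha) ?_ ?_
    · rw [lintegral_dirac] at h0
      simp only [Complex.ofReal_zero, zero_mul, add_zero] at h0
      have hC2 : (C₂ : ENNReal) = ENNReal.ofReal C₂ := by simp
      rw [hC2, ← ENNReal.ofReal_mul (by positivity), ← ENNReal.ofReal_mul (by positivity),
        ← ofReal_norm, ENNReal.ofReal_le_ofReal_iff (by positivity)] at h0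
      have h3 := abs_integral_gegenC_le_norm_iterAvg n hl hκ (a := a) (by linarith)
      have e : (n : ℝ) ^ l * (R ^ (-m) * ∏ j, (R + n * |a j|) ^ (-κ j)) =
          (n : ℝ) ^ m * (R ^ (-m) * ∏ j, (|a j| + R / n) ^ (-κ j)) := by
        rw [hldef, add_comm, Real.rpow_add hn0, Real.rpow_sum_of_pos hn0]
        have : ∀ j, (|a j| + R / n) ^ (-κ j) = (n : ℝ) ^ κ j * (R + n * |a j|) ^ (-κ j) := by
          intro j
          rw [show R + n * |a j| = n * (|a j| + R / n) by field_simp; ring,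
            Real.mul_rpow hn0.le (by positivity), ← mul_assoc, ← Real.rpow_add hn0]
          simp
        simp only [this]
        rw [Finset.prod_mul_distrib]
        ring
      calc _ ≤ n * (C₂ * (C₁ * (n : ℝ) ^ l / n) * (R ^ (-m) * ∏ j, (R + n * |a j|) ^ (-κ j))) := by
            gcongr
            exact h3.trans h0
        _ = C₂ * C₁ * ((n : ℝ) ^ l * (R ^ (-m) * ∏ j, (R + n * |a j|) ^ (-κ j))) := by
            field_simp
        _ ≤ (C₂ + 1) * C₁ * ((n : ℝ) ^ l * (R ^ (-m) * ∏ j, (R + n * |a j|) ^ (-κ j))) := by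
            gcongr; linarith
        _ = _ := by rw [e]; ring
    · rw [ae_dirac_eq]
      simp only [Filter.eventually_pure, zero_add]
      exact ⟨le_rfl, by linarith⟩
    · intro r hr
      rw [lintegral_dirac]
      simp only [neg_zero, Real.rpow_zero, ENNReal.ofReal_one, mul_one]
      exact ENNReal.ofReal_le_ofReal (rpow_mul_prod_le hκ hm hn0.le hR hr a)
  · intro u hu h0 h1 r hr hr2
    have hRr : R ≤ r := le_of_sq_le_sq (by linarith) hr.le
    have := h₁ n hn u (by linarith) h0 h1 r hr hr2 (hnR.trans hRr)
    rw [zero_add, ← ENNReal.ofReal_mul (by positivity), ← ofReal_norm]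
    refine ENNReal.ofReal_le_ofReal ?_
    rw [div_mul_eq_mul_div, le_div_iff₀ hn0]
    linarith

theorem eval_chebyshev_T_le {n : ℕ} (hn : 1 ≤ n) {u : ℝ} (h1 : 1 ≤ u) (hu : u ≤ 1 + 2 / (n : ℝ) ^ 2) :
    (Polynomial.Chebyshev.T ℝ n).eval u ≤ Real.cosh 2 := by
  have hn0 : (0 : ℝ) < n := by exact_mod_cast hn
  have hs : 1 / (n : ℝ) ≤ Real.sinh (1 / n) := Real.self_le_sinh_iff.2 (by positivity)
  have hs2 : (1 / (n : ℝ)) ^ 2 ≤ Real.sinh (1 / n) ^ 2 := by gcongr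
  have hc : u ≤ Real.cosh (2 * (1 / n)) := by
    rw [Real.cosh_two_mul, Real.cosh_sq]
    have : 2 / (n : ℝ) ^ 2 = 2 * (1 / (n : ℝ)) ^ 2 := by ring
    linarith
  rw [← Real.cosh_arcosh h1] at hc
  rw [Real.cosh_le_cosh, abs_of_nonneg (by positivity : (0 : ℝ) ≤ 2 * (1 / n))] at hc
  have e := Polynomial.Chebyshev.T_real_cosh (Real.arcosh u) n
  rw [Real.cosh_arcosh h1] at e
  rw [e, Real.cosh_le_cosh, abs_mul]
  push_cast
  rw [abs_of_pos hn0, abs_of_pos (by norm_num : (0 : ℝ) < 2)]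
  calc (n : ℝ) * |Real.arcosh u| ≤ n * (2 * (1 / n)) := by gcongr
    _ = 2 := by field_simp

/-- A polynomial of degree at most `n` does not grow by more than a constant factor when
extrapolated by a distance of order `n⁻²` beyond the end of an interval. -/
theorem abs_eval_one_le {n : ℕ} (hn : 1 ≤ n) {P : Polynomial ℝ} (hP : P.degree ≤ n) {M : ℝ}
    (hM : 0 < M)
    (h : ∀ r ∈ Set.Icc (1 / 2 : ℝ) (1 - 1 / (4 * (n : ℝ) ^ 2)), |P.eval r| ≤ M) :
    |P.eval 1| ≤ Real.cosh 2 * M := by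
  have hn0 : (1 : ℝ) ≤ n := by exact_mod_cast hn
  set δ : ℝ := 1 / (4 * (n : ℝ) ^ 2) with hδ
  have hδ0 : 0 < δ := by positivity
  have hδ1 : δ ≤ 1 / 4 := by
    rw [hδ]
    apply one_div_le_one_div_of_le (by norm_num)
    nlinarith
  set s : ℝ := (1 / 2 - δ) / 2 with hs
  set c : ℝ := (3 / 2 - δ) / 2 with hc
  have hs0 : 1 / 8 ≤ s := by rw [hs]; linarith
  set u : ℝ := 1 + δ / s with hu
  have hu1 : 1 ≤ u := by
    have : 0 ≤ δ / s := by positivity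
    linarith
  have hu2 : u ≤ 1 + 2 / (n : ℝ) ^ 2 := by
    have : δ / s ≤ δ / (1 / 8) := by gcongr
    have e : δ / (1 / 8) = 2 / (n : ℝ) ^ 2 := by rw [hδ]; field_simp; norm_num
    linarith
  have hcu : c + s * u = 1 := by
    have : s ≠ 0 := by linarith
    rw [hu, mul_add, mul_div_cancel₀ _ this]
    rw [hc, hs]; ring
  have key : ∀ ε : ℝ, |ε| = 1 → ε * P.eval 1 ≤ Real.cosh 2 * M := by
    intro ε hε
    have hdeg : (Polynomial.C (ε / M) *
        P.comp (Polynomial.C s * Polynomial.X + Polynomial.C c)).degree ≤ n := by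
      rw [← Polynomial.natDegree_le_iff_degree_le] at hP ⊢
      refine (Polynomial.natDegree_C_mul_le _ _).trans ?_
      refine Polynomial.natDegree_comp_le.trans ?_
      calc _ ≤ n * 1 := Nat.mul_le_mul hP Polynomial.natDegree_linear_le
        _ = n := mul_one n
    have := Polynomial.Chebyshev.eval_iterate_derivative_le_of_forall_abs_le_one (k := 0) hu1 hdeg ?_
    · simp only [Function.iterate_zero, id_eq, Polynomial.eval_mul, Polynomial.eval_C,
        Polynomial.eval_comp, Polynomial.eval_add, Polynomial.eval_X] at this
      rw [add_comm, hcu] at this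
      have h2 := this.trans (eval_chebyshev_T_le hn hu1 hu2)
      rw [div_mul_eq_mul_div, div_le_iff₀ hM] at h2
      exact h2
    · intro v hv
      simp only [Polynomial.eval_mul, Polynomial.eval_C,
        Polynomial.eval_comp, Polynomial.eval_add, Polynomial.eval_X]
      rw [abs_mul, abs_div, hε, abs_of_pos hM, one_div, ← div_eq_inv_mul, div_le_one hM]
      apply h
      constructor <;> nlinarith [hv.1, hv.2]
  rw [abs_le]
  constructor
  · linarith [key (-1) (by simp)]
  · linarith [key 1 (by simp)]

theorem exists_polynomial_jacobiP (n : ℕ) (a b : ℝ) :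
    ∃ P : Polynomial ℝ, P.natDegree ≤ n ∧ ∀ t, jacobiP n a b t = P.eval t := by
  refine ⟨∑ m ∈ range (n + 1), Polynomial.C (genBinom (n + a) (n - m) * genBinom (n + b) m) *
    (Polynomial.C (1 / 2) * Polynomial.X + Polynomial.C (-1 / 2)) ^ m *
    (Polynomial.C (1 / 2) * Polynomial.X + Polynomial.C (1 / 2)) ^ (n - m), ?_, fun t => ?_⟩
  · refine Polynomial.natDegree_sum_le_of_forall_le _ _ fun m hm => ?_
    have hm : m ≤ n := Nat.lt_succ_iff.1 (mem_range.1 hm)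
    rw [mul_assoc]
    refine (Polynomial.natDegree_C_mul_le _ _).trans (Polynomial.natDegree_mul_le.trans ?_)
    have h1 : ∀ (c e : ℝ) (i : ℕ),
        ((Polynomial.C c * Polynomial.X + Polynomial.C e) ^ i).natDegree ≤ i := fun c e i =>
      Polynomial.natDegree_pow_le.trans
        ((Nat.mul_le_mul_left i Polynomial.natDegree_linear_le).trans (mul_one i).le)
    calc _ ≤ m + (n - m) := add_le_add (h1 _ _ _) (h1 _ _ _)
      _ = n := by omega
  · rw [jacobiP, Polynomial.eval_finsetSum]
    refine Finset.sum_congr rfl fun m _ => ?_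
    simp only [Polynomial.eval_mul, Polynomial.eval_C, Polynomial.eval_pow, Polynomial.eval_add,
      Polynomial.eval_X]
    congr 3 <;> ring

theorem exists_polynomial_gegenC (n : ℕ) (l : ℝ) :
    ∃ P : Polynomial ℝ, P.natDegree ≤ n ∧ ∀ t, gegenC n l t = P.eval t := by
  obtain ⟨P, hP, h⟩ := exists_polynomial_jacobiP n (l - 1 / 2) (l - 1 / 2)
  refine ⟨Polynomial.C (poch (2 * l) n / poch (l + 1 / 2) n) * P,
    (Polynomial.natDegree_C_mul_le _ _).trans hP, fun t => ?_⟩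
  rw [gegenC, h, Polynomial.eval_mul, Polynomial.eval_C]

theorem exists_polynomial_integral_gegenC (n : ℕ) (l : ℝ) {k : ℕ} {κ : Fin k → ℝ}
    (hκ : ∀ j, 0 < κ j) (a : Fin k → ℝ) :
    ∃ P : Polynomial ℝ, P.degree ≤ n ∧ ∀ r : ℝ,
      ∫ t in cube k, gegenC n l (∑ j, r * a j * t j) * wprod κ t = P.eval r := by
  obtain ⟨P, hP, h⟩ := exists_polynomial_gegenC n l
  refine ⟨∑ i ∈ range (n + 1), Polynomial.C (P.coeff i *
    ∫ t in cube k, (∑ j, a j * t j) ^ i * wprod κ t) * Polynomial.X ^ i, ?_, fun r => ?_⟩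
  · rw [← Polynomial.natDegree_le_iff_degree_le]
    refine Polynomial.natDegree_sum_le_of_forall_le _ _ fun i hi => ?_
    exact (Polynomial.natDegree_C_mul_X_pow_le _ _).trans (Nat.lt_succ_iff.1 (mem_range.1 hi))
  · rw [Polynomial.eval_finsetSum]
    have hintg : ∀ i : ℕ, IntegrableOn (fun t => (∑ j, a j * t j) ^ i * wprod κ t) (cube k) :=
      fun i => IntegrableOn.continuousOn_mul (by fun_prop) (integrableOn_wprod hκ) (isCompact_cube k)
    have e : ∀ t : Fin k → ℝ, gegenC n l (∑ j, r * a j * t j) * wprod κ t =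
        ∑ i ∈ range (n + 1), P.coeff i * r ^ i * ((∑ j, a j * t j) ^ i * wprod κ t) := by
      intro t
      rw [h, Polynomial.eval_eq_sum_range' (Nat.lt_succ_iff.2 hP), Finset.sum_mul]
      refine Finset.sum_congr rfl fun i _ => ?_
      have : ∑ j, r * a j * t j = r * ∑ j, a j * t j := by
        rw [Finset.mul_sum]; exact Finset.sum_congr rfl fun j _ => mul_assoc _ _ _
      rw [this, mul_pow]; ring
    simp_rw [e]
    rw [integral_finsetSum _ fun i _ => (hintg i).const_mul _]
    refine Finset.sum_congr rfl fun i _ => ?_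
    rw [integral_const_mul, Polynomial.eval_mul, Polynomial.eval_C, Polynomial.eval_pow,
      Polynomial.eval_X]
    ring

theorem exists_abs_integral_gegenC_le' {k : ℕ} {κ : Fin k → ℝ} (hκ : ∀ j, 0 < κ j) {m : ℝ}
    (hm : 0 ≤ m) (hl : 0 < (∑ j, κ j) + m) :
    ∃ C : ℝ, 0 < C ∧ ∀ n : ℕ, 1 ≤ n → ∀ a : Fin k → ℝ, ∑ j, |a j| ≤ 1 →
      n * |∫ t in cube k, gegenC n ((∑ j, κ j) + m) (∑ j, a j * t j) * wprod κ t| ≤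
        C * (n : ℝ) ^ m * ((1 / n : ℝ) ^ (-m) * ∏ j, (|a j| + 1 / (n : ℝ) ^ 2) ^ (-κ j)) := by
  obtain ⟨C, hC, h⟩ := exists_abs_integral_gegenC_le hκ hm hl
  refine ⟨Real.cosh 2 * (C * (1 / 2) ^ (-((∑ j, κ j) + m))), by positivity, fun n hn a ha => ?_⟩
  have hn0 : (0 : ℝ) < n := by exact_mod_cast hn
  have hn1 : (1 : ℝ) ≤ n := by exact_mod_cast hn
  obtain ⟨P, hP, hPe⟩ := exists_polynomial_integral_gegenC n ((∑ j, κ j) + m) hκ a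
  have hpos : 0 < ∏ j, (|a j| + 1 / (n : ℝ) ^ 2) ^ (-κ j) :=
    Finset.prod_pos fun j _ => Real.rpow_pos_of_pos (by positivity) _
  set B : ℝ := C * (1 / 2) ^ (-((∑ j, κ j) + m)) * (n : ℝ) ^ m *
    ((1 / n : ℝ) ^ (-m) * ∏ j, (|a j| + 1 / (n : ℝ) ^ 2) ^ (-κ j)) with hB
  have hB0 : 0 < B := by positivity
  have hmain := abs_eval_one_le hn hP (M := B / n) (by positivity) ?_
  · have e := hPe 1
    simp only [one_mul] at e
    rw [e]
    rw [← mul_div_assoc, le_div_iff₀ hn0] at hmain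
    calc _ = |P.eval 1| * n := mul_comm _ _
      _ ≤ _ := hmain
      _ = _ := by rw [hB]; ring
  · rintro r ⟨hr1, hr2⟩
    have hr0 : 0 < r := by linarith
    rw [← hPe, le_div_iff₀ hn0, mul_comm]
    have h1 := h n hn (fun j => r * a j) (1 / (2 * n)) le_rfl ?_
    · refine h1.trans ?_
      have e1 : (1 / (2 * n) : ℝ) ^ (-m) = (1 / 2) ^ (-m) * (1 / n : ℝ) ^ (-m) := by
        rw [← Real.mul_rpow (by norm_num) (by positivity)]
        congr 1; field_simp
      have e2 : ∏ j, (|r * a j| + 1 / (2 * n) / (n : ℝ)) ^ (-κ j) ≤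
          (1 / 2) ^ (-∑ j, κ j) * ∏ j, (|a j| + 1 / (n : ℝ) ^ 2) ^ (-κ j) := by
        rw [← Finset.sum_neg_distrib, Real.rpow_sum_of_pos (by norm_num),
          ← Finset.prod_mul_distrib]
        refine Finset.prod_le_prod (fun j _ => by positivity) fun j _ => ?_
        rw [← Real.mul_rpow (by norm_num) (by positivity)]
        refine Real.rpow_le_rpow_of_nonpos (by positivity) ?_ (by linarith [hκ j])
        rw [abs_mul, abs_of_pos hr0]
        have : 1 / (2 * n) / (n : ℝ) = 1 / 2 * (1 / (n : ℝ) ^ 2) := by field_simp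
        rw [this]
        nlinarith [abs_nonneg (a j)]
      rw [e1]
      calc _ ≤ C * (n : ℝ) ^ m * ((1 / 2) ^ (-m) * (1 / n : ℝ) ^ (-m) *
            ((1 / 2) ^ (-∑ j, κ j) * ∏ j, (|a j| + 1 / (n : ℝ) ^ 2) ^ (-κ j))) := by gcongr
        _ = B := by
          rw [hB, neg_add, Real.rpow_add (by norm_num)]; ring
    · simp only [abs_mul, abs_of_pos hr0]
      rw [← Finset.mul_sum]
      have : (1 / (2 * n) : ℝ) ^ 2 = 1 / (4 * (n : ℝ) ^ 2) := by ring
      rw [this]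
      nlinarith

theorem rpow_neg_le_of_le_four_mul {p q s : ℝ} (hq : 0 < q) (h : q ≤ 4 * p)
    (hs : 0 ≤ s) : p ^ (-s) ≤ 4 ^ s * q ^ (-s) := by
  have e : (4 : ℝ) ^ s * q ^ (-s) = (q / 4) ^ (-s) := by
    rw [Real.div_rpow hq.le (by norm_num), Real.rpow_neg (by norm_num : (0 : ℝ) ≤ 4)]
    field_simp
  rw [e]
  exact Real.rpow_le_rpow_of_nonpos (by positivity) (by linarith) (by linarith)

theorem rpow_mul_prod_le_of_le_four_mul {k : ℕ} {κ : Fin k → ℝ} (hκ : ∀ j, 0 < κ j) {m : ℝ}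
    (hm : 0 ≤ m) (a : Fin k → ℝ) {R N ρ : ℝ} (hR : 0 < R) (hN : 0 < N) (hρ : 0 ≤ ρ)
    (h : ρ + N⁻¹ ≤ 4 * R) :
    R ^ (-m) * ∏ j, (|a j| + R / N) ^ (-κ j) ≤ 4 ^ (m + ∑ j, κ j) *
      ((ρ + N⁻¹) ^ (-m) * ∏ j, (|a j| + N⁻¹ * ρ + (N ^ 2)⁻¹) ^ (-κ j)) := by
  have h1 : R ^ (-m) ≤ 4 ^ m * (ρ + N⁻¹) ^ (-m) :=
    rpow_neg_le_of_le_four_mul (by positivity) h hm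
  have h2 : ∏ j, (|a j| + R / N) ^ (-κ j) ≤
      4 ^ (∑ j, κ j) * ∏ j, (|a j| + N⁻¹ * ρ + (N ^ 2)⁻¹) ^ (-κ j) := by
    rw [Real.rpow_sum_of_pos (by norm_num), ← Finset.prod_mul_distrib]
    refine Finset.prod_le_prod (fun j _ => by positivity) fun j _ => ?_
    refine rpow_neg_le_of_le_four_mul (by positivity) ?_ (hκ j).le
    have : N⁻¹ * (ρ + N⁻¹) ≤ N⁻¹ * (4 * R) := by gcongr
    have e : N⁻¹ * (ρ + N⁻¹) = N⁻¹ * ρ + (N ^ 2)⁻¹ := by rw [mul_add, ← sq, inv_pow]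
    have e2 : 4 * (|a j| + R / N) = 4 * |a j| + N⁻¹ * (4 * R) := by ring
    rw [e2]
    linarith [abs_nonneg (a j)]
  rw [Real.rpow_add (by norm_num)]
  calc _ ≤ 4 ^ m * (ρ + N⁻¹) ^ (-m) *
        (4 ^ (∑ j, κ j) * ∏ j, (|a j| + N⁻¹ * ρ + (N ^ 2)⁻¹) ^ (-κ j)) := by gcongr
    _ = _ := by ring

theorem norm_ebar_sub_sq {k : ℕ} {x y : EuclideanSpace ℝ (Fin k)}
    (hx : x ∈ Metric.sphere (0 : EuclideanSpace ℝ (Fin k)) 1)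
    (hy : y ∈ Metric.sphere (0 : EuclideanSpace ℝ (Fin k)) 1) :
    ‖ebar x - ebar y‖ ^ 2 = 2 - 2 * ∑ j, |x j * y j| := by
  have h : ∀ z : EuclideanSpace ℝ (Fin k), z ∈ Metric.sphere 0 1 → ∑ j, z j ^ 2 = 1 := by
    intro z hz
    have := EuclideanSpace.real_norm_sq_eq z
    rw [mem_sphere_zero_iff_norm.1 hz] at this
    linarith
  rw [EuclideanSpace.real_norm_sq_eq]
  have e : ∀ j, (ebar x - ebar y) j ^ 2 = x j ^ 2 + y j ^ 2 - 2 * |x j * y j| := by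
    intro j
    have : (ebar x - ebar y) j = |x j| - |y j| := rfl
    rw [this, sub_sq, sq_abs, sq_abs, abs_mul]
    ring
  simp_rw [e]
  rw [Finset.sum_sub_distrib, Finset.sum_add_distrib, h x hx, h y hy, ← Finset.mul_sum]
  norm_num

theorem exists_abs_integral_gegenC_sphere_le {k : ℕ} {κ : Fin k → ℝ} (hκ : ∀ j, 0 < κ j) {m : ℝ}
    (hm : 0 ≤ m) (hl : 0 < (∑ j, κ j) + m) :
    ∃ C : ℝ, 0 < C ∧ ∀ n : ℕ, 1 ≤ n → ∀ x y : EuclideanSpace ℝ (Fin k),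
      x ∈ Metric.sphere (0 : EuclideanSpace ℝ (Fin k)) 1 →
      y ∈ Metric.sphere (0 : EuclideanSpace ℝ (Fin k)) 1 →
      n * |∫ t in cube k, gegenC n ((∑ j, κ j) + m) (∑ j, x j * y j * t j) * wprod κ t| ≤
        C * (n : ℝ) ^ m * ((‖ebar x - ebar y‖ + (n : ℝ)⁻¹) ^ (-m) *
          ∏ j, (|x j * y j| + (n : ℝ)⁻¹ * ‖ebar x - ebar y‖ + ((n : ℝ) ^ 2)⁻¹) ^ (-κ j)) := by
  obtain ⟨C₁, hC₁, h₁⟩ := exists_abs_integral_gegenC_le hκ hm hl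
  obtain ⟨C₂, hC₂, h₂⟩ := exists_abs_integral_gegenC_le' hκ hm hl
  refine ⟨(C₁ + C₂) * 4 ^ (m + ∑ j, κ j), by positivity, fun n hn x y hx hy => ?_⟩
  have hn0 : (0 : ℝ) < n := by exact_mod_cast hn
  have hsq := norm_ebar_sub_sq hx hy
  have hρ := norm_nonneg (ebar x - ebar y)
  set ρ := ‖ebar x - ebar y‖
  set S := ∑ j, |x j * y j| with hS
  suffices H : ∃ R, 0 < R ∧ ρ + (n : ℝ)⁻¹ ≤ 4 * R ∧
      n * |∫ t in cube k, gegenC n ((∑ j, κ j) + m) (∑ j, x j * y j * t j) * wprod κ t| ≤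
      (C₁ + C₂) * (n : ℝ) ^ m * (R ^ (-m) * ∏ j, (|x j * y j| + R / n) ^ (-κ j)) by
    obtain ⟨R, hR, hle, H⟩ := H
    refine H.trans ?_
    have := rpow_mul_prod_le_of_le_four_mul hκ hm (fun j => x j * y j) hR hn0 hρ hle
    calc _ ≤ (C₁ + C₂) * (n : ℝ) ^ m * _ := mul_le_mul_of_nonneg_left this (by positivity)
      _ = _ := by ring
  have hinv : (1 / (2 * n) : ℝ) = (n : ℝ)⁻¹ / 2 := by field_simp
  have hinv0 : 0 < (n : ℝ)⁻¹ := by positivity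
  by_cases hc : 1 / (2 * n) ≤ √(1 - S)
  · have hR : 0 < √(1 - S) := lt_of_lt_of_le (by positivity) hc
    have hR2 : √(1 - S) ^ 2 = 1 - S := Real.sq_sqrt (Real.sqrt_pos.1 hR).le
    refine ⟨√(1 - S), hR, ?_, ?_⟩
    · rw [hinv] at hc
      have : ρ ≤ 2 * √(1 - S) := by
        refine (pow_le_pow_iff_left₀ hρ (by positivity) two_ne_zero).1 ?_
        nlinarith
      linarith
    · refine (h₁ n hn (fun j => x j * y j) _ hc (by rw [hR2, ← hS]; linarith)).trans ?_
      gcongr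
      linarith
  · have hS1 : S ≤ 1 := by nlinarith
    push Not at hc
    have hR2 : √(1 - S) ^ 2 = 1 - S := Real.sq_sqrt (by linarith)
    refine ⟨1 / n, by positivity, ?_, ?_⟩
    · have : ρ ≤ (n : ℝ)⁻¹ := by
        refine (pow_le_pow_iff_left₀ hρ (by positivity) two_ne_zero).1 ?_
        rw [hinv] at hc
        nlinarith [Real.sqrt_nonneg (1 - S)]
      rw [one_div]; linarith
    · refine (h₂ n hn (fun j => x j * y j) hS1).trans ?_
      have e : (1 / n : ℝ) / n = 1 / (n : ℝ) ^ 2 := by field_simp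
      simp only [e]
      gcongr
      linarith

/-- projection kernel estimate on the sphere: there is `c > 0`
(depending only on `d, κ`) such that for all `n ≥ 1` and `x, y ∈ S^d`,
`|P_n(h_κ²;x,y)| ≤ c n^{(d-1)/2} (‖x̄-ȳ‖+n⁻¹)^{-(d-1)/2} ∏ (|x_j y_j| + n⁻¹‖x̄-ȳ‖ + n⁻²)^{-κ_j}`. -/
theorem projection_kernel_estimate_sphere (d : ℕ) (hd : 1 ≤ d) (κ : Fin (d + 1) → ℝ)
    (hκ : ∀ i, 0 < κ i) :
    ∃ c : ℝ, 0 < c ∧ ∀ n : ℕ, 1 ≤ n → ∀ x y : EuclideanSpace ℝ (Fin (d + 1)),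
      x ∈ Metric.sphere (0 : EuclideanSpace ℝ (Fin (d + 1))) 1 →
      y ∈ Metric.sphere (0 : EuclideanSpace ℝ (Fin (d + 1))) 1 →
      |hP d κ n x y| ≤
        c * (n : ℝ) ^ (((d : ℝ) - 1) / 2) *
          (‖ebar x - ebar y‖ + (n : ℝ)⁻¹) ^ (-(((d : ℝ) - 1) / 2)) *
          ∏ j, (|x j * y j| + (n : ℝ)⁻¹ * ‖ebar x - ebar y‖ + ((n : ℝ) ^ 2)⁻¹) ^ (-κ j) := by
  have hd' : (1 : ℝ) ≤ d := by exact_mod_cast hd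
  have hm : 0 ≤ ((d : ℝ) - 1) / 2 := by linarith
  have hκs : 0 < ∑ j, κ j := Finset.sum_pos (fun j _ => hκ j) univ_nonempty
  have hl : 0 < lamK d κ := by rw [lamK]; linarith
  obtain ⟨C, hC, h⟩ := exists_abs_integral_gegenC_sphere_le hκ hm hl
  set w : ℝ := |(∫ t in cube (d + 1), wprod κ t)⁻¹| with hw
  have hw0 : 0 ≤ w := abs_nonneg _
  refine ⟨(w + 1) * ((1 + lamK d κ) / lamK d κ) * C, by positivity, fun n hn x y hx hy => ?_⟩
  have hn1 : (1 : ℝ) ≤ n := by exact_mod_cast hn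
  have hI := h n hn x y hx hy
  rw [← lamK] at hI
  rw [hP, abs_mul, abs_mul, ← hw, abs_of_pos (by positivity : 0 < ((n : ℝ) + lamK d κ) / lamK d κ)]
  set I := |∫ t in cube (d + 1), gegenC n (lamK d κ) (∑ i, x i * y i * t i) * wprod κ t|
  have hI0 : 0 ≤ I := abs_nonneg _
  calc w * ((n + lamK d κ) / lamK d κ) * I
      ≤ (w + 1) * (((1 + lamK d κ) * n) / lamK d κ) * I := by
        gcongr
        · linarith
        · nlinarith
    _ = (w + 1) * ((1 + lamK d κ) / lamK d κ) * (n * I) := by ring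
    _ ≤ _ := mul_le_mul_of_nonneg_left hI (by positivity)
    _ = _ := by ring
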